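/- Suppose φ : ℂ → ℝ is smooth, periodic and non-constant, that ∇(Δφ) ≠ 0 at every point of γ = (Δφ)^{−1}(0) ⊆ M, and that γ is connected, so that γ is a simple closed curve; let g : ℝ/Lℤ → M be a smooth unit-speed parametrization of γ of length L, and let n(t) = ±i g′(t) be the unit normal along γ, with the sign chosen so that the directional derivative ∂ₙΔφ(g(t)) := ⟨∇(Δφ)(g(t)), n(t)⟩ is positive for all t. Set κ = (1/2)·(3/2)^{2/3}·∫₀^L (∂ₙΔφ(g(t)))^{1/3} dt and M₊ = {Δφ > 0}. Then for every integer N ≥ 4 there exist constants C > 0 and τ₀ > 0 such that for every τ ∈ (0, τ₀]: limsup_{h→0⁺} | 2πh·N(e^{−τ/h}, h) − ( ∫_{M₊∩E} Δφ(z) L(dz) − τ^{2/3}·κ ) | ≤ C·(τ^{(N+1)/6} + τ). -/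

import Mathlib

open MeasureTheory Real Complex

noncomputable section

/-- `f : ℂ → α` is 2π-periodic in both the real and the imaginary direction. -/
def PeriodicC {α : Type*} (f : ℂ → α) : Prop :=
  ∀ z : ℂ, f (z + (2 * Real.pi : ℝ)) = f z ∧ f (z + (2 * Real.pi : ℝ) * Complex.I) = f z

/-- The Cauchy–Riemann operator `∂̄ = (∂ₓ + i ∂_y)/2`. -/
noncomputable def dbar (u : ℂ → ℂ) (z : ℂ) : ℂ :=
  (fderiv ℝ u z 1 + Complex.I * fderiv ℝ u z Complex.I) / 2

/-- The Laplacian `Δ = ∂ₓ² + ∂_y²` of a real-valued function on `ℂ ≅ ℝ²`. -/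
noncomputable def lapC (f : ℂ → ℝ) (z : ℂ) : ℝ :=
  fderiv ℝ (fun w => fderiv ℝ f w 1) z 1 +
    fderiv ℝ (fun w => fderiv ℝ f w Complex.I) z Complex.I

/-- The fundamental domain `E = [0,2π) × [0,2π)`. -/
def Efd : Set ℂ :=
  {z : ℂ | z.re ∈ Set.Ico 0 (2 * Real.pi) ∧ z.im ∈ Set.Ico 0 (2 * Real.pi)}

/-- The squared weighted norm `‖u‖_{φ,h}² = ∫_E |u|² e^{-2φ/h}`. -/
noncomputable def wInt (φ : ℂ → ℝ) (h : ℝ) (u : ℂ → ℂ) : ℝ :=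
  ∫ z in Efd, ‖u z‖ ^ 2 * Real.exp (-2 * φ z / h)

/-- The counting function `N(t,h)`: the supremum of `dim V` over finite-dimensional
complex subspaces `V` of smooth periodic functions on which `‖h ∂̄ u‖_{φ,h} ≤ t ‖u‖_{φ,h}`. -/
noncomputable def countN (φ : ℂ → ℝ) (t h : ℝ) : ℕ :=
  sSup {n : ℕ | ∃ V : Submodule ℂ (ℂ → ℂ),
    Module.finrank ℂ V = n ∧
    (∀ u ∈ V, ContDiff ℝ (⊤ : ℕ∞) u ∧ PeriodicC u) ∧
    (∀ u ∈ V, wInt φ h (fun z => (h : ℂ) * dbar u z) ≤ t ^ 2 * wInt φ h u)}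

/-- `v` is distributionally subharmonic on the open set `U`. -/
def DSubhOn (v : ℂ → ℝ) (U : Set ℂ) : Prop :=
  ∀ χ : ℂ → ℝ, ContDiff ℝ (⊤ : ℕ∞) χ → HasCompactSupport χ → (∀ z, 0 ≤ χ z) →
    tsupport χ ⊆ U → 0 ≤ ∫ z : ℂ, v z * lapC χ z

/-- `v` is distributionally superharmonic on the open set `U`. -/
def DSuphOn (v : ℂ → ℝ) (U : Set ℂ) : Prop :=
  ∀ χ : ℂ → ℝ, ContDiff ℝ (⊤ : ℕ∞) χ → HasCompactSupport χ → (∀ z, 0 ≤ χ z) →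
    tsupport χ ⊆ U → (∫ z : ℂ, v z * lapC χ z) ≤ 0

/-- The point `2π m + 2π i k` of the period lattice. -/
def lat (m k : ℤ) : ℂ := ((2 * π * (m : ℝ) : ℝ) : ℂ) + ((2 * π * (k : ℝ) : ℝ) : ℂ) * I

lemma lat_re (m k : ℤ) : (lat m k).re = 2 * π * m := by simp [lat]

lemma lat_im (m k : ℤ) : (lat m k).im = 2 * π * k := by simp [lat]

lemma lat_zero : lat 0 0 = 0 := by simp [lat]

lemma lat_add (m k m' k' : ℤ) : lat (m + m') (k + k') = lat m k + lat m' k' := by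
  simp [lat]; ring

lemma lat_neg (m k : ℤ) : lat (-m) (-k) = -lat m k := by
  simp [lat]; ring

lemma lat_sub (m k m' k' : ℤ) : lat (m - m') (k - k') = lat m k - lat m' k' := by
  simp [lat]; ring

/-- The period lattice as an additive subgroup. -/
def latGroup : AddSubgroup ℂ where
  carrier := {z | ∃ m k : ℤ, z = lat m k}
  zero_mem' := ⟨0, 0, lat_zero.symm⟩
  add_mem' := by
    rintro _ _ ⟨m, k, rfl⟩ ⟨m', k', rfl⟩
    exact ⟨m + m', k + k', (lat_add _ _ _ _).symm⟩
  neg_mem' := by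
    rintro _ ⟨m, k, rfl⟩
    exact ⟨-m, -k, (lat_neg _ _).symm⟩

lemma mem_latGroup {z : ℂ} : z ∈ latGroup ↔ ∃ m k : ℤ, z = lat m k := Iff.rfl

instance : Countable latGroup := by
  have : (latGroup : Set ℂ) = Set.range (fun p : ℤ × ℤ => lat p.1 p.2) := by
    ext z
    simp only [SetLike.mem_coe, mem_latGroup, Set.mem_range, Prod.exists, eq_comm]
  exact (this ▸ Set.countable_range _ : (latGroup : Set ℂ).Countable).to_subtype

lemma PeriodicC.add_lat {α : Type*} {f : ℂ → α} (hf : PeriodicC f) (m k : ℤ) (z : ℂ) :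
    f (z + lat m k) = f z := by
  have h1 : Function.Periodic f ((2 * π : ℝ) : ℂ) := fun z => (hf z).1
  have h2 : Function.Periodic f (((2 * π : ℝ) : ℂ) * I) := fun z => (hf z).2
  have e : z + lat m k = z + (m : ℂ) * ((2 * π : ℝ) : ℂ) + (k : ℂ) * (((2 * π : ℝ) : ℂ) * I) := by
    simp [lat]; ring
  rw [e, h2.int_mul k, h1.int_mul m]

lemma PeriodicC.of_lat {α : Type*} {f : ℂ → α} (hf : ∀ m k z, f (z + lat m k) = f z) :
    PeriodicC f := fun z => by
  have h1 := hf 1 0 z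
  have h2 := hf 0 1 z
  simp only [lat, Int.cast_one, Int.cast_zero, mul_one, mul_zero, ofReal_zero, zero_mul, add_zero,
    zero_add] at h1 h2
  exact ⟨h1, h2⟩

lemma PeriodicC.vadd {α : Type*} {f : ℂ → α} (hf : PeriodicC f) (l : latGroup) (z : ℂ) :
    f (l +ᵥ z) = f z := by
  obtain ⟨l, m, k, rfl⟩ := l
  have : (⟨lat m k, m, k, rfl⟩ : latGroup) +ᵥ z = z + lat m k := by
    rw [add_comm]; rfl
  rw [this, hf.add_lat]

lemma PeriodicC.comp {α β : Type*} {f : ℂ → α} (hf : PeriodicC f) (F : α → β) :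
    PeriodicC (fun z => F (f z)) :=
  fun z => ⟨congrArg F (hf z).1, congrArg F (hf z).2⟩

lemma PeriodicC.comp₂ {α β δ : Type*} {f : ℂ → α} {g : ℂ → β} (hf : PeriodicC f)
    (hg : PeriodicC g) (F : α → β → δ) :
    PeriodicC (fun z => F (f z) (g z)) :=
  fun z => ⟨congrArg₂ F (hf z).1 (hg z).1, congrArg₂ F (hf z).2 (hg z).2⟩

lemma PeriodicC.shift {α : Type*} {f : ℂ → α} (hf : PeriodicC f) (a : ℂ) :
    PeriodicC (fun z => f (z + a)) := fun z => by
  constructor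
  · beta_reduce; rw [← (hf (z + a)).1]; congr 1; ring
  · beta_reduce; rw [← (hf (z + a)).2]; congr 1; ring

lemma PeriodicC.fderiv {F : Type*} [NormedAddCommGroup F] [NormedSpace ℝ F] {f : ℂ → F}
    (hf : PeriodicC f) : PeriodicC (fderiv ℝ f) := fun z => by
  constructor
  · rw [← fderiv_comp_add_right]; congr 1; funext w; exact (hf w).1
  · rw [← fderiv_comp_add_right]; congr 1; funext w; exact (hf w).2

/-- The half-open period square with lower left corner `a`. -/
def Sq (a : ℂ) : Set ℂ := {z | z - a ∈ Efd}

lemma measurableSet_Efd : MeasurableSet Efd := by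
  have : Efd = Complex.re ⁻¹' Set.Ico 0 (2 * π) ∩ Complex.im ⁻¹' Set.Ico 0 (2 * π) := rfl
  rw [this]
  exact (Complex.measurable_re measurableSet_Ico).inter (Complex.measurable_im measurableSet_Ico)

lemma measurableSet_Sq (a : ℂ) : MeasurableSet (Sq a) :=
  measurableSet_Efd.preimage (measurable_id.sub_const a)

lemma Sq_zero : Sq 0 = Efd := by simp [Sq]

/-- Every point has a unique lattice translate in a half-open period square. -/
lemma exists_lat_mem_Sq (a z : ℂ) : ∃ m k : ℤ, z + lat m k ∈ Sq a := by
  have hp : (0 : ℝ) < 2 * π := by positivity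
  obtain ⟨m, hm, -⟩ := existsUnique_add_zsmul_mem_Ico hp (z.re - a.re) 0
  obtain ⟨k, hk, -⟩ := existsUnique_add_zsmul_mem_Ico hp (z.im - a.im) 0
  refine ⟨m, k, ?_, ?_⟩
  · simp only [zsmul_eq_mul, zero_add, Complex.sub_re, Complex.add_re, lat_re] at hm ⊢
    convert hm using 1; ring
  · simp only [zsmul_eq_mul, zero_add, Complex.sub_im, Complex.add_im, lat_im] at hk ⊢
    convert hk using 1; ring

lemma lat_unique_Sq {a z : ℂ} {m k m' k' : ℤ} (h : z + lat m k ∈ Sq a)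
    (h' : z + lat m' k' ∈ Sq a) : m = m' ∧ k = k' := by
  have hp : (0 : ℝ) < 2 * π := by positivity
  obtain ⟨⟨h1, h2⟩, h3, h4⟩ := h
  obtain ⟨⟨h1', h2'⟩, h3', h4'⟩ := h'
  simp only [Complex.sub_re, Complex.add_re, lat_re, Complex.sub_im, Complex.add_im, lat_im] at *
  have key : ∀ i j : ℤ, 2 * π * (i : ℝ) - 2 * π * j < 2 * π → i ≤ j := by
    intro i j hij
    have : (i : ℝ) - j < 1 := by
      by_contra hc
      push Not at hc
      nlinarith
    have : i - j < 1 := by exact_mod_cast this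
    omega
  exact ⟨le_antisymm (key _ _ (by linarith)) (key _ _ (by linarith)),
    le_antisymm (key _ _ (by linarith)) (key _ _ (by linarith))⟩

lemma isAddFundamentalDomain_Sq (a : ℂ) :
    IsAddFundamentalDomain latGroup (Sq a) (volume : Measure ℂ) := by
  refine IsAddFundamentalDomain.mk' (measurableSet_Sq a).nullMeasurableSet fun z => ?_
  obtain ⟨m, k, h⟩ := exists_lat_mem_Sq a z
  refine ⟨⟨lat m k, m, k, rfl⟩, ?_, ?_⟩
  · change lat m k + z ∈ Sq a
    rwa [add_comm]
  · rintro ⟨_, m', k', rfl⟩ h'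
    change lat m' k' + z ∈ Sq a at h'
    rw [add_comm] at h'
    obtain ⟨rfl, rfl⟩ := lat_unique_Sq h h'
    rfl

lemma isAddFundamentalDomain_Efd :
    IsAddFundamentalDomain latGroup Efd (volume : Measure ℂ) := by
  simpa [Sq_zero] using isAddFundamentalDomain_Sq 0

lemma setIntegral_Sq {F : Type*} [NormedAddCommGroup F] [NormedSpace ℝ F] {f : ℂ → F}
    (hf : PeriodicC f) (a : ℂ) : ∫ z in Sq a, f z = ∫ z in Efd, f z :=
  (isAddFundamentalDomain_Sq a).setIntegral_eq isAddFundamentalDomain_Efd fun l z => hf.vadd l z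

lemma integrableOn_Sq_iff {F : Type*} [NormedAddCommGroup F] {f : ℂ → F}
    (hf : PeriodicC f) (a : ℂ) : IntegrableOn f (Sq a) ↔ IntegrableOn f Efd :=
  (isAddFundamentalDomain_Sq a).integrableOn_iff isAddFundamentalDomain_Efd fun l z => hf.vadd l z

lemma setIntegral_Efd_shift {F : Type*} [NormedAddCommGroup F] [NormedSpace ℝ F] {f : ℂ → F}
    (hf : PeriodicC f) (a : ℂ) : ∫ z in Efd, f (z + a) = ∫ z in Efd, f z := by
  rw [← setIntegral_Sq hf a]
  have := (measurePreserving_add_right (volume : Measure ℂ) a).setIntegral_preimage_emb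
    (measurableEmbedding_addRight a) f (Sq a)
  rw [← this]
  congr 2
  ext z
  simp [Sq]

/-- A closed disc containing the fundamental domain. -/
lemma Efd_subset_closedBall : Efd ⊆ Metric.closedBall 0 (4 * π) := by
  rintro z ⟨⟨h1, h2⟩, h3, h4⟩
  rw [mem_closedBall_zero_iff]
  refine (Complex.norm_le_abs_re_add_abs_im z).trans ?_
  rw [abs_of_nonneg h1, abs_of_nonneg h3]
  linarith

lemma volume_Efd_lt_top : volume Efd < ⊤ :=
  (measure_mono Efd_subset_closedBall).trans_lt measure_closedBall_lt_top

instance : IsFiniteMeasure (volume.restrict Efd : Measure ℂ) :=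
  ⟨by simpa using volume_Efd_lt_top⟩

lemma Continuous.integrableOn_Efd {F : Type*} [NormedAddCommGroup F] {f : ℂ → F}
    (hf : Continuous f) : IntegrableOn f Efd :=
  (hf.continuousOn.integrableOn_compact (isCompact_closedBall 0 (4 * π))).mono_set
    Efd_subset_closedBall

lemma volumeReal_Efd : volume.real Efd = 4 * π ^ 2 := by
  have h := Complex.volume_preserving_equiv_real_prod.measure_preimage
    ((measurableSet_Ico (a := (0 : ℝ)) (b := 2 * π)).prod
      (measurableSet_Ico (a := (0 : ℝ)) (b := 2 * π))).nullMeasurableSet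
  have e : Complex.measurableEquivRealProd ⁻¹' (Set.Ico 0 (2 * π) ×ˢ Set.Ico 0 (2 * π)) = Efd := by
    ext z; rfl
  rw [e] at h
  rw [Measure.real, h, Measure.volume_eq_prod, Measure.prod_prod]
  simp only [Real.volume_Ico, ENNReal.toReal_mul, sub_zero]
  rw [ENNReal.toReal_ofReal (by positivity)]
  ring

/-- Continuous periodic functions are bounded. -/
lemma PeriodicC.bounded {F : Type*} [NormedAddCommGroup F] {f : ℂ → F} (hf : PeriodicC f)
    (hc : Continuous f) : ∃ C > 0, ∀ z, ‖f z‖ ≤ C := by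
  obtain ⟨C, hC⟩ := (isCompact_closedBall (0 : ℂ) (4 * π)).exists_bound_of_continuousOn
    hc.continuousOn
  refine ⟨max C 1, by positivity, fun z => ?_⟩
  obtain ⟨m, k, h⟩ := exists_lat_mem_Sq 0 z
  rw [Sq_zero] at h
  rw [← hf.add_lat m k]
  exact (hC _ (Efd_subset_closedBall h)).trans (le_max_left _ _)

/-- The discs of radius at most `π` embed in a period square. -/
lemma ball_subset_Sq {z : ℂ} {r : ℝ} (hr : r ≤ π) :
    Metric.ball z r ⊆ Sq (z - (π + π * I)) := by
  intro w hw
  rw [mem_ball_iff_norm] at hw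
  have h1 := (Complex.abs_re_le_norm (w - z)).trans_lt hw
  have h2 := (Complex.abs_im_le_norm (w - z)).trans_lt hw
  rw [abs_lt] at h1 h2
  simp only [Complex.sub_re, Complex.sub_im] at h1 h2
  refine ⟨⟨?_, ?_⟩, ?_, ?_⟩ <;> simp <;> linarith

/-- The mean of a derivative of a periodic function vanishes. -/
lemma integral_Efd_fderiv {f : ℂ → ℝ} (hf : PeriodicC f) (hc : ContDiff ℝ 1 f) (v : ℂ) :
    ∫ z in Efd, fderiv ℝ f z v = 0 := by
  have hd : Continuous (fun z => fderiv ℝ f z v) :=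
    (hc.continuous_fderiv one_ne_zero).clm_apply continuous_const
  have hdp : PeriodicC (fun z => fderiv ℝ f z v) := hf.fderiv.comp (fun T => T v)
  obtain ⟨C, -, hC⟩ := hdp.bounded hd
  have key := hasDerivAt_integral_of_dominated_loc_of_deriv_le (μ := volume.restrict Efd)
    (F := fun (s : ℝ) (z : ℂ) => f (z + s • v)) (F' := fun s z => fderiv ℝ f (z + s • v) v)
    (bound := fun _ => C) (x₀ := (0 : ℝ)) (s := Set.univ) Filter.univ_mem
    (Filter.Eventually.of_forall fun s =>
      (hc.continuous.comp (by fun_prop)).aestronglyMeasurable)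
    ((hc.continuous.comp (by fun_prop)).integrableOn_Efd)
    ((hd.comp (by fun_prop)).aestronglyMeasurable)
    (Filter.Eventually.of_forall fun z s _ => hC _) (integrable_const C)
    (Filter.Eventually.of_forall fun z s _ => by
      have h1 : HasDerivAt (fun s : ℝ => z + s • v) v s := by
        simpa using ((hasDerivAt_id s).smul_const v).const_add z
      exact ((hc.differentiable one_ne_zero) _).hasFDerivAt.comp_hasDerivAt s h1)
  have h0 := key.2
  simp only [zero_smul, add_zero] at h0
  have hconst : (fun s : ℝ => ∫ z in Efd, f (z + s • v)) = fun _ => ∫ z in Efd, f z := by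
    funext s; exact setIntegral_Efd_shift hf _
  rw [hconst] at h0
  exact h0.unique (hasDerivAt_const _ _)

lemma ContDiff.fderiv_apply_const {F : Type*} [NormedAddCommGroup F] [NormedSpace ℝ F]
    {f : ℂ → F} {m n : WithTop ℕ∞} (hf : ContDiff ℝ n f) (hmn : m + 1 ≤ n) (v : ℂ) :
    ContDiff ℝ m (fun z => fderiv ℝ f z v) :=
  (hf.fderiv_right hmn).clm_apply contDiff_const

lemma ContDiff.lapC {f : ℂ → ℝ} {m n : WithTop ℕ∞} (hf : ContDiff ℝ n f) (hmn : m + 2 ≤ n) :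
    ContDiff ℝ m (lapC f) := by
  have h : m + 1 + 1 ≤ n := by rw [add_assoc, one_add_one_eq_two]; exact hmn
  exact ((hf.fderiv_apply_const h 1).fderiv_apply_const le_rfl 1).add
    ((hf.fderiv_apply_const h I).fderiv_apply_const le_rfl I)

lemma ContDiff.continuous_lapC {f : ℂ → ℝ} (hf : ContDiff ℝ 2 f) : Continuous (_root_.lapC f) :=
  (hf.lapC (m := 0) (by simp)).continuous

lemma PeriodicC.lapC {f : ℂ → ℝ} (hf : PeriodicC f) : PeriodicC (lapC f) :=
  ((hf.fderiv.comp fun T => T 1).fderiv.comp fun T => T 1).comp₂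
    ((hf.fderiv.comp fun T => T I).fderiv.comp fun T => T I) (fun a b => a + b)

lemma integral_Efd_lapC {f : ℂ → ℝ} (hf : PeriodicC f) (hc : ContDiff ℝ 2 f) :
    ∫ z in Efd, lapC f z = 0 := by
  have h1 := hc.fderiv_apply_const (m := 1) (by norm_num) 1
  have h2 := hc.fderiv_apply_const (m := 1) (by norm_num) I
  have e : ∫ z in Efd, lapC f z = (∫ z in Efd, fderiv ℝ (fun w => fderiv ℝ f w 1) z 1) +
      ∫ z in Efd, fderiv ℝ (fun w => fderiv ℝ f w I) z I :=
    integral_add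
      ((h1.fderiv_apply_const (m := 0) (by simp) 1).continuous.integrableOn_Efd)
      ((h2.fderiv_apply_const (m := 0) (by simp) I).continuous.integrableOn_Efd)
  rw [e, integral_Efd_fderiv (hf.fderiv.comp fun T => T 1) h1,
    integral_Efd_fderiv (hf.fderiv.comp fun T => T I) h2, add_zero]

open Metric in
lemma integral_ball_radial (f : ℝ → ℝ) {r : ℝ} (hr : 0 ≤ r) :
    ∫ w in ball (0 : ℂ) r, f ‖w‖ = 2 * π * ∫ s in (0 : ℝ)..r, s * f s := by
  have h := integral_fun_norm_addHaar (volume : Measure ℂ) ((Set.Iio r).indicator f)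
  have e1 : ∫ w : ℂ, (Set.Iio r).indicator f ‖w‖ = ∫ w in ball (0 : ℂ) r, f ‖w‖ := by
    rw [← integral_indicator measurableSet_ball]
    refine integral_congr_ae (Filter.Eventually.of_forall fun w => ?_)
    by_cases hw : ‖w‖ < r <;> simp [Set.indicator, hw]
  have e2 : volume.real (ball (0 : ℂ) 1) = π := by
    simp [Measure.real, Complex.volume_ball]
  rw [e1, e2] at h
  rw [h, Complex.finrank_real_complex]
  simp only [smul_eq_mul, nsmul_eq_mul, Nat.cast_ofNat, Nat.add_one_sub_one, pow_one]
  rw [intervalIntegral.integral_of_le hr, integral_Ioc_eq_integral_Ioo, ← mul_assoc]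
  congr 1
  rw [← integral_indicator measurableSet_Ioi, ← integral_indicator measurableSet_Ioo]
  refine integral_congr_ae (Filter.Eventually.of_forall fun s => ?_)
  by_cases h1 : 0 < s <;> by_cases h2 : s < r <;> simp [Set.indicator, h1, h2]

lemma integral_ball_gaussian {b r : ℝ} (hb : 0 < b) (hr : 0 ≤ r) :
    ∫ w in Metric.ball (0 : ℂ) r, Real.exp (-b * ‖w‖ ^ 2) =
      π / b * (1 - Real.exp (-b * r ^ 2)) := by
  rw [integral_ball_radial (fun s => Real.exp (-b * s ^ 2)) hr]
  have hd : ∀ s : ℝ, HasDerivAt (fun s => -(1 / (2 * b)) * Real.exp (-b * s ^ 2))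
      (s * Real.exp (-b * s ^ 2)) s := fun s => by
    have h1 : HasDerivAt (fun s : ℝ => -b * s ^ 2) (-b * (2 * s)) s := by
      simpa using (hasDerivAt_pow 2 s).const_mul (-b)
    refine (h1.exp.const_mul (-(1 / (2 * b)))).congr_deriv ?_
    field_simp
  rw [intervalIntegral.integral_eq_sub_of_hasDerivAt (fun s _ => hd s)
    (Continuous.intervalIntegrable (by fun_prop) _ _)]
  simp
  field_simp
  ring

/-- Cauchy–Schwarz with respect to a nonnegative density. -/
lemma sq_integral_mul_le {α : Type*} [MeasurableSpace α] {μ : Measure α} {k f : α → ℝ}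
    (hk : ∀ x, 0 ≤ k x) (h0 : Integrable k μ) (h1 : Integrable (fun x => k x * f x) μ)
    (h2 : Integrable (fun x => k x * f x ^ 2) μ) :
    (∫ x, k x * f x ∂μ) ^ 2 ≤ (∫ x, k x ∂μ) * ∫ x, k x * f x ^ 2 ∂μ := by
  have key : ∀ t : ℝ, 0 ≤ (∫ x, k x ∂μ) * (t * t) + (-2 * ∫ x, k x * f x ∂μ) * t +
      ∫ x, k x * f x ^ 2 ∂μ := fun t => by
    have e : ∫ x, k x * (f x - t) ^ 2 ∂μ = (∫ x, k x ∂μ) * (t * t) +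
        (-2 * ∫ x, k x * f x ∂μ) * t + ∫ x, k x * f x ^ 2 ∂μ := by
      have : ∀ x, k x * (f x - t) ^ 2 = (t * t) * k x + (-2 * t) * (k x * f x) +
          k x * f x ^ 2 := fun x => by ring
      simp_rw [this]
      have h01 : Integrable (fun x => (t * t) * k x + (-2 * t) * (k x * f x)) μ :=
        (h0.const_mul _).add (h1.const_mul _)
      rw [integral_add h01 h2,
        integral_add (h0.const_mul _) (h1.const_mul _), integral_const_mul, integral_const_mul]
      ring
    rw [← e]
    exact integral_nonneg fun x => mul_nonneg (hk x) (sq_nonneg _)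
  have := discrim_le_zero key
  rw [discrim] at this
  nlinarith

/-- If all circle means of `v` are close to `v 0`, so is every radial average of `v`. -/
lemma norm_radial_mean_sub_le {v : ℂ → ℂ} {k : ℝ → ℝ} {r M : ℝ}
    (hv : ContinuousOn v (Metric.closedBall 0 r)) (hk : Continuous k) (hk0 : ∀ s, 0 ≤ k s)
    (hM : ∀ ρ, 0 ≤ ρ → ρ < r →
      ‖∫ θ in (0 : ℝ)..2 * π, (v (circleMap 0 ρ θ) - v 0)‖ ≤ 2 * π * M) :
    ‖(∫ w in Metric.ball (0 : ℂ) r, (k ‖w‖ : ℂ) * v w) -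
      ((∫ w in Metric.ball (0 : ℂ) r, k ‖w‖ : ℝ) : ℂ) * v 0‖ ≤
      M * ∫ w in Metric.ball (0 : ℂ) r, k ‖w‖ := by
  set B := Metric.ball (0 : ℂ) r
  have hBm : MeasurableSet B := Metric.isOpen_ball.measurableSet
  have hkn : Continuous (fun w : ℂ => k ‖w‖) := hk.comp continuous_norm
  have hki : IntegrableOn (fun w : ℂ => k ‖w‖) B :=
    (hkn.continuousOn.integrableOn_compact (isCompact_closedBall 0 r)).mono_set
      Metric.ball_subset_closedBall
  have hkc : IntegrableOn (fun w : ℂ => (k ‖w‖ : ℂ) * v w) B :=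
    (((Complex.continuous_ofReal.comp hkn).continuousOn.mul hv).integrableOn_compact
      (isCompact_closedBall 0 r)).mono_set Metric.ball_subset_closedBall
  set X := ∫ w in B, (k ‖w‖ : ℂ) * (v w - v 0) with hX
  have hXe : (∫ w in B, (k ‖w‖ : ℂ) * v w) - ((∫ w in B, k ‖w‖ : ℝ) : ℂ) * v 0 = X := by
    rw [hX]
    simp_rw [mul_sub]
    have hk1 : IntegrableOn (fun w : ℂ => (k ‖w‖ : ℂ) * v 0) B := hki.ofReal.mul_const _
    rw [integral_sub hkc hk1, integral_mul_const]
    congr 2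
    exact integral_ofReal.symm
  rw [hXe]
  have hrot : ∀ θ : ℝ, ∫ w in B, (k ‖w‖ : ℂ) * (v (w * Complex.exp (θ * I)) - v 0) = X := by
    intro θ
    have hmp := (rotation (Circle.exp θ)).measurePreserving
    have := hmp.setIntegral_preimage_emb (rotation (Circle.exp θ)).toMeasurableEquiv.measurableEmbedding
      (fun w => (k ‖w‖ : ℂ) * (v w - v 0)) B
    rw [hX, ← this]
    have hpre : (rotation (Circle.exp θ)) ⁻¹' B = B := by
      ext w
      simp only [Set.mem_preimage, B, mem_ball_zero_iff, LinearIsometryEquiv.norm_map]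
    rw [hpre]
    refine setIntegral_congr_fun hBm fun w _ => ?_
    simp [rotation_apply, mul_comm]
  have hcont : ContinuousOn (fun p : ℝ × ℂ => (k ‖p.2‖ : ℂ) *
      (v (p.2 * Complex.exp (p.1 * I)) - v 0)) (Set.Icc 0 (2 * π) ×ˢ Metric.closedBall 0 r) := by
    refine ContinuousOn.mul (by fun_prop) (ContinuousOn.sub ?_ continuousOn_const)
    refine hv.comp (by fun_prop) ?_
    rintro ⟨θ, w⟩ ⟨-, hw⟩
    simpa [Complex.norm_exp_ofReal_mul_I] using hw
  have h_int : Integrable (Function.uncurry fun (θ : ℝ) (w : ℂ) => (k ‖w‖ : ℂ) *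
      (v (w * Complex.exp (θ * I)) - v 0))
      ((volume.restrict (Set.uIoc 0 (2 * π))).prod (volume.restrict B)) := by
    rw [Measure.prod_restrict]
    refine (hcont.integrableOn_compact
      (isCompact_Icc.prod (isCompact_closedBall 0 r))).mono_set ?_
    rw [Set.uIoc_of_le (by positivity)]
    exact Set.prod_mono Set.Ioc_subset_Icc_self Metric.ball_subset_closedBall
  have hswap := intervalIntegral_integral_swap h_int
  simp_rw [hrot] at hswap
  have hbd : ∀ w ∈ B, ‖∫ θ in (0 : ℝ)..2 * π, (k ‖w‖ : ℂ) *
      (v (w * Complex.exp (θ * I)) - v 0)‖ ≤ k ‖w‖ * (2 * π * M) := by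
    intro w hw
    rw [intervalIntegral.integral_const_mul, norm_mul, Complex.norm_real,
      Real.norm_of_nonneg (hk0 _)]
    refine mul_le_mul_of_nonneg_left ?_ (hk0 _)
    refine le_of_eq_of_le ?_ (hM ‖w‖ (norm_nonneg _) (by simpa [B] using hw))
    congr 1
    have hper : Function.Periodic (fun θ => v (circleMap 0 ‖w‖ θ) - v 0) (2 * π) := fun θ => by
      simp only [periodic_circleMap 0 ‖w‖ θ]
    have h1 := hper.intervalIntegral_add_eq (w.arg) 0
    rw [zero_add] at h1
    rw [← h1, add_comm w.arg]
    have h2 := intervalIntegral.integral_comp_add_right (a := 0) (b := 2 * π)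
      (fun θ => v (circleMap 0 ‖w‖ θ) - v 0) w.arg
    rw [zero_add] at h2
    rw [← h2]
    refine intervalIntegral.integral_congr fun θ _ => ?_
    simp only [circleMap, zero_add, ofReal_add, add_mul, Complex.exp_add]
    conv_lhs => rw [← Complex.norm_mul_exp_arg_mul_I w]
    ring_nf
  have hfin : ‖∫ w in B, ∫ θ in (0 : ℝ)..2 * π, (k ‖w‖ : ℂ) *
      (v (w * Complex.exp (θ * I)) - v 0)‖ ≤ ∫ w in B, k ‖w‖ * (2 * π * M) :=
    norm_integral_le_of_norm_le (hki.mul_const _) ((ae_restrict_iff' hBm).2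
      (Filter.Eventually.of_forall hbd))
  rw [← hswap, intervalIntegral.integral_const, integral_mul_const, norm_smul] at hfin
  simp only [sub_zero, Real.norm_of_nonneg two_pi_pos.le] at hfin
  have : 2 * π * ‖X‖ ≤ 2 * π * (M * ∫ w in B, k ‖w‖) := by linarith
  exact le_of_mul_le_mul_left this two_pi_pos

/-- A local Bessel inequality: approximate point evaluations of an orthonormal family with
respect to the weight `ψ` are controlled by the Gaussian mass of a quadratic majorant of `ψ`. -/
lemma exists_approx_eval {ι : Type*} [Fintype ι] {u : ι → ℂ → ℂ} {ψ : ℂ → ℝ} {z a b : ℂ}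
    {r h B : ℝ} (hr : 0 < r) (hh : 0 < h) (hB : 0 < B)
    (hu : ∀ j, ContinuousOn (u j) (Metric.closedBall z r))
    (hψ : ContinuousOn ψ (Metric.closedBall z r))
    (hT : ∀ w : ℂ, ‖w‖ ≤ r → ψ (z + w) ≤ ψ z + (a * w + b * w ^ 2).re + B / 4 * ‖w‖ ^ 2)
    (hbes : ∀ c : ι → ℂ, ∫ w in Metric.ball z r, ‖∑ j, c j * u j w‖ ^ 2 *
      Real.exp (-2 * ψ w / h) ≤ ∑ j, ‖c j‖ ^ 2)
    (M : ι → ℝ)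
    (hM : ∀ j, ∀ ρ, 0 ≤ ρ → ρ < r → ‖∫ θ in (0 : ℝ)..2 * π,
      (u j (z + circleMap 0 ρ θ) * Complex.exp (-(a * circleMap 0 ρ θ + b * circleMap 0 ρ θ ^ 2) / h)
        - u j z)‖ ≤ 2 * π * M j) :
    ∃ α : ι → ℂ, (∀ j, ‖u j z - α j‖ ≤ M j) ∧
      (∑ j, ‖α j‖ ^ 2) * Real.exp (-2 * ψ z / h) ≤
        B / (2 * π * h * (1 - Real.exp (-B * r ^ 2 / (2 * h)))) := by
  set D := Metric.ball (0 : ℂ) r with hD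
  have hDm : MeasurableSet D := Metric.isOpen_ball.measurableSet
  have hDs : D ⊆ Metric.closedBall 0 r := Metric.ball_subset_closedBall
  set β := B / (2 * h) with hβ
  have hβ0 : 0 < β := by positivity
  set k : ℝ → ℝ := fun s => Real.exp (-β * s ^ 2) with hk
  have hkc : Continuous k := by fun_prop
  have hkn : Continuous (fun w : ℂ => k ‖w‖) := hkc.comp continuous_norm
  set Z := ∫ w in D, k ‖w‖ with hZ
  have hZe : Z = π / β * (1 - Real.exp (-β * r ^ 2)) := integral_ball_gaussian hβ0 hr.le
  have h1e : 0 < 1 - Real.exp (-β * r ^ 2) := by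
    rw [sub_pos, Real.exp_lt_one_iff]
    have : 0 < β * r ^ 2 := by positivity
    linarith
  have hZ0 : 0 < Z := by rw [hZe]; positivity
  have hZinv : Z⁻¹ = B / (2 * π * h * (1 - Real.exp (-B * r ^ 2 / (2 * h)))) := by
    have : -B * r ^ 2 / (2 * h) = -β * r ^ 2 := by rw [hβ]; ring
    rw [hZe, this, hβ]
    field_simp
  have hmap : Set.MapsTo (fun w => z + w) (Metric.closedBall 0 r) (Metric.closedBall z r) := by
    intro w hw
    simpa [mem_closedBall_iff_norm] using hw
  let P : ℂ → ℂ := fun w => Complex.exp (-(a * w + b * w ^ 2) / h)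
  have hPc : Continuous P := by fun_prop
  let v : ι → ℂ → ℂ := fun j w => u j (z + w) * P w
  have hvc : ∀ j, ContinuousOn (v j) (Metric.closedBall 0 r) := fun j =>
    ((hu j).comp (by fun_prop) hmap).mul hPc.continuousOn
  have hv0 : ∀ j, v j 0 = u j z := fun j => by simp [v, P]
  let α : ι → ℂ := fun j => (Z : ℂ)⁻¹ * ∫ w in D, (k ‖w‖ : ℂ) * v j w
  have hci : ∀ {f : ℂ → ℂ}, ContinuousOn f (Metric.closedBall 0 r) → IntegrableOn f D :=
    fun hf => (hf.integrableOn_compact (isCompact_closedBall 0 r)).mono_set hDs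
  have hri : ∀ {f : ℂ → ℝ}, ContinuousOn f (Metric.closedBall 0 r) → IntegrableOn f D :=
    fun hf => (hf.integrableOn_compact (isCompact_closedBall 0 r)).mono_set hDs
  refine ⟨α, fun j => ?_, ?_⟩
  · have h1 := norm_radial_mean_sub_le (v := v j) (k := k) (M := M j) (hvc j) hkc
      (fun s => (Real.exp_pos _).le) (fun ρ h0 h1 => by
        simp only [hv0]
        exact hM j ρ h0 h1)
    rw [hv0] at h1
    have e : u j z - α j = -((Z : ℂ)⁻¹ * ((∫ w in D, (k ‖w‖ : ℂ) * v j w) - (Z : ℂ) * u j z)) := by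
      have : (Z : ℂ) ≠ 0 := by exact_mod_cast hZ0.ne'
      simp only [α]
      field_simp
      ring
    rw [e, norm_neg, norm_mul, norm_inv, Complex.norm_real, Real.norm_of_nonneg hZ0.le]
    calc Z⁻¹ * _ ≤ Z⁻¹ * (M j * Z) := by gcongr
      _ = M j := by field_simp
  · set S := ∑ j, ‖α j‖ ^ 2 with hS
    have hS0 : 0 ≤ S := by positivity
    let W : ℂ → ℂ := fun w => ∑ j, (starRingEnd ℂ) (α j) * u j (z + w)
    have hWc : ContinuousOn W (Metric.closedBall 0 r) :=
      continuousOn_finsetSum _ fun j _ =>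
        continuousOn_const.mul ((hu j).comp (by fun_prop) hmap)
    have hSW : (Z : ℂ) * S = ∫ w in D, (k ‖w‖ : ℂ) * (W w * P w) := by
      have e1 : ∀ w, (k ‖w‖ : ℂ) * (W w * P w) =
          ∑ j, (starRingEnd ℂ) (α j) * ((k ‖w‖ : ℂ) * v j w) := fun w => by
        simp only [W, v, Finset.sum_mul, Finset.mul_sum]
        exact Finset.sum_congr rfl fun j _ => by ring
      simp_rw [e1]
      have hji : ∀ j, IntegrableOn
          (fun w => (starRingEnd ℂ) (α j) * ((k ‖w‖ : ℂ) * v j w)) D := fun j =>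
        (hci ((Complex.continuous_ofReal.comp hkn).continuousOn.mul (hvc j))).const_mul _
      rw [integral_finsetSum _ fun j _ => hji j]
      simp_rw [integral_const_mul]
      have e2 : ∀ j, ∫ w in D, (k ‖w‖ : ℂ) * v j w = Z * α j := fun j => by
        have : (Z : ℂ) ≠ 0 := by exact_mod_cast hZ0.ne'
        simp only [α]
        field_simp
      simp_rw [e2]
      rw [hS, ofReal_sum, Finset.mul_sum]
      refine Finset.sum_congr rfl fun j _ => ?_
      rw [ofReal_pow, ← Complex.conj_mul']
      ring
    let f : ℂ → ℝ := fun w => ‖W w * P w‖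
    have hfc : ContinuousOn f (Metric.closedBall 0 r) := (hWc.mul hPc.continuousOn).norm
    have h1 : Z * S ≤ ∫ w in D, k ‖w‖ * f w := by
      have : ‖(Z : ℂ) * S‖ = Z * S := by
        rw [norm_mul, Complex.norm_real, Complex.norm_real, Real.norm_of_nonneg hZ0.le,
          Real.norm_of_nonneg hS0]
      rw [← this, hSW]
      refine (norm_integral_le_integral_norm _).trans_eq ?_
      refine integral_congr_ae (Filter.Eventually.of_forall fun w => ?_)
      simp only [norm_mul, f, Complex.norm_real, Real.norm_of_nonneg (Real.exp_pos _).le, k]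
    have h2 := sq_integral_mul_le (μ := volume.restrict D) (k := fun w : ℂ => k ‖w‖) (f := f)
      (fun w => (Real.exp_pos _).le) (hri hkn.continuousOn) (hri (hkn.continuousOn.mul hfc))
      (hri (hkn.continuousOn.mul (hfc.pow 2)))
    have h3 : (∫ w in D, k ‖w‖ * f w ^ 2) ≤ Real.exp (2 * ψ z / h) * S := by
      have hc3 : ContinuousOn (fun w => ‖W w‖ ^ 2 * Real.exp (-2 * ψ (z + w) / h))
          (Metric.closedBall 0 r) :=
        (hWc.norm.pow 2).mul (Real.continuous_exp.comp_continuousOn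
          ((continuousOn_const.mul (hψ.comp (by fun_prop) hmap)).div_const _))
      calc (∫ w in D, k ‖w‖ * f w ^ 2)
          ≤ ∫ w in D, Real.exp (2 * ψ z / h) *
              (‖W w‖ ^ 2 * Real.exp (-2 * ψ (z + w) / h)) := by
            refine setIntegral_mono_on (hri (hkn.continuousOn.mul (hfc.pow 2)))
              ((hri hc3).const_mul _) hDm fun w hw => ?_
            have hw' : ‖w‖ ≤ r := by simpa using hDs hw
            simp only [f, norm_mul, P, Complex.norm_exp, k]
            have e3 : (-(a * w + b * w ^ 2) / (h : ℂ)).re = -(a * w + b * w ^ 2).re / h := by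
              rw [Complex.div_ofReal_re, Complex.neg_re]
            rw [e3, mul_pow, ← Real.exp_nat_mul]
            have : Real.exp (-β * ‖w‖ ^ 2) *
                Real.exp ((2 : ℕ) * (-(a * w + b * w ^ 2).re / h)) ≤
                Real.exp (2 * ψ z / h) * Real.exp (-2 * ψ (z + w) / h) := by
              rw [← Real.exp_add, ← Real.exp_add, Real.exp_le_exp]
              have := hT w hw'
              have e4 : -β * ‖w‖ ^ 2 + (2 : ℕ) * (-(a * w + b * w ^ 2).re / h) =
                  -2 * ((a * w + b * w ^ 2).re + B / 4 * ‖w‖ ^ 2) / h := by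
                rw [hβ]; push_cast; ring
              rw [e4, ← add_div]
              gcongr
              linarith
            nlinarith [sq_nonneg ‖W w‖]
        _ = Real.exp (2 * ψ z / h) *
              ∫ w in D, ‖W w‖ ^ 2 * Real.exp (-2 * ψ (z + w) / h) := integral_const_mul _ _
        _ ≤ Real.exp (2 * ψ z / h) * S := by
            gcongr
            have hb := hbes fun j => (starRingEnd ℂ) (α j)
            have e5 := (measurePreserving_add_left (volume : Measure ℂ) z).setIntegral_preimage_emb
              (measurableEmbedding_addLeft z) (fun w => ‖∑ j, (starRingEnd ℂ) (α j) * u j w‖ ^ 2 *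
                Real.exp (-2 * ψ w / h)) (Metric.ball z r)
            have e6 : (fun w => z + w) ⁻¹' Metric.ball z r = D := by
              ext w; simp [hD]
            rw [e6] at e5
            simp only [RCLike.norm_conj] at hb
            exact (e5.trans_le hb)
    have h4 : (Z * S) ^ 2 ≤ Z * (Real.exp (2 * ψ z / h) * S) := by
      refine (pow_le_pow_left₀ (by positivity) h1 2).trans (h2.trans ?_)
      exact mul_le_mul_of_nonneg_left h3 hZ0.le
    rw [← hZinv]
    rcases hS0.eq_or_lt with hS00 | hSpos
    · rw [← hS00, zero_mul]; positivity
    · have h5 : Z * S ≤ Real.exp (2 * ψ z / h) := by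
        have : (Z * S) * (Z * S) ≤ Real.exp (2 * ψ z / h) * (Z * S) := by nlinarith
        exact le_of_mul_le_mul_right this (by positivity)
      have e7 : Real.exp (2 * ψ z / h) * Real.exp (-2 * ψ z / h) = 1 := by
        rw [← Real.exp_add, ← Real.exp_zero]; congr 1; ring
      have h6 := mul_le_mul_of_nonneg_right h5 (Real.exp_pos (-2 * ψ z / h)).le
      rw [e7] at h6
      rw [inv_eq_one_div, le_div_iff₀ hZ0]
      linarith

lemma fderiv_fderiv_apply {F : Type*} [NormedAddCommGroup F] [NormedSpace ℝ F] {f : ℂ → F}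
    (hf : ContDiff ℝ 2 f) (z v w : ℂ) :
    fderiv ℝ (fun x => fderiv ℝ f x v) z w = fderiv ℝ (fderiv ℝ f) z w v := by
  have hd : DifferentiableAt ℝ (fderiv ℝ f) z :=
    ((hf.fderiv_right (m := 1) (by norm_num)).differentiable one_ne_zero) z
  rw [fderiv_clm_apply hd (differentiableAt_const v)]
  simp

lemma lapC_eq {f : ℂ → ℝ} (hf : ContDiff ℝ 2 f) (z : ℂ) :
    lapC f z = fderiv ℝ (fderiv ℝ f) z 1 1 + fderiv ℝ (fderiv ℝ f) z I I := by
  rw [lapC, fderiv_fderiv_apply hf, fderiv_fderiv_apply hf]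

/-- The decomposition of a real symmetric bilinear form on `ℂ` into trace and trace-free parts. -/
lemma symm_bilin_apply_self (T : ℂ →L[ℝ] ℂ →L[ℝ] ℝ) (hT : T 1 I = T I 1) (w : ℂ) :
    T w w = 2 * (((T 1 1 - T I I) / 4 - T 1 I / 2 * I : ℂ) * w ^ 2).re +
      (T 1 1 + T I I) / 2 * ‖w‖ ^ 2 := by
  have hw : w = w.re • (1 : ℂ) + w.im • I := by
    simp [Complex.re_add_im]
  have e : T w w = w.re ^ 2 * T 1 1 + 2 * (w.re * w.im) * T 1 I + w.im ^ 2 * T I I := by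
    conv_lhs => rw [hw]
    simp only [map_add, map_smul, add_apply, smul_apply,
      smul_eq_mul, hT]
    ring
  rw [e, ← Complex.normSq_eq_norm_sq, Complex.normSq_apply]
  simp [pow_two]
  ring

lemma exists_delta_of_continuous_normed {F : Type*} [NormedAddCommGroup F] {f : ℂ → F}
    {K : Set ℂ} (hK : IsCompact K) (hf : Continuous f) {ε : ℝ} (hε : 0 < ε) :
    ∃ δ > 0, ∀ x ∈ K, ∀ y ∈ K, dist x y ≤ δ → dist (f x) (f y) ≤ ε :=
  Metric.uniformContinuousOn_iff_le.1 (hK.uniformContinuousOn_of_continuous hf.continuousOn) ε hε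

/-- Uniform second order Taylor upper bound: up to the real part of a holomorphic quadratic
polynomial, a `C²` function is bounded by its Laplacian. -/
lemma exists_taylor_upper {ψ : ℂ → ℝ} (hψ : ContDiff ℝ 2 ψ) {K : Set ℂ} (hK : IsCompact K)
    {ε : ℝ} (hε : 0 < ε) : ∃ r₀ > 0, ∀ z ∈ K, ∃ a b : ℂ, ∀ w : ℂ, ‖w‖ ≤ r₀ →
      ψ (z + w) ≤ ψ z + (a * w + b * w ^ 2).re + (lapC ψ z + ε) / 4 * ‖w‖ ^ 2 := by
  have hd1 : ContDiff ℝ 1 (fderiv ℝ ψ) := hψ.fderiv_right (by norm_num)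
  have hd2 : Continuous (fderiv ℝ (fderiv ℝ ψ)) := hd1.continuous_fderiv one_ne_zero
  have hK' : IsCompact (Metric.cthickening 1 K) := hK.cthickening
  obtain ⟨δ, hδ, huc⟩ := exists_delta_of_continuous_normed
    (F := ℂ →L[ℝ] ℂ →L[ℝ] ℝ) hK' hd2 (ε := ε / 4) (by positivity)
  refine ⟨min δ 1, by positivity, fun z hz => ?_⟩
  set T := fderiv ℝ (fderiv ℝ ψ) z with hT
  have hsymm : ∀ x y, T x y = T y x :=
    (hψ.contDiffAt (x := z)).isSymmSndFDerivAt (by simp)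
  refine ⟨(fderiv ℝ ψ z 1 : ℂ) - fderiv ℝ ψ z I * I,
    ((T 1 1 - T I I) / 4 - T 1 I / 2 * I : ℂ), fun w hw => ?_⟩
  have hzK : ∀ x, ‖x‖ ≤ min δ 1 → z + x ∈ Metric.cthickening 1 K := fun x hx => by
    refine Metric.mem_cthickening_of_dist_le _ z _ _ hz ?_
    rw [dist_eq_norm, add_sub_cancel_left]
    exact hx.trans (min_le_right _ _)
  have hcb : Convex ℝ (Metric.closedBall (0 : ℂ) (min δ 1)) := convex_closedBall _ _
  have step1 : ∀ x, ‖x‖ ≤ min δ 1 → ‖fderiv ℝ ψ (z + x) - fderiv ℝ ψ z - T x‖ ≤ ε / 4 * ‖x‖ := by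
    intro x hx
    have hder : ∀ y ∈ Metric.closedBall (0 : ℂ) (min δ 1),
        HasFDerivWithinAt (fun y => fderiv ℝ ψ (z + y) - T y)
          (fderiv ℝ (fderiv ℝ ψ) (z + y) - T) (Metric.closedBall (0 : ℂ) (min δ 1)) y := by
      intro y _
      have h1 : HasFDerivAt (fun y => fderiv ℝ ψ (z + y)) (fderiv ℝ (fderiv ℝ ψ) (z + y)) y := by
        have := ((hd1.differentiable one_ne_zero) (z + y)).hasFDerivAt
        rw [← hasFDerivAt_comp_add_left] at this
        exact this
      exact (h1.sub T.hasFDerivAt).hasFDerivWithinAt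
    have := hcb.norm_image_sub_le_of_norm_hasFDerivWithin_le hder (C := ε / 4) (fun y hy => by
      have hy' : ‖y‖ ≤ min δ 1 := by simpa using hy
      rw [← dist_eq_norm]
      refine huc _ (hzK y hy') _ (by simpa using hzK 0 (by simp; positivity)) ?_
      rw [dist_eq_norm, add_sub_cancel_left]
      exact hy'.trans (min_le_left _ _))
      (Metric.mem_closedBall_self (by positivity)) (by simpa using hx)
    simp only [add_zero, map_zero, sub_zero] at this
    rwa [sub_right_comm] at this
  set r := ‖w‖ with hr
  have hder : ∀ y ∈ Metric.closedBall (0 : ℂ) r,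
      HasFDerivWithinAt (fun y => ψ (z + y) - fderiv ℝ ψ z y - T y y / 2)
        (fderiv ℝ ψ (z + y) - fderiv ℝ ψ z - T y) (Metric.closedBall (0 : ℂ) r) y := by
    intro y _
    have h1 : HasFDerivAt (fun y => ψ (z + y)) (fderiv ℝ ψ (z + y)) y := by
      have := ((hψ.differentiable two_ne_zero) (z + y)).hasFDerivAt
      rw [← hasFDerivAt_comp_add_left] at this
      exact this
    have h2 : HasFDerivAt (fun y => T y y) (T.precompR ℂ y (ContinuousLinearMap.id ℝ ℂ) +
        T.precompL ℂ (ContinuousLinearMap.id ℝ ℂ) y) y :=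
      T.hasFDerivAt_of_bilinear (hasFDerivAt_id y) (hasFDerivAt_id y)
    have h3 := ((h1.sub (fderiv ℝ ψ z).hasFDerivAt).sub (h2.const_mul (1 / 2 : ℝ)))
    have h4 : HasFDerivAt (fun y => ψ (z + y) - fderiv ℝ ψ z y - T y y / 2) _ y :=
      h3.congr_of_eventuallyEq (Filter.Eventually.of_forall fun y => by simp; ring)
    refine (h4.congr_fderiv ?_).hasFDerivWithinAt
    refine ContinuousLinearMap.ext fun x => ?_
    simp only [one_div, sub_apply, smul_apply, add_apply, ContinuousLinearMap.precompR_apply,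
      ContinuousLinearMap.precompL_apply, ContinuousLinearMap.compL_apply,
      ContinuousLinearMap.comp_id, ContinuousLinearMap.id_apply, smul_eq_mul]
    rw [hsymm x y]
    ring
  have h5 := (convex_closedBall (0 : ℂ) r).norm_image_sub_le_of_norm_hasFDerivWithin_le hder
    (C := ε / 4 * r) (fun y hy => by
      have hy' : ‖y‖ ≤ r := by simpa using hy
      exact (step1 y (hy'.trans hw)).trans (by gcongr))
    (Metric.mem_closedBall_self (norm_nonneg _)) (show w ∈ _ by simp [hr])
  simp only [add_zero, map_zero, sub_zero, zero_div] at h5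
  have h6 := (le_abs_self _).trans h5
  have h7 := symm_bilin_apply_self T (hsymm 1 I) w
  have h8 : (((fderiv ℝ ψ z 1 : ℂ) - fderiv ℝ ψ z I * I) * w).re = fderiv ℝ ψ z w := by
    have hw' : w = w.re • (1 : ℂ) + w.im • I := by simp [Complex.re_add_im]
    conv_rhs => rw [hw']
    simp only [map_add, map_smul, smul_eq_mul]
    simp
    ring
  rw [Complex.add_re, h8, lapC_eq hψ]
  rw [← hr] at h7
  nlinarith

lemma dbar_eq_apply (T : ℂ →L[ℝ] ℂ) (ζ : ℂ) :
    T ζ = (T 1 + I * T I) * (starRingEnd ℂ) ζ - I * T (I * ζ) := by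
  have h1 : ζ = ζ.re • (1 : ℂ) + ζ.im • I := by simp [Complex.re_add_im]
  have h2 : I * ζ = (-ζ.im) • (1 : ℂ) + ζ.re • I := by
    conv_lhs => rw [h1]
    simp only [Complex.real_smul]
    push_cast
    linear_combination (ζ.im : ℂ) * I_mul_I
  have h3 : (starRingEnd ℂ) ζ = ζ.re - ζ.im * I := by
    apply Complex.ext <;> simp
  rw [h2, h3]
  conv_lhs => rw [h1]
  simp only [map_add, map_smul]
  simp only [Complex.real_smul]
  push_cast
  linear_combination (ζ.im : ℂ) * T I * I_mul_I

lemma ContDiff.continuous_dbar {v : ℂ → ℂ} (hv : ContDiff ℝ 1 v) : Continuous (dbar v) := by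
  have h := hv.continuous_fderiv one_ne_zero
  unfold dbar
  fun_prop

/-- The measure `dσ dθ` on `(0, r] × (0, 2π]`. -/
def polarBox (r : ℝ) : Measure (ℝ × ℝ) :=
  (volume.restrict (Set.Ioc 0 r)).prod (volume.restrict (Set.Ioc 0 (2 * π)))

instance (r : ℝ) : IsFiniteMeasure (polarBox r) := by
  unfold polarBox; infer_instance

lemma continuous_circleMap_uncurry (c : ℂ) :
    Continuous (fun p : ℝ × ℝ => circleMap c p.1 p.2) := by
  unfold circleMap
  fun_prop

lemma integrable_polarBox {F : Type*} [NormedAddCommGroup F] {f : ℝ × ℝ → F}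
    (hf : Continuous f) (r : ℝ) : Integrable f (polarBox r) := by
  have hK : IsCompact (Set.Icc (0 : ℝ) r ×ˢ Set.Icc (0 : ℝ) (2 * π)) :=
    isCompact_Icc.prod isCompact_Icc
  have h : IntegrableOn f (Set.Icc (0 : ℝ) r ×ˢ Set.Icc (0 : ℝ) (2 * π)) volume :=
    hf.continuousOn.integrableOn_compact hK
  have h2 := h.mono_set (Set.prod_mono (Set.Ioc_subset_Icc_self (a := (0:ℝ)) (b := r))
    (Set.Ioc_subset_Icc_self (a := (0:ℝ)) (b := 2 * π)))
  rw [polarBox, Measure.prod_restrict]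
  exact h2

lemma polarBox_real_univ {r : ℝ} (hr : 0 ≤ r) : (polarBox r).real Set.univ = 2 * π * r := by
  rw [polarBox, ← Set.univ_prod_univ, measureReal_prod_prod]
  simp [hr, Real.two_pi_pos.le]
  ring

lemma integral_polarBox {F : Type*} [NormedAddCommGroup F] [NormedSpace ℝ F] {f : ℝ × ℝ → F} (hf : Continuous f) {r : ℝ} (hr : 0 ≤ r) :
    ∫ p, f p ∂(polarBox r) = ∫ σ in (0:ℝ)..r, ∫ θ in (0:ℝ)..(2 * π), f (σ, θ) := by
  have := integrable_polarBox hf r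
  rw [polarBox] at this ⊢
  rw [integral_prod _ this, intervalIntegral.integral_of_le hr]
  simp_rw [intervalIntegral.integral_of_le Real.two_pi_pos.le]

/-- Approximate mean value property on circles, with the defect controlled by `∂̄`. -/
lemma norm_circle_mean_sub_le {v : ℂ → ℂ} (hv : ContDiff ℝ 1 v) {ρ r : ℝ} (hρ : 0 ≤ ρ)
    (hρr : ρ ≤ r) :
    ‖∫ θ in (0:ℝ)..(2 * π), (v (circleMap 0 ρ θ) - v 0)‖ ≤
      2 * ∫ p, ‖dbar v (circleMap 0 p.1 p.2)‖ ∂(polarBox r) := by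
  have hcD := hv.continuous_fderiv one_ne_zero
  have hcd := hv.continuous_dbar
  have hcm := continuous_circleMap_uncurry 0
  have hexp : ∀ σ θ : ℝ, circleMap 0 σ θ = σ * cexp (θ * I) := fun σ θ => by simp [circleMap]
  have hftc : ∀ θ : ℝ, v (circleMap 0 ρ θ) - v 0 =
      ∫ σ in (0:ℝ)..ρ, fderiv ℝ v (circleMap 0 σ θ) (cexp (θ * I)) := by
    intro θ
    have := intervalIntegral.integral_eq_sub_of_hasDerivAt (a := 0) (b := ρ)
      (f := fun σ : ℝ => v (circleMap 0 σ θ))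
      (f' := fun σ : ℝ => fderiv ℝ v (circleMap 0 σ θ) (cexp (θ * I))) ?_ ?_
    · rw [this]; simp
    · intro σ _
      have h1 : HasDerivAt (fun σ : ℝ => circleMap 0 σ θ) (cexp (θ * I)) σ := by
        simp_rw [hexp]
        simpa using (Complex.ofRealCLM.hasDerivAt (x := σ)).mul_const (cexp (θ * I))
      exact ((hv.differentiable one_ne_zero) _).hasFDerivAt.comp_hasDerivAt σ h1
    · apply Continuous.intervalIntegrable
      have : Continuous (fun σ : ℝ => circleMap 0 σ θ) := by simp_rw [hexp]; fun_prop
      fun_prop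
  have hzero : ∀ σ : ℝ, σ ≠ 0 →
      ∫ θ in (0:ℝ)..(2 * π), fderiv ℝ v (circleMap 0 σ θ) (I * cexp (θ * I)) = 0 := by
    intro σ hσ
    have hd : ∀ θ : ℝ, HasDerivAt (fun θ : ℝ => v (circleMap 0 σ θ))
        (σ • fderiv ℝ v (circleMap 0 σ θ) (I * cexp (θ * I))) θ := by
      intro θ
      have := ((hv.differentiable one_ne_zero) _).hasFDerivAt.comp_hasDerivAt θ
        (hasDerivAt_circleMap 0 σ θ)
      refine this.congr_deriv ?_
      rw [← map_smul]
      congr 1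
      simp [hexp]; ring
    have := intervalIntegral.integral_eq_sub_of_hasDerivAt (a := 0) (b := 2 * π)
      (fun θ _ => hd θ) ?_
    · rw [intervalIntegral.integral_smul] at this
      have h2 : circleMap 0 σ (2 * π) = circleMap 0 σ 0 := by
        simpa using periodic_circleMap 0 σ 0
      rw [h2, sub_self] at this
      exact (smul_eq_zero.1 this).resolve_left hσ
    · apply Continuous.intervalIntegrable
      have := continuous_circleMap 0 σ
      fun_prop
  simp_rw [hftc]
  have hc1 : Continuous (fun p : ℝ × ℝ => fderiv ℝ v (circleMap 0 p.1 p.2) (cexp (p.2 * I))) := by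
    fun_prop
  have hc2 : Continuous (fun p : ℝ × ℝ =>
      2 * dbar v (circleMap 0 p.1 p.2) * (starRingEnd ℂ) (cexp (p.2 * I))) := by
    have := Complex.continuous_conj
    fun_prop
  have hswap : ∫ θ in (0:ℝ)..(2 * π), ∫ σ in (0:ℝ)..ρ,
      fderiv ℝ v (circleMap 0 σ θ) (cexp (θ * I)) =
      ∫ p, 2 * dbar v (circleMap 0 p.1 p.2) * (starRingEnd ℂ) (cexp (p.2 * I)) ∂(polarBox ρ) := by
    rw [intervalIntegral_intervalIntegral_swap, integral_polarBox hc2 hρ,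
      intervalIntegral.integral_of_le hρ, intervalIntegral.integral_of_le hρ]
    · refine setIntegral_congr_fun measurableSet_Ioc fun σ hσ => ?_
      have hθ : ∀ θ : ℝ, fderiv ℝ v (circleMap 0 σ θ) (cexp (θ * I)) =
          2 * dbar v (circleMap 0 σ θ) * (starRingEnd ℂ) (cexp (θ * I)) -
          I * fderiv ℝ v (circleMap 0 σ θ) (I * cexp (θ * I)) := fun θ => by
        rw [dbar_eq_apply, dbar]; ring
      simp only [hθ]
      have := continuous_circleMap 0 σ
      rw [intervalIntegral.integral_sub, intervalIntegral.integral_const_mul,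
        hzero σ hσ.1.ne', mul_zero, sub_zero]
      · exact (hc2.comp (by fun_prop : Continuous fun θ : ℝ => (σ, θ))).intervalIntegrable _ _
      · exact Continuous.intervalIntegrable (by fun_prop) _ _
    · have : IntegrableOn (fun p : ℝ × ℝ =>
          fderiv ℝ v (circleMap 0 p.2 p.1) (cexp (p.1 * I)))
          (Set.uIcc 0 (2 * π) ×ˢ Set.uIcc 0 ρ) :=
        (hc1.comp continuous_swap).continuousOn.integrableOn_compact
          (isCompact_uIcc.prod isCompact_uIcc)
      exact this.mono_set (Set.prod_mono Set.uIoc_subset_uIcc Set.uIoc_subset_uIcc)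
  rw [hswap, ← integral_const_mul]
  have hc3 : Continuous (fun p : ℝ × ℝ => 2 * ‖dbar v (circleMap 0 p.1 p.2)‖) := by fun_prop
  calc _ ≤ ∫ p, ‖2 * dbar v (circleMap 0 p.1 p.2) * (starRingEnd ℂ) (cexp (p.2 * I))‖
        ∂(polarBox ρ) := norm_integral_le_integral_norm _
    _ = ∫ p, 2 * ‖dbar v (circleMap 0 p.1 p.2)‖ ∂(polarBox ρ) := by
        refine integral_congr_ae (Filter.Eventually.of_forall fun p => ?_)
        simp [Complex.norm_exp]
    _ ≤ _ := by
        have := integrable_polarBox hc3 r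
        rw [polarBox, Measure.prod_restrict] at this ⊢
        rw [polarBox, Measure.prod_restrict]
        exact setIntegral_mono_set this (Filter.Eventually.of_forall fun p => by positivity)
          (Set.prod_mono (Set.Ioc_subset_Ioc_right hρr) subset_rfl).eventuallyLE

lemma dbar_mul_of_differentiableAt {u f : ℂ → ℂ} {z : ℂ} (hu : DifferentiableAt ℝ u z)
    (hf : DifferentiableAt ℂ f z) : dbar (fun w => u w * f w) z = dbar u z * f z := by
  have hf' : HasFDerivAt f ((fderiv ℂ f z).restrictScalars ℝ) z :=
    hf.hasFDerivAt.restrictScalars ℝ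
  have h := hu.hasFDerivAt.mul hf'
  have h2 : HasFDerivAt (fun w => u w * f w) _ z := h
  rw [dbar, dbar, h2.fderiv]
  simp only [add_apply, smul_apply, ContinuousLinearMap.coe_restrictScalars', smul_eq_mul]
  have h1 : fderiv ℂ f z I = I * fderiv ℂ f z 1 := by
    simp
  rw [h1]
  linear_combination (u z * fderiv ℂ f z 1 / 2) * I_mul_I

lemma dbar_comp_const_add {u : ℂ → ℂ} (z w : ℂ) :
    dbar (fun w => u (z + w)) w = dbar u (z + w) := by
  rw [dbar, dbar, fderiv_comp_add_left]

lemma sq_integral_le_of_finite {α : Type*} [MeasurableSpace α] {μ : Measure α}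
    [IsFiniteMeasure μ] {f : α → ℝ} (h1 : Integrable f μ)
    (h2 : Integrable (fun x => f x ^ 2) μ) :
    (∫ x, f x ∂μ) ^ 2 ≤ μ.real Set.univ * ∫ x, f x ^ 2 ∂μ := by
  have := sq_integral_mul_le (μ := μ) (k := fun _ => 1) (f := f) (fun _ => zero_le_one)
    (integrable_const 1) (by simpa using h1) (by simpa using h2)
  simpa using this

/-- Pointwise bound for a Bessel system in terms of the Laplacian of the weight, with an error
controlled by `∂̄`. -/
lemma sum_sq_le_of_taylor {ι : Type*} [Fintype ι] {u : ι → ℂ → ℂ} {ψ : ℂ → ℝ} {z a b : ℂ}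
    {r h B B₁ ε : ℝ} (hr : 0 < r) (hh : 0 < h) (hB : 0 < B) (hB₁ : B ≤ B₁) (hε : 0 < ε)
    (hu : ∀ j, ContDiff ℝ 1 (u j)) (hψ : Continuous ψ)
    (hT : ∀ w : ℂ, ‖w‖ ≤ r → ψ (z + w) ≤ ψ z + (a * w + b * w ^ 2).re + B / 4 * ‖w‖ ^ 2)
    (hbes : ∀ c : ι → ℂ, ∫ w in Metric.ball z r, ‖∑ j, c j * u j w‖ ^ 2 * Real.exp (-2 * ψ w / h) ≤
      ∑ j, ‖c j‖ ^ 2) :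
    (∑ j, ‖u j z‖ ^ 2) * Real.exp (-2 * ψ z / h) ≤
      (1 + ε) * (B / (2 * π * h * (1 - Real.exp (-B * r ^ 2 / (2 * h))))) +
      (1 + 1 / ε) * (2 * r / π * Real.exp (B₁ * r ^ 2 / (2 * h))) *
        ∑ j, ∫ p, ‖dbar (u j) (z + circleMap 0 p.1 p.2)‖ ^ 2 *
          Real.exp (-2 * ψ (z + circleMap 0 p.1 p.2) / h) ∂(polarBox r) := by
  set v : ι → ℂ → ℂ := fun j w => u j (z + w) * cexp (-(a * w + b * w ^ 2) / h) with hv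
  have hhol : ∀ w : ℂ, DifferentiableAt ℂ (fun w : ℂ => cexp (-(a * w + b * w ^ 2) / h)) w :=
    fun w => by fun_prop
  have hexpc : ContDiff ℝ 1 (fun w : ℂ => cexp (-(a * w + b * w ^ 2) / h)) := by
    fun_prop
  have hvc : ∀ j, ContDiff ℝ 1 (v j) := fun j =>
    ((hu j).comp (contDiff_const.add contDiff_id)).mul hexpc
  have hdv : ∀ j w, dbar (v j) w = dbar (u j) (z + w) * cexp (-(a * w + b * w ^ 2) / h) := by
    intro j w
    rw [hv]
    simp only
    rw [dbar_mul_of_differentiableAt (u := fun w => u j (z + w)) ?_ (hhol w), dbar_comp_const_add]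
    exact (((hu j).comp (contDiff_const.add contDiff_id)).differentiable one_ne_zero) w
  have hcm := continuous_circleMap_uncurry 0
  have hdc : ∀ j, Continuous (dbar (u j)) := fun j => (hu j).continuous_dbar
  have hdvc : ∀ j, Continuous (dbar (v j)) := fun j => (hvc j).continuous_dbar
  set M : ι → ℝ := fun j => (1 / π) * ∫ p, ‖dbar (v j) (circleMap 0 p.1 p.2)‖ ∂(polarBox r)
    with hM
  obtain ⟨α, hα1, hα2⟩ := exists_approx_eval (a := a) (b := b) hr hh hB
    (fun j => (hu j).continuous.continuousOn) hψ.continuousOn hT hbes M (fun j ρ hρ hρr => by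
      have := norm_circle_mean_sub_le (hvc j) hρ hρr.le
      have e : 2 * π * M j = 2 * ∫ p, ‖dbar (v j) (circleMap 0 p.1 p.2)‖ ∂(polarBox r) := by
        rw [hM]; field_simp
      rw [e]
      simpa [hv] using this)
  have hMsq : ∀ j, M j ^ 2 * Real.exp (-2 * ψ z / h) ≤
      (2 * r / π * Real.exp (B₁ * r ^ 2 / (2 * h))) *
        ∫ p, ‖dbar (u j) (z + circleMap 0 p.1 p.2)‖ ^ 2 *
          Real.exp (-2 * ψ (z + circleMap 0 p.1 p.2) / h) ∂(polarBox r) := by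
    intro j
    have hc1 : Continuous (fun p : ℝ × ℝ => ‖dbar (v j) (circleMap 0 p.1 p.2)‖) := by
      have := hdvc j
      fun_prop
    have hcs := sq_integral_le_of_finite (integrable_polarBox hc1 r)
      (integrable_polarBox (hc1.pow 2) r)
    rw [polarBox_real_univ hr.le] at hcs
    have hc2 : Continuous (fun p : ℝ × ℝ => ‖dbar (u j) (z + circleMap 0 p.1 p.2)‖ ^ 2 *
          Real.exp (-2 * ψ (z + circleMap 0 p.1 p.2) / h)) := by
      have := hdc j
      fun_prop
    have hpt : (∫ p, ‖dbar (v j) (circleMap 0 p.1 p.2)‖ ^ 2 ∂(polarBox r)) *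
        Real.exp (-2 * ψ z / h) ≤ Real.exp (B₁ * r ^ 2 / (2 * h)) *
        ∫ p, ‖dbar (u j) (z + circleMap 0 p.1 p.2)‖ ^ 2 *
          Real.exp (-2 * ψ (z + circleMap 0 p.1 p.2) / h) ∂(polarBox r) := by
      rw [← integral_mul_const, ← integral_const_mul]
      have i1 : Integrable (fun p : ℝ × ℝ => ‖dbar (v j) (circleMap 0 p.1 p.2)‖ ^ 2 *
        Real.exp (-2 * ψ z / h)) (polarBox r) :=
        integrable_polarBox (by have := hdvc j; fun_prop) r
      refine integral_mono_ae i1 ((integrable_polarBox hc2 r).const_mul _) ?_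
      have hae : ∀ᵐ p ∂(polarBox r), p.1 ∈ Set.Ioc 0 r := by
        rw [polarBox, Measure.prod_restrict]
        filter_upwards [ae_restrict_mem (measurableSet_Ioc.prod measurableSet_Ioc)] with p hp
        exact hp.1
      filter_upwards [hae] with p hp
      set w := circleMap 0 p.1 p.2 with hw
      have hwn : ‖w‖ ≤ r := by
        rw [hw]; simp [abs_of_pos hp.1, hp.2]
      simp only [hdv, norm_mul, mul_pow, Complex.norm_exp]
      rw [mul_left_comm, mul_assoc]
      refine mul_le_mul_of_nonneg_left ?_ (sq_nonneg _)
      rw [← Real.exp_nat_mul, ← Real.exp_add, ← Real.exp_add]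
      refine Real.exp_le_exp.2 ?_
      have hre : (-(a * w + b * w ^ 2) / (h : ℂ)).re = -(a * w + b * w ^ 2).re / h := by
        rw [Complex.div_ofReal_re, Complex.neg_re]
      rw [hre]
      have hTw := hT w hwn
      have hB₁0 : 0 ≤ B₁ := hB.le.trans hB₁
      have h3 : B / 4 * ‖w‖ ^ 2 ≤ B₁ / 4 * r ^ 2 := by gcongr
      have : 0 ≤ (2 / h) * (ψ z + (a * w + b * w ^ 2).re + B₁ / 4 * r ^ 2 - ψ (z + w)) :=
        mul_nonneg (by positivity) (by linarith)
      have e : (2 / h) * (ψ z + (a * w + b * w ^ 2).re + B₁ / 4 * r ^ 2 - ψ (z + w)) =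
        (B₁ * r ^ 2 / (2 * h) + -2 * ψ (z + w) / h) -
        ((2:ℕ) * (-(a * w + b * w ^ 2).re / h) + -2 * ψ z / h) := by
        push_cast; field_simp; ring
      linarith
    calc M j ^ 2 * Real.exp (-2 * ψ z / h)
        = 1 / π ^ 2 * ((∫ p, ‖dbar (v j) (circleMap 0 p.1 p.2)‖ ∂(polarBox r)) ^ 2 *
          Real.exp (-2 * ψ z / h)) := by rw [hM]; ring
      _ ≤ 1 / π ^ 2 * ((2 * π * r * ∫ p, ‖dbar (v j) (circleMap 0 p.1 p.2)‖ ^ 2 ∂(polarBox r)) *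
          Real.exp (-2 * ψ z / h)) := by gcongr
      _ = 2 * r / π * ((∫ p, ‖dbar (v j) (circleMap 0 p.1 p.2)‖ ^ 2 ∂(polarBox r)) *
          Real.exp (-2 * ψ z / h)) := by field_simp
      _ ≤ 2 * r / π * _ := mul_le_mul_of_nonneg_left hpt (by positivity)
      _ = _ := by ring
  have hpt : ∀ j, ‖u j z‖ ^ 2 ≤ (1 + ε) * ‖α j‖ ^ 2 + (1 + 1 / ε) * M j ^ 2 := by
    intro j
    have h1 : ‖u j z‖ ≤ ‖α j‖ + M j := by
      calc ‖u j z‖ = ‖α j + (u j z - α j)‖ := by congr 1; ring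
        _ ≤ _ := (norm_add_le _ _).trans (by gcongr; exact hα1 j)
    have h2 : 0 ≤ (ε * ‖α j‖ - M j) ^ 2 / ε := by positivity
    have h3 : (ε * ‖α j‖ - M j) ^ 2 / ε =
      (1 + ε) * ‖α j‖ ^ 2 + (1 + 1 / ε) * M j ^ 2 - (‖α j‖ + M j) ^ 2 := by field_simp; ring
    have h4 : ‖u j z‖ ^ 2 ≤ (‖α j‖ + M j) ^ 2 := by gcongr
    linarith
  calc (∑ j, ‖u j z‖ ^ 2) * Real.exp (-2 * ψ z / h)
      ≤ (∑ j, ((1 + ε) * ‖α j‖ ^ 2 + (1 + 1 / ε) * M j ^ 2)) * Real.exp (-2 * ψ z / h) := by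
        gcongr with j; exact hpt j
    _ = (1 + ε) * ((∑ j, ‖α j‖ ^ 2) * Real.exp (-2 * ψ z / h)) +
        (1 + 1 / ε) * ∑ j, M j ^ 2 * Real.exp (-2 * ψ z / h) := by
        rw [Finset.sum_add_distrib, ← Finset.mul_sum, ← Finset.mul_sum, ← Finset.sum_mul]; ring
    _ ≤ (1 + ε) * _ + (1 + 1 / ε) * ∑ j, _ :=
        add_le_add (mul_le_mul_of_nonneg_left hα2 (by positivity))
          (mul_le_mul_of_nonneg_left (Finset.sum_le_sum fun j _ => hMsq j) (by positivity))
    _ = _ := by rw [← Finset.mul_sum]; ring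

/-- Simultaneous diagonalization of a positive definite and a Hermitian form. -/
lemma exists_simultaneous_basis {V : Type*} [AddCommGroup V] [Module ℂ V] [FiniteDimensional ℂ V]
    (A B : V →ₗ⋆[ℂ] V →ₗ[ℂ] ℂ) (hA : ∀ x y, (starRingEnd ℂ) (A y x) = A x y)
    (hApos : ∀ x, x ≠ 0 → 0 < (A x x).re) (hB : ∀ x y, (starRingEnd ℂ) (B y x) = B x y) :
    ∃ (e : Module.Basis (Fin (Module.finrank ℂ V)) ℂ V) (lam : Fin (Module.finrank ℂ V) → ℝ),
      (∀ i j, A (e i) (e j) = if i = j then 1 else 0) ∧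
      (∀ i j, B (e i) (e j) = if i = j then (lam i : ℂ) else 0) := by
  let core : InnerProductSpace.Core ℂ V :=
    { inner := fun x y => A x y
      conj_inner_symm := hA
      re_inner_nonneg := fun x => by
        by_cases h : x = 0
        · simp [h]
        · exact (hApos x h).le
      add_left := fun x y z => by simp
      smul_left := fun x y r => by simp
      definite := fun x hx => by
        by_contra h
        have := hApos x h
        rw [hx] at this
        simp at this }
  let : NormedAddCommGroup V := core.toNormedAddCommGroup
  let : InnerProductSpace ℂ V := InnerProductSpace.ofCore core.toCore
  have : CompleteSpace V := FiniteDimensional.complete ℂ V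
  let T : V →ₗ[ℂ] V :=
    { toFun := fun x => (InnerProductSpace.toDual ℂ V).symm (LinearMap.toContinuousLinearMap (B x))
      map_add' := fun x y => by simp
      map_smul' := fun r x => by
        simp only [LinearMap.map_smulₛₗ, map_smul, RingHom.id_apply]
        rw [LinearIsometryEquiv.map_smulₛₗ]
        simp }
  have hT : ∀ x y, inner ℂ (T x) y = B x y := fun x y => by
    simp [T, InnerProductSpace.toDual_symm_apply]
  have hsym : T.IsSymmetric := fun x y => by
    rw [hT, ← inner_conj_symm, hT, hB]
  refine ⟨(hsym.eigenvectorBasis rfl).toBasis, hsym.eigenvalues rfl, fun i j => ?_, fun i j => ?_⟩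
  · have := (orthonormal_iff_ite.1 (hsym.eigenvectorBasis rfl).orthonormal) i j
    simp only [OrthonormalBasis.coe_toBasis]
    exact this
  · rw [← hT]
    simp only [OrthonormalBasis.coe_toBasis, hsym.apply_eigenvectorBasis]
    rw [inner_smul_left, (orthonormal_iff_ite.1 (hsym.eigenvectorBasis rfl).orthonormal) i j]
    split_ifs <;> simp

/-- Simultaneous diagonalization of two weighted `L²` forms on the span of finitely many
functions. -/
lemma exists_simultaneous_functions {X ι : Type*} [MeasurableSpace X] {μ : Measure X} [Fintype ι]
    {f : ι → X → ℂ} {wA wB : X → ℝ}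
    (hA : ∀ k l, Integrable (fun x => (starRingEnd ℂ) (f k x) * f l x * wA x) μ)
    (hB : ∀ k l, Integrable (fun x => (starRingEnd ℂ) (f k x) * f l x * wB x) μ)
    (hpos : ∀ c : ι → ℂ, c ≠ 0 → 0 < ∫ x, ‖∑ k, c k * f k x‖ ^ 2 * wA x ∂μ) :
    ∃ (e : Fin (Fintype.card ι) → ι → ℂ) (lam : Fin (Fintype.card ι) → ℝ),
      LinearIndependent ℂ e ∧
      (∀ c : Fin (Fintype.card ι) → ℂ,
        ∫ x, ‖∑ i, c i * ∑ k, e i k * f k x‖ ^ 2 * wA x ∂μ = ∑ i, ‖c i‖ ^ 2) ∧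
      (∀ c : Fin (Fintype.card ι) → ℂ,
        ∫ x, ‖∑ i, c i * ∑ k, e i k * f k x‖ ^ 2 * wB x ∂μ = ∑ i, lam i * ‖c i‖ ^ 2) := by
  have expand : ∀ (w : X → ℝ) (c d : ι → ℂ) (x : X),
      (starRingEnd ℂ) (∑ k, c k * f k x) * (∑ k, d k * f k x) * w x =
      ∑ k, ∑ l, (starRingEnd ℂ) (c k) * d l * ((starRingEnd ℂ) (f k x) * f l x * w x) := by
    intro w c d x
    rw [map_sum, Finset.sum_mul_sum, Finset.sum_mul]
    refine Finset.sum_congr rfl fun k _ => ?_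
    rw [Finset.sum_mul]
    refine Finset.sum_congr rfl fun l _ => ?_
    rw [map_mul]; ring
  have h_int : ∀ (w : X → ℝ),
      (∀ k l, Integrable (fun x => (starRingEnd ℂ) (f k x) * f l x * w x) μ) → ∀ c d : ι → ℂ,
      Integrable (fun x => (starRingEnd ℂ) (∑ k, c k * f k x) * (∑ k, d k * f k x) * w x) μ := by
    intro w hw c d
    simp_rw [expand w]
    exact integrable_finsetSum _ fun k _ => integrable_finsetSum _ fun l _ => (hw k l).const_mul _
  have form : ∀ (w : X → ℝ),
      (∀ k l, Integrable (fun x => (starRingEnd ℂ) (f k x) * f l x * w x) μ) →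
      ∃ Q : (ι → ℂ) →ₗ⋆[ℂ] (ι → ℂ) →ₗ[ℂ] ℂ, ∀ c d, Q c d =
        ∫ x, (starRingEnd ℂ) (∑ k, c k * f k x) * (∑ k, d k * f k x) * w x ∂μ := by
    intro w hw
    refine ⟨LinearMap.mk₂'ₛₗ (starRingEnd ℂ) (RingHom.id ℂ)
      (fun c d => ∫ x, (starRingEnd ℂ) (∑ k, c k * f k x) * (∑ k, d k * f k x) * w x ∂μ)
      ?_ ?_ ?_ ?_, fun c d => rfl⟩
    · intro c c' d
      rw [← integral_add (h_int w hw c d) (h_int w hw c' d)]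
      congr 1; ext x
      simp only [Pi.add_apply, add_mul, Finset.sum_add_distrib, map_add]
    · intro r c d
      rw [smul_eq_mul, ← integral_const_mul]
      congr 1; ext x
      simp only [Pi.smul_apply, smul_eq_mul, mul_assoc, ← Finset.mul_sum, map_mul]
    · intro c d d'
      rw [← integral_add (h_int w hw c d) (h_int w hw c d')]
      congr 1; ext x
      simp only [Pi.add_apply, add_mul, Finset.sum_add_distrib, mul_add]
    · intro r c d
      rw [RingHom.id_apply, smul_eq_mul, ← integral_const_mul]
      congr 1; ext x
      simp only [Pi.smul_apply, smul_eq_mul, mul_assoc, ← Finset.mul_sum]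
      ring
  have herm : ∀ (w : X → ℝ) (c d : ι → ℂ), (starRingEnd ℂ)
      (∫ x, (starRingEnd ℂ) (∑ k, d k * f k x) * (∑ k, c k * f k x) * w x ∂μ) =
      ∫ x, (starRingEnd ℂ) (∑ k, c k * f k x) * (∑ k, d k * f k x) * w x ∂μ := by
    intro w c d
    rw [← integral_conj]
    congr 1; ext x
    simp only [map_mul, Complex.conj_conj, Complex.conj_ofReal]
    ring
  have hself : ∀ (w : X → ℝ) (c : ι → ℂ),
      ∫ x, (starRingEnd ℂ) (∑ k, c k * f k x) * (∑ k, c k * f k x) * w x ∂μ =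
      ((∫ x, ‖∑ k, c k * f k x‖ ^ 2 * w x ∂μ : ℝ) : ℂ) := by
    intro w c
    rw [← integral_complex_ofReal]
    congr 1; ext x
    rw [← Complex.normSq_eq_conj_mul_self, Complex.normSq_eq_norm_sq]
    simp
  obtain ⟨QA, hQA⟩ := form wA hA
  obtain ⟨QB, hQB⟩ := form wB hB
  obtain ⟨e, lam, h1, h2⟩ := exists_simultaneous_basis QA QB
    (fun c d => by rw [hQA, hQA, herm]) (fun c hc => by
      rw [hQA, hself, Complex.ofReal_re]; exact hpos c hc) (fun c d => by rw [hQB, hQB, herm])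
  have hcard : Module.finrank ℂ (ι → ℂ) = Fintype.card ι := by simp
  have hcomb : ∀ (c : Fin (Module.finrank ℂ (ι → ℂ)) → ℂ) (x : X),
      ∑ i, c i * ∑ k, e i k * f k x = ∑ k, (∑ i, c i • e i) k * f k x := by
    intro c x
    simp only [Finset.mul_sum, Finset.sum_apply, Pi.smul_apply, smul_eq_mul, Finset.sum_mul]
    rw [Finset.sum_comm]
    simp only [mul_assoc]
  have hQ : ∀ (Q : (ι → ℂ) →ₗ⋆[ℂ] (ι → ℂ) →ₗ[ℂ] ℂ) (m : Fin (Module.finrank ℂ (ι → ℂ)) → ℝ)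
      (_ : ∀ i j, Q (e i) (e j) = if i = j then (m i : ℂ) else 0)
      (c : Fin (Module.finrank ℂ (ι → ℂ)) → ℂ),
      Q (∑ i, c i • e i) (∑ i, c i • e i) = ((∑ i, m i * ‖c i‖ ^ 2 : ℝ) : ℂ) := by
    intro Q m hm c
    simp only [map_sum, LinearMap.map_smulₛₗ, LinearMap.sum_apply, LinearMap.smul_apply,
      hm, map_smul, smul_eq_mul, mul_ite, mul_zero, Finset.sum_ite_eq',
      Finset.mem_univ, if_true]
    push_cast
    refine Finset.sum_congr rfl fun i _ => ?_
    rw [← Complex.ofReal_pow, ← Complex.normSq_eq_norm_sq, Complex.normSq_eq_conj_mul_self]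
    ring
  rw [← hcard]
  refine ⟨fun i => e i, lam, e.linearIndependent, fun c => ?_, fun c => ?_⟩
  · simp_rw [hcomb]
    have := hQ QA (fun _ => 1) (fun i j => by simpa using h1 i j) c
    rw [hQA, hself] at this
    simpa using Complex.ofReal_injective this
  · simp_rw [hcomb]
    have := hQ QB lam h2 c
    rw [hQB, hself] at this
    exact Complex.ofReal_injective this

lemma setIntegral_Efd_ball_le {f : ℂ → ℝ} (hf : PeriodicC f) (hfi : IntegrableOn f Efd)
    (hf0 : ∀ z, 0 ≤ f z) {r : ℝ} (hr : r ≤ π) (z : ℂ) :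
    ∫ w in Metric.ball z r, f w ≤ ∫ w in Efd, f w := by
  rw [← setIntegral_Sq hf (z - (π + π * I))]
  exact setIntegral_mono_set ((integrableOn_Sq_iff hf _).2 hfi) (Filter.Eventually.of_forall hf0)
    (ball_subset_Sq hr).eventuallyLE

lemma setIntegral_Efd_pos {f : ℂ → ℝ} (hf : PeriodicC f) (hc : Continuous f)
    (hf0 : ∀ z, 0 ≤ f z) (hne : ∃ z, f z ≠ 0) : 0 < ∫ z in Efd, f z := by
  obtain ⟨z, hz⟩ := hne
  refine lt_of_lt_of_le ?_ (setIntegral_Efd_ball_le hf hc.integrableOn_Efd hf0 le_rfl z)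
  rw [setIntegral_pos_iff_support_of_nonneg_ae (Filter.Eventually.of_forall hf0)
    ((hc.continuousOn.integrableOn_compact (isCompact_closedBall z π)).mono_set
      Metric.ball_subset_closedBall)]
  exact ((hc.isOpen_support).inter Metric.isOpen_ball).measure_pos _
    ⟨z, hz, Metric.mem_ball_self Real.pi_pos⟩

lemma PeriodicC.dbar {u : ℂ → ℂ} (hu : PeriodicC u) : PeriodicC (dbar u) :=
  hu.fderiv.comp fun T => (T 1 + I * T I) / 2

lemma wInt_const_mul (ψ : ℂ → ℝ) (h : ℝ) (c : ℂ) (u : ℂ → ℂ) :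
    wInt ψ h (fun z => c * u z) = ‖c‖ ^ 2 * wInt ψ h u := by
  rw [wInt, wInt, ← integral_const_mul]
  congr 1; ext z
  rw [norm_mul]; ring

/-- The integrated form of the pointwise bound for an orthonormal system. -/
lemma card_le_of_orthonormal {ι : Type*} [Fintype ι] {u : ι → ℂ → ℂ} {ψ B : ℂ → ℝ}
    {r h B₀ B₁ ε δ : ℝ} (hr : 0 < r) (hrπ : r ≤ π) (hh : 0 < h) (hε : 0 < ε) (hB₀ : 0 < B₀)
    (hu : ∀ j, ContDiff ℝ 1 (u j)) (hup : ∀ j, PeriodicC (u j)) (hψ : Continuous ψ)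
    (hψp : PeriodicC ψ) (hB : ∀ z, B₀ ≤ B z) (hB₁ : ∀ z, B z ≤ B₁) (hBc : Continuous B)
    (hT : ∀ z ∈ Efd, ∃ a b : ℂ, ∀ w : ℂ, ‖w‖ ≤ r →
      ψ (z + w) ≤ ψ z + (a * w + b * w ^ 2).re + B z / 4 * ‖w‖ ^ 2)
    (hon : ∀ c : ι → ℂ, wInt ψ h (fun z => ∑ j, c j * u j z) = ∑ j, ‖c j‖ ^ 2)
    (hd : ∀ j, wInt ψ h (dbar (u j)) ≤ δ) :
    (Fintype.card ι : ℝ) ≤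
      (1 + ε) / (2 * π * h * (1 - Real.exp (-B₀ * r ^ 2 / (2 * h)))) * (∫ z in Efd, B z) +
      (1 + 1 / ε) * (4 * r ^ 2) * Real.exp (B₁ * r ^ 2 / (2 * h)) * δ * Fintype.card ι := by
  classical
  have hdc : ∀ j, Continuous (dbar (u j)) := fun j => (hu j).continuous_dbar
  have huc : ∀ j, Continuous (u j) := fun j => (hu j).continuous
  set H : ι → ℂ → ℝ := fun j z => ‖dbar (u j) z‖ ^ 2 * Real.exp (-2 * ψ z / h) with hH
  have hHc : ∀ j, Continuous (H j) := fun j => by have := hdc j; fun_prop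
  have hHp : ∀ j, PeriodicC (H j) := fun j =>
    (hup j).dbar.comp₂ hψp fun a b => ‖a‖ ^ 2 * Real.exp (-2 * b / h)
  set G : ι → ℂ → ℝ := fun j z => ∫ p, H j (z + circleMap 0 p.1 p.2) ∂(polarBox r) with hG
  have hcm := continuous_circleMap_uncurry 0
  have hGint : ∀ j, Integrable (fun q : ℂ × (ℝ × ℝ) => H j (q.1 + circleMap 0 q.2.1 q.2.2))
      ((volume.restrict Efd).prod (polarBox r)) := by
    intro j
    obtain ⟨C, -, hC⟩ := (hHp j).bounded (hHc j)
    have := hHc j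
    refine Integrable.of_bound (C := C) ?_ (Filter.Eventually.of_forall fun q => hC _)
    have hcont : Continuous (fun q : ℂ × (ℝ × ℝ) => H j (q.1 + circleMap 0 q.2.1 q.2.2)) := by
      fun_prop
    exact hcont.aestronglyMeasurable
  have hGi : ∀ j, IntegrableOn (G j) Efd := fun j => (hGint j).integral_prod_left
  have hGval : ∀ j, ∫ z in Efd, G j z = 2 * π * r * wInt ψ h (dbar (u j)) := by
    intro j
    rw [hG]
    simp only
    rw [integral_integral_swap (hGint j)]
    simp_rw [setIntegral_Efd_shift (hHp j)]
    rw [integral_const, polarBox_real_univ hr.le, smul_eq_mul]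
    rfl
  set q := 1 - Real.exp (-B₀ * r ^ 2 / (2 * h)) with hq
  have hq0 : 0 < q := by
    have : Real.exp (-B₀ * r ^ 2 / (2 * h)) < 1 := by
      rw [Real.exp_lt_one_iff]
      apply div_neg_of_neg_of_pos _ (by positivity)
      have : 0 < B₀ * r ^ 2 := by positivity
      linarith
    linarith
  set K := (1 + 1 / ε) * (2 * r / π * Real.exp (B₁ * r ^ 2 / (2 * h))) with hK
  have hpt : ∀ z ∈ Efd, ∑ j, ‖u j z‖ ^ 2 * Real.exp (-2 * ψ z / h) ≤
      (1 + ε) / (2 * π * h * q) * B z + K * ∑ j, G j z := by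
    intro z hz
    obtain ⟨a, b, hab⟩ := hT z hz
    have h1 := sum_sq_le_of_taylor (u := u) (z := z) hr hh (hB₀.trans_le (hB z)) (hB₁ z) hε hu hψ hab
      (fun c => by
        rw [← hon c]
        refine setIntegral_Efd_ball_le ?_ ?_ (fun z => by positivity) hrπ z
        · have : PeriodicC (fun z => ∑ j, c j * u j z) := fun z => by
            constructor
            · simp only [(hup _ z).1]
            · simp only [(hup _ z).2]
          exact this.comp₂ hψp fun a b => ‖a‖ ^ 2 * Real.exp (-2 * b / h)
        · refine Continuous.integrableOn_Efd ?_
          fun_prop)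
    rw [← Finset.sum_mul]
    refine h1.trans (add_le_add ?_ le_rfl)
    have h2 : q ≤ 1 - Real.exp (-B z * r ^ 2 / (2 * h)) := by
      rw [hq]
      have : Real.exp (-B z * r ^ 2 / (2 * h)) ≤ Real.exp (-B₀ * r ^ 2 / (2 * h)) := by
        refine Real.exp_le_exp.2 (div_le_div_of_nonneg_right ?_ (by positivity))
        have := mul_le_mul_of_nonneg_right (hB z) (sq_nonneg r)
        linarith
      linarith
    have hBz := hB₀.trans_le (hB z)
    calc (1 + ε) * (B z / (2 * π * h * (1 - Real.exp (-B z * r ^ 2 / (2 * h)))))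
        ≤ (1 + ε) * (B z / (2 * π * h * q)) := by gcongr
      _ = _ := by ring
  have hone : ∀ j, ∫ z in Efd, ‖u j z‖ ^ 2 * Real.exp (-2 * ψ z / h) = 1 := by
    intro j
    have := hon (Pi.single j 1)
    simpa [wInt, Pi.single_apply, apply_ite, ite_pow] using this
  have hint1 : ∀ j, IntegrableOn (fun z => ‖u j z‖ ^ 2 * Real.exp (-2 * ψ z / h)) Efd := fun j =>
    Continuous.integrableOn_Efd (by fun_prop)
  have hint2 : IntegrableOn (fun z => (1 + ε) / (2 * π * h * q) * B z) Efd :=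
    Continuous.integrableOn_Efd (by fun_prop)
  have hint3 : IntegrableOn (fun z => K * ∑ j, G j z) Efd :=
    (integrable_finsetSum _ fun j _ => hGi j).const_mul _
  calc (Fintype.card ι : ℝ) = ∫ z in Efd, ∑ j, ‖u j z‖ ^ 2 * Real.exp (-2 * ψ z / h) := by
        rw [integral_finsetSum _ fun j _ => hint1 j]
        simp only [hone]
        simp
    _ ≤ ∫ z in Efd, ((1 + ε) / (2 * π * h * q) * B z + K * ∑ j, G j z) :=
        setIntegral_mono_on (integrable_finsetSum _ fun j _ => hint1 j) (hint2.add hint3)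
          measurableSet_Efd hpt
    _ = (1 + ε) / (2 * π * h * q) * (∫ z in Efd, B z) +
        K * ∑ j, 2 * π * r * wInt ψ h (dbar (u j)) := by
        rw [integral_add hint2 hint3, integral_const_mul, integral_const_mul,
          integral_finsetSum _ fun j _ => hGi j]
        simp_rw [hGval]
    _ ≤ (1 + ε) / (2 * π * h * q) * (∫ z in Efd, B z) + K * ∑ j : ι, 2 * π * r * δ := by
        gcongr with j
        exact hd j
    _ = _ := by
        rw [Finset.sum_const, Finset.card_univ, nsmul_eq_mul, hK]
        field_simp
        ring

lemma tendsto_exp_neg_div_div_pow {c : ℝ} (hc : 0 < c) (k : ℕ) :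
    Filter.Tendsto (fun h : ℝ => Real.exp (-c / h) / h ^ k) (nhdsWithin 0 (Set.Ioi 0))
      (nhds 0) := by
  have h1 : Filter.Tendsto (fun x : ℝ => x ^ k * Real.exp (-c * x)) Filter.atTop (nhds 0) := by
    have := Real.tendsto_pow_mul_exp_neg_atTop_nhds_zero k
    have h2 := (this.comp (Filter.tendsto_id.const_mul_atTop hc)).const_mul ((c ^ k)⁻¹)
    rw [mul_zero] at h2
    refine h2.congr fun x => ?_
    simp only [Function.comp, id, mul_pow]
    field_simp
  refine (h1.comp tendsto_inv_nhdsGT_zero).congr fun h => ?_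
  simp only [Function.comp, inv_pow, div_eq_mul_inv]
  ring

/-- Upper bound for the dimension of admissible spaces through a comparison weight `ψ`. -/
theorem two_pi_mul_finrank_le {φ ψ : ℂ → ℝ} (hφ : Continuous φ) (hψ : ContDiff ℝ 2 ψ)
    (hψp : PeriodicC ψ) {τ τ' : ℝ} (hτ : τ' < τ) (h1 : ∀ z, φ z - τ' ≤ ψ z)
    (h2 : ∀ z, ψ z ≤ φ z) {ε : ℝ} (hε : 0 < ε) :
    ∃ h₀ > 0, ∀ h : ℝ, 0 < h → h ≤ h₀ → ∀ V : Submodule ℂ (ℂ → ℂ),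
      (∀ u ∈ V, ContDiff ℝ (⊤ : ℕ∞) u ∧ PeriodicC u) →
      (∀ u ∈ V, wInt φ h (fun z => (h : ℂ) * dbar u z) ≤
        Real.exp (-τ / h) ^ 2 * wInt φ h u) →
      2 * π * h * Module.finrank ℂ V ≤ (∫ z in Efd, max (lapC ψ z) 0) + ε := by
  set J := ∫ z in Efd, max (lapC ψ z) 0 with hJ
  have hlc : Continuous (lapC ψ) := hψ.continuous_lapC
  have hJ0 : 0 ≤ J := integral_nonneg fun z => le_max_right _ _
  obtain ⟨C, hC0, hC⟩ := hψp.lapC.bounded hlc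
  obtain ⟨ε₁, hε₁, hε₁1, hε₁J⟩ : ∃ ε₁ : ℝ, 0 < ε₁ ∧ ε₁ ≤ 1 ∧
      (1 + ε₁) * (J + 4 * π ^ 2 * ε₁) < J + ε := by
    refine ⟨min 1 (ε / (2 * (J + 8 * π ^ 2))), by positivity, min_le_left _ _, ?_⟩
    set x := min 1 (ε / (2 * (J + 8 * π ^ 2)))
    have hx0 : 0 < x := by positivity
    have hx1 : x ≤ 1 := min_le_left _ _
    have hx2 : x * (2 * (J + 8 * π ^ 2)) ≤ ε := by
      rw [← le_div_iff₀ (by positivity)]; exact min_le_right _ _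
    have : x * x ≤ x := by nlinarith
    have hp : 0 < π ^ 2 := by positivity
    nlinarith
  set B : ℂ → ℝ := fun z => max (lapC ψ z) 0 + ε₁ with hBdef
  have hBc : Continuous B := by fun_prop
  have hBint : ∫ z in Efd, B z = J + 4 * π ^ 2 * ε₁ := by
    rw [hBdef]
    have i1 : IntegrableOn (fun z => max (lapC ψ z) 0) Efd :=
      Continuous.integrableOn_Efd (by fun_prop)
    rw [integral_add i1 (integrable_const _), integral_const]
    simp [volumeReal_Efd, hJ]
  set B₁ := C + ε₁ with hB₁def
  have hB₁ : ∀ z, B z ≤ B₁ := fun z => by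
    have := (le_abs_self _).trans (hC z)
    simp only [hBdef, hB₁def]
    gcongr
    exact max_le this hC0.le
  obtain ⟨r₀, hr₀, hTay⟩ := exists_taylor_upper hψ (isCompact_closedBall (0 : ℂ) (4 * π)) hε₁
  set r := min (min r₀ π) (Real.sqrt (2 * (τ - τ') / B₁)) with hrdef
  have hττ : 0 < τ - τ' := sub_pos.2 hτ
  have hr : 0 < r := by positivity
  have hrπ : r ≤ π := (min_le_left _ _).trans (min_le_right _ _)
  have hrr₀ : r ≤ r₀ := (min_le_left _ _).trans (min_le_left _ _)
  have hrB : B₁ * r ^ 2 ≤ 2 * (τ - τ') := by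
    have h3 : r ^ 2 ≤ 2 * (τ - τ') / B₁ := by
      calc r ^ 2 ≤ (Real.sqrt (2 * (τ - τ') / B₁)) ^ 2 := by
            gcongr; exact min_le_right _ _
        _ = _ := Real.sq_sqrt (by positivity)
    rw [le_div_iff₀ (by positivity)] at h3
    linarith
  -- the error terms in the limit
  set K := (1 + 1 / ε₁) * (4 * r ^ 2) with hK
  have hlim : Filter.Tendsto (fun h : ℝ => (1 + ε₁) * (J + 4 * π ^ 2 * ε₁) /
      ((1 - Real.exp (-(ε₁ * r ^ 2 / 2) / h) / h ^ 0) *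
        (1 - K * (Real.exp (-(τ - τ') / h) / h ^ 2)))) (nhdsWithin 0 (Set.Ioi 0))
      (nhds ((1 + ε₁) * (J + 4 * π ^ 2 * ε₁) / ((1 - 0) * (1 - K * 0)))) := by
    refine tendsto_const_nhds.div (Filter.Tendsto.mul ?_ ?_) (by simp)
    · exact tendsto_const_nhds.sub (tendsto_exp_neg_div_div_pow (by positivity) 0)
    · exact tendsto_const_nhds.sub ((tendsto_exp_neg_div_div_pow hττ 2).const_mul K)
  have hlim2 : Filter.Tendsto (fun h : ℝ => K * (Real.exp (-(τ - τ') / h) / h ^ 2))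
      (nhdsWithin 0 (Set.Ioi 0)) (nhds (K * 0)) :=
    (tendsto_exp_neg_div_div_pow hττ 2).const_mul K
  have hev := (hlim.eventually_lt_const (u := J + ε) (by simpa using hε₁J)).and
    (hlim2.eventually_lt_const (u := 1) (by simp))
  rw [eventually_nhdsWithin_iff, Metric.eventually_nhds_iff] at hev
  obtain ⟨h₀, hh₀, hev⟩ := hev
  refine ⟨h₀ / 2, by positivity, fun h hh hhle V hV hVle => ?_⟩
  obtain ⟨hev1, hev2⟩ := hev (y := h) (by simp [abs_of_pos hh]; linarith) hh
  by_cases hfin : FiniteDimensional ℂ V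
  swap
  · rw [Module.finrank_of_not_finite hfin]
    simp only [Nat.cast_zero, mul_zero]
    positivity
  -- an orthonormal basis for the weight `ψ`
  set d := Module.finrank ℂ V with hddef
  set b := Module.finBasis ℂ V with hb
  set f : Fin d → ℂ → ℂ := fun k => (b k : ℂ → ℂ) with hf
  have hfc : ∀ k, ContDiff ℝ (⊤ : ℕ∞) (f k) := fun k => (hV _ (b k).2).1
  have hfp : ∀ k, PeriodicC (f k) := fun k => (hV _ (b k).2).2
  have hfcc : ∀ k, Continuous (f k) := fun k => (hfc k).continuous
  have hψc : Continuous ψ := hψ.continuous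
  have hgram : ∀ k l, Integrable (fun x => (starRingEnd ℂ) (f k x) * f l x *
      (Real.exp (-2 * ψ x / h) : ℝ)) (volume.restrict Efd) := fun k l => by
    have := Complex.continuous_conj
    have hc : Continuous (fun x => (starRingEnd ℂ) (f k x) * f l x *
      ((Real.exp (-2 * ψ x / h) : ℝ) : ℂ)) := by fun_prop
    exact hc.integrableOn_Efd
  have hmem : ∀ c : Fin d → ℂ, (fun z => ∑ k, c k * f k z) = ((∑ k, c k • b k : V) : ℂ → ℂ) := by
    intro c
    ext z
    simp [hf]
  obtain ⟨e, lam, -, hon, -⟩ := exists_simultaneous_functions (f := f)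
    (μ := volume.restrict Efd) (wA := fun x => Real.exp (-2 * ψ x / h))
    (wB := fun x => Real.exp (-2 * ψ x / h)) hgram hgram (fun c hc => by
      have hne : (∑ k, c k • b k : V) ≠ 0 := by
        intro h0
        refine hc (funext fun k => ?_)
        exact (Fintype.linearIndependent_iff.1 b.linearIndependent c h0) k
      have hper : PeriodicC (fun z => ∑ k, c k * f k z) := by
        rw [hmem]; exact (hV _ (∑ k, c k • b k : V).2).2
      refine setIntegral_Efd_pos
        (hper.comp₂ hψp fun a b => ‖a‖ ^ 2 * Real.exp (-2 * b / h)) (by fun_prop)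
        (fun z => by positivity) ?_
      by_contra hcon
      push Not at hcon
      apply hne
      apply Subtype.ext
      rw [← hmem]
      ext z
      have := hcon z
      simpa [(Real.exp_pos _).ne'] using this)
  set u : Fin (Fintype.card (Fin d)) → ℂ → ℂ := fun i z => ∑ k, e i k * f k z with hu
  have huV : ∀ i, u i ∈ V := fun i => by
    rw [hu]; simp only; rw [hmem]; exact (∑ k, e i k • b k : V).2
  have hsmooth : ∀ i, ContDiff ℝ 1 (u i) := fun i => (hV _ (huV i)).1.of_le (by norm_cast)
  have hdbar : ∀ i, wInt ψ h (dbar (u i)) ≤ Real.exp (-2 * (τ - τ') / h) / h ^ 2 := by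
    intro i
    have hone : wInt ψ h (u i) = 1 := by
      have := hon (Pi.single i 1)
      simpa [wInt, hu, Pi.single_apply, apply_ite, ite_pow] using this
    have hdc := (hsmooth i).continuous_dbar
    have huc := (hsmooth i).continuous
    have e1 : wInt ψ h (dbar (u i)) ≤ Real.exp (2 * τ' / h) * wInt φ h (dbar (u i)) := by
      rw [wInt, wInt, ← integral_const_mul]
      refine setIntegral_mono_on (Continuous.integrableOn_Efd (by fun_prop))
        (Continuous.integrableOn_Efd (by fun_prop)) measurableSet_Efd fun z _ => ?_
      rw [mul_left_comm, ← Real.exp_add]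
      gcongr
      rw [← add_div]
      gcongr
      linarith [h1 z]
    have e2 : wInt φ h (u i) ≤ 1 := by
      rw [← hone, wInt, wInt]
      refine setIntegral_mono_on (Continuous.integrableOn_Efd (by fun_prop))
        (Continuous.integrableOn_Efd (by fun_prop)) measurableSet_Efd fun z _ => ?_
      gcongr ?_ * Real.exp (?_ / _)
      linarith [h2 z]
    have e3 := hVle _ (huV i)
    rw [wInt_const_mul] at e3
    have e4 : wInt φ h (dbar (u i)) ≤ Real.exp (-τ / h) ^ 2 / h ^ 2 := by
      rw [le_div_iff₀ (by positivity)]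
      calc wInt φ h (dbar (u i)) * h ^ 2 = ‖(h : ℂ)‖ ^ 2 * wInt φ h (dbar (u i)) := by
            simp [mul_comm]
        _ ≤ _ := e3
        _ ≤ Real.exp (-τ / h) ^ 2 * 1 := by gcongr
        _ = _ := mul_one _
    calc _ ≤ _ := e1
      _ ≤ Real.exp (2 * τ' / h) * (Real.exp (-τ / h) ^ 2 / h ^ 2) := by gcongr
      _ = _ := by
        rw [← Real.exp_nat_mul, mul_div_assoc', ← Real.exp_add]
        congr 2
        push_cast; ring
  have hfinal := card_le_of_orthonormal (u := u) (ψ := ψ) (B := B) (r := r) (h := h) (B₀ := ε₁)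
    (B₁ := B₁) (ε := ε₁) hr hrπ hh hε₁ hε₁ hsmooth (fun i => (hV _ (huV i)).2) hψc hψp
    (fun z => by simp [hBdef]) hB₁ hBc (fun z hz => by
      obtain ⟨a, b, hab⟩ := hTay z (Efd_subset_closedBall hz)
      refine ⟨a, b, fun w hw => (hab w (hw.trans hrr₀)).trans ?_⟩
      have : lapC ψ z + ε₁ ≤ B z := by simp [hBdef]
      gcongr) hon hdbar
  rw [hBint, Fintype.card_fin, Fintype.card_fin] at hfinal
  set q := 1 - Real.exp (-ε₁ * r ^ 2 / (2 * h)) with hq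
  have hqe : 1 - Real.exp (-(ε₁ * r ^ 2 / 2) / h) / h ^ 0 = q := by
    rw [hq, pow_zero, div_one]; congr 2; field_simp
  have hq0 : 0 < q := by
    rw [hq, sub_pos, Real.exp_lt_one_iff]
    apply div_neg_of_neg_of_pos _ (by positivity)
    have : 0 < ε₁ * r ^ 2 := by positivity
    linarith
  rw [hqe] at hev1
  set s := K * (Real.exp (-(τ - τ') / h) / h ^ 2) with hs
  have hs1 : (1 + 1 / ε₁) * (4 * r ^ 2) * Real.exp (B₁ * r ^ 2 / (2 * h)) *
      (Real.exp (-2 * (τ - τ') / h) / h ^ 2) ≤ s := by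
    rw [hs, hK, mul_assoc, mul_div_assoc', ← Real.exp_add]
    gcongr
    have : B₁ * r ^ 2 / (2 * h) ≤ (τ - τ') / h := by
      rw [div_le_div_iff₀ (by positivity) hh]
      nlinarith
    have e : -(τ - τ') / h = (τ - τ') / h + -2 * (τ - τ') / h := by field_simp; ring
    rw [e]
    gcongr
  have h4 : (d : ℝ) ≤ (1 + ε₁) / (2 * π * h * q) * (J + 4 * π ^ 2 * ε₁) + s * d :=
    hfinal.trans (by gcongr)
  have h5 : 2 * π * h * d ≤ (1 + ε₁) * (J + 4 * π ^ 2 * ε₁) / (q * (1 - s)) := by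
    have hs0 : 0 < 1 - s := by linarith
    rw [le_div_iff₀ (by positivity)]
    have h6 : d * (1 - s) ≤ (1 + ε₁) / (2 * π * h * q) * (J + 4 * π ^ 2 * ε₁) := by linarith
    calc 2 * π * h * d * (q * (1 - s)) = 2 * π * h * q * (d * (1 - s)) := by ring
      _ ≤ 2 * π * h * q * ((1 + ε₁) / (2 * π * h * q) * (J + 4 * π ^ 2 * ε₁)) := by gcongr
      _ = _ := by field_simp
  linarith

/-- Upper bound for the counting function through a comparison weight. -/
theorem two_pi_mul_countN_le {φ ψ : ℂ → ℝ} (hφ : Continuous φ) (hψ : ContDiff ℝ 2 ψ)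
    (hψp : PeriodicC ψ) {τ τ' : ℝ} (hτ : τ' < τ) (h1 : ∀ z, φ z - τ' ≤ ψ z)
    (h2 : ∀ z, ψ z ≤ φ z) {ε : ℝ} (hε : 0 < ε) :
    ∃ h₀ > 0, ∀ h : ℝ, 0 < h → h ≤ h₀ →
      2 * π * h * countN φ (Real.exp (-τ / h)) h ≤ (∫ z in Efd, max (lapC ψ z) 0) + ε := by
  obtain ⟨h₀, hh₀, H⟩ := two_pi_mul_finrank_le hφ hψ hψp hτ h1 h2 hε
  refine ⟨h₀, hh₀, fun h hh hle => ?_⟩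
  have hmem : countN φ (Real.exp (-τ / h)) h ∈ {n : ℕ | ∃ V : Submodule ℂ (ℂ → ℂ),
      Module.finrank ℂ V = n ∧ (∀ u ∈ V, ContDiff ℝ (⊤ : ℕ∞) u ∧ PeriodicC u) ∧
      (∀ u ∈ V, wInt φ h (fun z => (h : ℂ) * dbar u z) ≤
        Real.exp (-τ / h) ^ 2 * wInt φ h u)} := by
    refine Nat.sSup_mem ⟨0, ⊥, by simp, ?_, ?_⟩ ?_
    · intro u hu
      rw [Submodule.mem_bot] at hu
      subst hu
      exact ⟨contDiff_const, fun z => by simp⟩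
    · intro u hu
      rw [Submodule.mem_bot] at hu
      subst hu
      have e1 : (fun z => (h : ℂ) * dbar 0 z) = fun _ => 0 := by
        ext z
        have : fderiv ℝ (0 : ℂ → ℂ) z = 0 := fderiv_const_apply 0
        simp [dbar, this]
      rw [e1]
      simp [wInt]
    · refine ⟨⌈((∫ z in Efd, max (lapC ψ z) 0) + ε) / (2 * π * h)⌉₊, ?_⟩
      rintro n ⟨V, rfl, hV1, hV2⟩
      have := H h hh hle V hV1 hV2
      have h3 : (Module.finrank ℂ V : ℝ) ≤ ((∫ z in Efd, max (lapC ψ z) 0) + ε) / (2 * π * h) := by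
        rw [le_div_iff₀ (by positivity)]; linarith
      exact_mod_cast h3.trans (Nat.le_ceil _)
  obtain ⟨V, hVn, hV1, hV2⟩ := hmem
  rw [← hVn]
  exact H h hh hle V hV1 hV2

/-- Every admissible space bounds the counting function from below, for small `h`. -/
theorem finrank_le_countN {φ : ℂ → ℝ} (hφ : ContDiff ℝ 2 φ) (hφp : PeriodicC φ) {τ : ℝ}
    (hτ : 0 < τ) :
    ∃ h₀ > 0, ∀ h : ℝ, 0 < h → h ≤ h₀ → ∀ V : Submodule ℂ (ℂ → ℂ),
      (∀ u ∈ V, ContDiff ℝ (⊤ : ℕ∞) u ∧ PeriodicC u) →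
      (∀ u ∈ V, wInt φ h (fun z => (h : ℂ) * dbar u z) ≤
        Real.exp (-τ / h) ^ 2 * wInt φ h u) →
      Module.finrank ℂ V ≤ countN φ (Real.exp (-τ / h)) h := by
  obtain ⟨h₀, hh₀, H⟩ := two_pi_mul_finrank_le hφ.continuous hφ hφp (half_lt_self hτ)
    (fun z => by linarith) (fun z => le_rfl) one_pos
  refine ⟨h₀, hh₀, fun h hh hle V hV1 hV2 => le_csSup ?_ ⟨V, rfl, hV1, hV2⟩⟩
  refine ⟨⌈((∫ z in Efd, max (lapC φ z) 0) + 1) / (2 * π * h)⌉₊, ?_⟩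
  rintro n ⟨V, rfl, hV1, hV2⟩
  have := H h hh hle V hV1 hV2
  have h3 : (Module.finrank ℂ V : ℝ) ≤ ((∫ z in Efd, max (lapC φ z) 0) + 1) / (2 * π * h) := by
    rw [le_div_iff₀ (by positivity)]; linarith
  exact_mod_cast h3.trans (Nat.le_ceil _)

/-- The second derivative of the regularized `log √s`. -/
def regLog₂ (s : ℝ) : ℝ := -(1 / 2) * (max s 1 ^ 2)⁻¹

/-- The first derivative of the regularized `log √s`. -/
def regLog₁ (s : ℝ) : ℝ := 1 / 2 + ∫ t in (1:ℝ)..s, regLog₂ t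

/-- A `C²` function on `ℝ` which agrees with `log √s` for `s ≥ 1`. -/
def regLog₀ (s : ℝ) : ℝ := ∫ t in (1:ℝ)..s, regLog₁ t

lemma continuous_regLog₂ : Continuous regLog₂ := by
  unfold regLog₂
  refine continuous_const.mul (Continuous.inv₀ (by fun_prop) fun s => ?_)
  have : 0 < max s 1 := by positivity
  positivity

lemma hasDerivAt_regLog₁ (s : ℝ) : HasDerivAt regLog₁ (regLog₂ s) s :=
  (intervalIntegral.integral_hasDerivAt_right (continuous_regLog₂.intervalIntegrable _ _)
    (continuous_regLog₂.stronglyMeasurableAtFilter _ _) continuous_regLog₂.continuousAt).const_add _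

lemma continuous_regLog₁ : Continuous regLog₁ :=
  continuous_iff_continuousAt.2 fun s => (hasDerivAt_regLog₁ s).continuousAt

lemma hasDerivAt_regLog₀ (s : ℝ) : HasDerivAt regLog₀ (regLog₁ s) s :=
  intervalIntegral.integral_hasDerivAt_right (continuous_regLog₁.intervalIntegrable _ _)
    (continuous_regLog₁.stronglyMeasurableAtFilter _ _) continuous_regLog₁.continuousAt

lemma contDiff_regLog₀ : ContDiff ℝ 2 regLog₀ := by
  have e1 : deriv regLog₁ = regLog₂ := funext fun s => (hasDerivAt_regLog₁ s).deriv
  have e0 : deriv regLog₀ = regLog₁ := funext fun s => (hasDerivAt_regLog₀ s).deriv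
  have h1 : ContDiff ℝ 1 regLog₁ := by
    rw [contDiff_one_iff_deriv, e1]
    exact ⟨fun s => (hasDerivAt_regLog₁ s).differentiableAt, continuous_regLog₂⟩
  rw [show (2 : WithTop ℕ∞) = 1 + 1 by norm_num, contDiff_succ_iff_deriv, e0]
  exact ⟨fun s => (hasDerivAt_regLog₀ s).differentiableAt, by simp, h1⟩

lemma regLog₁_of_one_le {s : ℝ} (hs : 1 ≤ s) : regLog₁ s = (1 / 2) * s⁻¹ := by
  have : ∫ t in (1:ℝ)..s, regLog₂ t = (1 / 2) * s⁻¹ - (1 / 2) * (1 : ℝ)⁻¹ := by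
    refine intervalIntegral.integral_eq_sub_of_hasDerivAt (f := fun t : ℝ => (1 / 2) * t⁻¹)
      (fun t ht => ?_) (continuous_regLog₂.intervalIntegrable _ _)
    rw [Set.uIcc_of_le hs] at ht
    have ht0 : t ≠ 0 := by linarith [ht.1]
    refine ((hasDerivAt_inv ht0).const_mul (1 / 2)).congr_deriv ?_
    rw [regLog₂, max_eq_left ht.1]; ring
  rw [regLog₁, this]; ring

lemma regLog₁_of_le_one {s : ℝ} (hs : s ≤ 1) : regLog₁ s = 1 - s / 2 := by
  have : ∫ t in (1:ℝ)..s, regLog₂ t = ∫ t in (1:ℝ)..s, (-(1 / 2) : ℝ) := by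
    refine intervalIntegral.integral_congr fun t ht => ?_
    rw [Set.uIcc_of_ge hs] at ht
    rw [regLog₂, max_eq_right ht.2]; norm_num
  rw [regLog₁, this]; simp; ring

lemma regLog₀_of_one_le {s : ℝ} (hs : 1 ≤ s) : regLog₀ s = (1 / 2) * Real.log s := by
  have : ∫ t in (1:ℝ)..s, regLog₁ t = (1 / 2) * Real.log s - (1 / 2) * Real.log 1 := by
    refine intervalIntegral.integral_eq_sub_of_hasDerivAt (f := fun t : ℝ => (1 / 2) * Real.log t)
      (fun t ht => ?_) (continuous_regLog₁.intervalIntegrable _ _)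
    rw [Set.uIcc_of_le hs] at ht
    have ht0 : t ≠ 0 := by linarith [ht.1]
    refine ((Real.hasDerivAt_log ht0).const_mul (1 / 2)).congr_deriv ?_
    rw [regLog₁_of_one_le ht.1]
  rw [regLog₀, this]; simp

/-- The density `λ' + s λ''` of the regularized logarithm. -/
lemma regLog_density (s : ℝ) : regLog₁ s + s * regLog₂ s = max (1 - s) 0 := by
  rcases le_total s 1 with hs | hs
  · rw [regLog₁_of_le_one hs, regLog₂, max_eq_right hs, max_eq_left (by linarith)]; ring
  · have : s ≠ 0 := by linarith
    rw [regLog₁_of_one_le hs, regLog₂, max_eq_left hs, max_eq_right (by linarith)]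
    field_simp; ring

/-- A `C²` regularization of `log ‖z‖`, unchanged for `‖z‖ ≥ s`. -/
def regLog (s : ℝ) (z : ℂ) : ℝ := regLog₀ (‖z‖ ^ 2 / s ^ 2) + Real.log s

lemma norm_sq_eq_re_im (z : ℂ) : ‖z‖ ^ 2 = z.re ^ 2 + z.im ^ 2 := by
  rw [← Complex.normSq_eq_norm_sq, Complex.normSq_apply]; ring

lemma contDiff_regLog (s : ℝ) : ContDiff ℝ 2 (regLog s) := by
  unfold regLog
  have : ContDiff ℝ 2 (fun z : ℂ => ‖z‖ ^ 2 / s ^ 2) := (contDiff_norm_sq ℝ).div_const _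
  exact (contDiff_regLog₀.comp this).add contDiff_const

lemma regLog_of_le {s : ℝ} (hs : 0 < s) {z : ℂ} (hz : s ≤ ‖z‖) : regLog s z = Real.log ‖z‖ := by
  have hz0 : 0 < ‖z‖ := hs.trans_le hz
  rw [regLog, regLog₀_of_one_le (by rw [one_le_div (by positivity)]; gcongr), ← div_pow,
    Real.log_pow, Real.log_div hz0.ne' hs.ne']
  push_cast; ring

lemma lapC_regLog {s : ℝ} (hs : 0 < s) (z : ℂ) :
    lapC (regLog s) z = 4 / s ^ 2 * max (1 - ‖z‖ ^ 2 / s ^ 2) 0 := by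
  have hn : ∀ (w v : ℂ), HasFDerivAt (fun z : ℂ => ‖z‖ ^ 2 / s ^ 2)
      ((s ^ 2)⁻¹ • (2 : ℕ) • innerSL ℝ w) w := by
    intro w v
    have h1 : HasFDerivAt (fun z : ℂ => ‖z‖ ^ 2) ((2 : ℕ) • innerSL ℝ w) w :=
      (hasStrictFDerivAt_norm_sq w).hasFDerivAt
    have := h1.const_mul (s ^ 2)⁻¹
    refine this.congr_of_eventuallyEq (Filter.Eventually.of_forall fun z => ?_)
    simp [div_eq_inv_mul]
  have hfd : ∀ w v : ℂ, fderiv ℝ (regLog s) w v =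
      regLog₁ (‖w‖ ^ 2 / s ^ 2) * ((2 / s ^ 2) * inner ℝ w v) := by
    intro w v
    have h2 := ((hasDerivAt_regLog₀ (‖w‖ ^ 2 / s ^ 2)).comp_hasFDerivAt w (hn w v)).add_const
      (Real.log s)
    have h3 : HasFDerivAt (regLog s) _ w := h2
    rw [h3.fderiv]
    simp only [smul_apply, innerSL_apply_apply, smul_eq_mul, nsmul_eq_mul]
    push_cast
    ring
  have hfd2 : ∀ v : ℂ, fderiv ℝ (fun w => fderiv ℝ (regLog s) w v) z v =
      regLog₂ (‖z‖ ^ 2 / s ^ 2) * ((2 / s ^ 2) * inner ℝ z v) ^ 2 +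
      regLog₁ (‖z‖ ^ 2 / s ^ 2) * ((2 / s ^ 2) * inner ℝ v v) := by
    intro v
    simp_rw [hfd]
    have h2 := (hasDerivAt_regLog₁ (‖z‖ ^ 2 / s ^ 2)).comp_hasFDerivAt z (hn z v)
    have h4 : HasFDerivAt (fun w : ℂ => (2 / s ^ 2) * inner ℝ w v)
        ((2 / s ^ 2) • (innerSL ℝ v)) z := by
      have := ((innerSL ℝ v).hasFDerivAt (x := z)).const_mul (2 / s ^ 2)
      refine this.congr_of_eventuallyEq (Filter.Eventually.of_forall fun w => ?_)
      simp [real_inner_comm]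
    have h5 : HasFDerivAt (fun w => regLog₁ (‖w‖ ^ 2 / s ^ 2) * ((2 / s ^ 2) * inner ℝ w v)) _ z :=
      h2.mul h4
    rw [h5.fderiv]
    simp
    ring
  rw [lapC, hfd2, hfd2]
  have key := regLog_density (‖z‖ ^ 2 / s ^ 2)
  rw [← key]
  have e1 : inner ℝ z 1 = z.re := by simp [Complex.inner]
  have e2 : inner ℝ z I = z.im := by simp [Complex.inner]
  have e3 : inner ℝ (1 : ℂ) (1 : ℂ) = (1 : ℝ) := by simp
  have e4 : inner ℝ I I = (1 : ℝ) := by simp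
  rw [e1, e2, e3, e4, norm_sq_eq_re_im]
  field_simp
  ring

/-- The representative of `w` modulo the period lattice in the period square centred at `0`. -/
def latRed (w : ℂ) : ℂ :=
  w + lat (exists_lat_mem_Sq (0 - (π + π * I)) w).choose
    (exists_lat_mem_Sq (0 - (π + π * I)) w).choose_spec.choose

lemma exists_latRed_eq (w : ℂ) : ∃ m k : ℤ, latRed w = w - lat m k :=
  ⟨-(exists_lat_mem_Sq (0 - (π + π * I)) w).choose,
    -(exists_lat_mem_Sq (0 - (π + π * I)) w).choose_spec.choose, by rw [lat_neg, sub_neg_eq_add]; rfl⟩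

lemma latRed_eq_of_mem_Sq {w : ℂ} {m k : ℤ} (h : w - lat m k ∈ Sq (0 - (π + π * I))) :
    latRed w = w - lat m k := by
  have h1 := (exists_lat_mem_Sq (0 - (π + π * I)) w).choose_spec.choose_spec
  rw [sub_eq_add_neg w, ← lat_neg] at h
  obtain ⟨e1, e2⟩ := lat_unique_Sq h1 h
  have e3 := congrArg₂ lat e1 e2
  rw [lat_neg] at e3
  rw [sub_eq_add_neg, ← e3]
  rfl

lemma latRed_eq_of_norm_lt {w : ℂ} {m k : ℤ} (h : ‖w - lat m k‖ < π) :
    latRed w = w - lat m k :=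
  latRed_eq_of_mem_Sq (ball_subset_Sq le_rfl (by simpa using h))

lemma periodicC_latRed : PeriodicC latRed := PeriodicC.of_lat fun m k z => by
  have h1 := (exists_lat_mem_Sq (0 - (π + π * I)) z).choose_spec.choose_spec
  set m' := (exists_lat_mem_Sq (0 - (π + π * I)) z).choose
  set k' := (exists_lat_mem_Sq (0 - (π + π * I)) z).choose_spec.choose
  have e : latRed z = z + lat m' k' := rfl
  have e2 : z + lat m k - lat (m - m') (k - k') = z + lat m' k' := by rw [lat_sub]; ring
  rw [latRed_eq_of_mem_Sq (m := m - m') (k := k - k') (by rwa [e2]), e2, e]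

/-- A periodic weight vanishing like `|w|` at lattice points, equal to `1` at distance `≥ s`. -/
def poleWeight (s : ℝ) (w : ℂ) : ℝ := ‖latRed w‖ * Real.exp (-regLog s (latRed w))

/-- The periodic curvature density accompanying `poleWeight`. -/
def poleDensity (s : ℝ) (w : ℂ) : ℝ := lapC (regLog s) (latRed w)

lemma periodicC_poleWeight (s : ℝ) : PeriodicC (poleWeight s) :=
  periodicC_latRed.comp fun v => ‖v‖ * Real.exp (-regLog s v)

lemma periodicC_poleDensity (s : ℝ) : PeriodicC (poleDensity s) :=
  periodicC_latRed.comp fun v => lapC (regLog s) v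

lemma lapC_regLog_nonneg {s : ℝ} (hs : 0 < s) (z : ℂ) : 0 ≤ lapC (regLog s) z := by
  rw [lapC_regLog hs]; positivity

lemma poleDensity_nonneg {s : ℝ} (hs : 0 < s) (w : ℂ) : 0 ≤ poleDensity s w :=
  lapC_regLog_nonneg hs _

lemma lapC_regLog_eq_zero {s : ℝ} (hs : 0 < s) {z : ℂ} (hz : s ≤ ‖z‖) : lapC (regLog s) z = 0 := by
  rw [lapC_regLog hs, max_eq_right, mul_zero]
  rw [sub_nonpos, one_le_div (by positivity)]
  gcongr

lemma poleDensity_eq_zero {s : ℝ} (hs : 0 < s) {w : ℂ} (hw : s ≤ ‖latRed w‖) :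
    poleDensity s w = 0 := lapC_regLog_eq_zero hs hw

lemma poleWeight_eq_one {s : ℝ} (hs : 0 < s) {w : ℂ} (hw : s ≤ ‖latRed w‖) :
    poleWeight s w = 1 := by
  have h0 : 0 < ‖latRed w‖ := hs.trans_le hw
  rw [poleWeight, regLog_of_le hs hw, Real.exp_neg, Real.exp_log h0, mul_inv_cancel₀ h0.ne']

lemma poleWeight_pos {s : ℝ} {w : ℂ} (hw : latRed w ≠ 0) : 0 < poleWeight s w :=
  mul_pos (norm_pos_iff.2 hw) (Real.exp_pos _)

lemma poleWeight_nonneg {s : ℝ} (w : ℂ) : 0 ≤ poleWeight s w :=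
  mul_nonneg (norm_nonneg _) (Real.exp_pos _).le

lemma le_poleDensity {s : ℝ} (hs : 0 < s) (hsπ : s < π) {w : ℂ} {m k : ℤ}
    (hw : ‖w - lat m k‖ ≤ s / 2) : 3 / s ^ 2 ≤ poleDensity s w := by
  rw [poleDensity, latRed_eq_of_norm_lt (hw.trans_lt (by linarith)), lapC_regLog hs]
  have h1 : ‖w - lat m k‖ ^ 2 / s ^ 2 ≤ 1 / 4 := by
    rw [div_le_iff₀ (by positivity)]
    nlinarith [norm_nonneg (w - lat m k)]
  calc 3 / s ^ 2 = 4 / s ^ 2 * (3 / 4) := by ring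
    _ ≤ _ := by gcongr; exact le_max_of_le_left (by linarith)

lemma local_latRed {s : ℝ} (hs : 0 < s) (hsπ : 3 * s < π) (w₀ : ℂ) :
    (∃ m k : ℤ, ‖w₀ - lat m k‖ ≤ 2 * s ∧
      ∀ w ∈ Metric.closedBall w₀ (s / 2), latRed w = w - lat m k ∧ ‖w - lat m k‖ < π) ∨
    (2 * s ≤ ‖latRed w₀‖ ∧ ∀ w ∈ Metric.closedBall w₀ (s / 2), s ≤ ‖latRed w‖) := by
  rcases lt_or_ge ‖latRed w₀‖ (2 * s) with h | h
  · left
    obtain ⟨m, k, e⟩ := exists_latRed_eq w₀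
    rw [e] at h
    refine ⟨m, k, h.le, fun w hw => ?_⟩
    rw [mem_closedBall_iff_norm] at hw
    have : ‖w - lat m k‖ < π := by
      have := norm_add_le (w - w₀) (w₀ - lat m k)
      rw [sub_add_sub_cancel] at this
      linarith
    exact ⟨latRed_eq_of_norm_lt this, this⟩
  · right
    refine ⟨h, fun w hw => ?_⟩
    by_contra! hlt
    obtain ⟨m, k, e⟩ := exists_latRed_eq w
    rw [e] at hlt
    rw [mem_closedBall_iff_norm] at hw
    have h1 : ‖w₀ - lat m k‖ < 2 * s := by
      have := norm_add_le (w₀ - w) (w - lat m k)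
      rw [sub_add_sub_cancel, norm_sub_rev w₀ w] at this
      linarith
    rw [latRed_eq_of_norm_lt (h1.trans (by linarith))] at h
    linarith

lemma continuous_poleDensity {s : ℝ} (hs : 0 < s) (hsπ : 3 * s < π) :
    Continuous (poleDensity s) := by
  rw [continuous_iff_continuousAt]
  intro w₀
  have hmem : Metric.closedBall w₀ (s / 2) ∈ nhds w₀ :=
    Metric.closedBall_mem_nhds _ (by positivity)
  rcases local_latRed hs hsπ w₀ with ⟨m, k, -, h⟩ | ⟨-, h⟩
  · have hc : ContinuousAt (fun w => lapC (regLog s) (w - lat m k)) w₀ :=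
      ((contDiff_regLog s).continuous_lapC.comp (continuous_id.sub continuous_const)).continuousAt
    refine hc.congr (Filter.mem_of_superset hmem fun w hw => ?_)
    simp only [Set.mem_ofPred_eq, poleDensity, (h w hw).1]
  · refine continuousAt_const (y := (0 : ℝ)) |>.congr (Filter.mem_of_superset hmem fun w hw => ?_)
    simp only [Set.mem_ofPred_eq, poleDensity_eq_zero hs (h w hw)]

lemma integral_poleDensity {s : ℝ} (hs : 0 < s) (hsπ : 3 * s < π) :
    ∫ z in Efd, poleDensity s z = 2 * π := by
  rw [← setIntegral_Sq (periodicC_poleDensity s) (0 - (π + π * I))]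
  have h1 : ∫ z in Sq (0 - (π + π * I)), poleDensity s z =
      ∫ z in Metric.ball (0 : ℂ) s, poleDensity s z := by
    refine setIntegral_eq_of_subset_of_forall_sdiff_eq_zero (measurableSet_Sq _)
      (ball_subset_Sq (by linarith)) fun z hz => ?_
    have hz0 : latRed z = z := by
      have := latRed_eq_of_mem_Sq (w := z) (m := 0) (k := 0) (by simpa [lat_zero] using hz.1)
      simpa [lat_zero] using this
    exact poleDensity_eq_zero hs (by rw [hz0]; simpa using hz.2)
  have h2 : ∫ z in Metric.ball (0 : ℂ) s, poleDensity s z =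
      ∫ z in Metric.ball (0 : ℂ) s, (fun r : ℝ => 4 / s ^ 2 * (1 - r ^ 2 / s ^ 2)) ‖z‖ := by
    refine setIntegral_congr_fun measurableSet_ball fun z hz => ?_
    rw [mem_ball_zero_iff] at hz
    have hz0 : latRed z = z := by
      have := latRed_eq_of_norm_lt (w := z) (m := 0) (k := 0) (by simp [lat_zero]; linarith)
      simpa [lat_zero] using this
    simp only [poleDensity, hz0]
    rw [lapC_regLog hs, max_eq_left]
    rw [sub_nonneg, div_le_one (by positivity)]
    gcongr
  rw [h1, h2, integral_ball_radial (fun r : ℝ => 4 / s ^ 2 * (1 - r ^ 2 / s ^ 2)) hs.le]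
  have h3 : ∫ r in (0 : ℝ)..s, r * (4 / s ^ 2 * (1 - r ^ 2 / s ^ 2)) = 1 := by
    have hd : ∀ r ∈ Set.uIcc 0 s, HasDerivAt (fun r : ℝ => 2 * r ^ 2 / s ^ 2 - r ^ 4 / s ^ 4)
        (r * (4 / s ^ 2 * (1 - r ^ 2 / s ^ 2))) r := by
      intro r _
      have a1 := ((hasDerivAt_pow 2 r).const_mul 2).div_const (s ^ 2)
      have a2 := (hasDerivAt_pow 4 r).div_const (s ^ 4)
      refine HasDerivAt.congr_deriv (a1.sub a2) ?_
      push_cast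
      field_simp
      ring
    rw [intervalIntegral.integral_eq_sub_of_hasDerivAt hd
      (Continuous.intervalIntegrable (by fun_prop) _ _)]
    field_simp
    ring
  rw [h3, mul_one]

/-- Local factorisation of `poleWeight`, with a quadratic bound on the regular exponent. -/
lemma exists_local_poleWeight {s : ℝ} (hs : 0 < s) (hsπ : 3 * s < π) {ε : ℝ} (hε : 0 < ε) :
    ∃ r > 0, r ≤ s / 2 ∧ ∀ w₀ : ℂ, ∃ (S : ℂ → ℂ) (ℓ : ℂ → ℝ), Differentiable ℂ S ∧ Continuous ℓ ∧
      (∀ w ∈ Metric.closedBall w₀ (s / 2), poleWeight s w = ‖S w‖ * Real.exp (-ℓ w)) ∧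
      (∃ a b : ℂ, ∀ w : ℂ, ‖w‖ ≤ r →
        ℓ (w₀ + w) ≤ ℓ w₀ + (a * w + b * w ^ 2).re + (poleDensity s w₀ + ε) / 4 * ‖w‖ ^ 2) ∧
      ((∃ m k : ℤ, (∀ w, S w = w - lat m k) ∧
          ∀ w ∈ Metric.closedBall w₀ (s / 2), ‖w - lat m k‖ < π) ∨
        ((∀ w, S w = 1) ∧ ∀ w ∈ Metric.closedBall w₀ (s / 2), w ∉ latGroup)) := by
  obtain ⟨r, hr, hT⟩ := exists_taylor_upper (contDiff_regLog s)
    (isCompact_closedBall (0 : ℂ) (2 * s)) hε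
  refine ⟨min r (s / 2), by positivity, min_le_right _ _, fun w₀ => ?_⟩
  have hw₀ : w₀ ∈ Metric.closedBall w₀ (s / 2) := Metric.mem_closedBall_self (by positivity)
  rcases local_latRed hs hsπ w₀ with ⟨m, k, h2, h⟩ | ⟨-, h⟩
  · obtain ⟨a, b, hab⟩ := hT (w₀ - lat m k) (by simpa using h2)
    refine ⟨fun w => w - lat m k, fun w => regLog s (w - lat m k),
      differentiable_id.sub_const _,
      (contDiff_regLog s).continuous.comp (continuous_id.sub continuous_const),
      fun w hw => by rw [poleWeight, (h w hw).1], ⟨a, b, fun w hw => ?_⟩,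
      Or.inl ⟨m, k, fun _ => rfl, fun w hw => (h w hw).2⟩⟩
    have := hab w (hw.trans (min_le_left _ _))
    rw [poleDensity, (h w₀ hw₀).1]
    beta_reduce
    rwa [add_sub_right_comm]
  · refine ⟨fun _ => 1, fun _ => 0, differentiable_const _, continuous_const,
      fun w hw => by rw [poleWeight_eq_one hs (h w hw)]; simp, ⟨0, 0, fun w _ => ?_⟩,
      Or.inr ⟨fun _ => rfl, fun w hw hl => ?_⟩⟩
    · simp only [zero_mul, add_zero, Complex.zero_re, zero_add]
      rw [poleDensity_eq_zero hs (h w₀ hw₀)]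
      positivity
    · obtain ⟨m, k, rfl⟩ := hl
      have := h _ hw
      rw [latRed_eq_of_norm_lt (m := m) (k := k) (by simpa using pi_pos)] at this
      simp at this
      linarith

/-- The square period pair `(2π, 2πi)`. -/
def squarePeriods : PeriodPair where
  ω₁ := ((2 * π : ℝ) : ℂ)
  ω₂ := ((2 * π : ℝ) : ℂ) * I
  indep := by
    rw [LinearIndependent.pair_iff]
    intro a b h
    have h1 := congrArg Complex.re h
    have h2 := congrArg Complex.im h
    simp [pi_ne_zero] at h1 h2
    exact ⟨h1, h2⟩

lemma mem_squarePeriods_lattice {z : ℂ} : z ∈ squarePeriods.lattice ↔ z ∈ latGroup := by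
  rw [PeriodPair.mem_lattice, mem_latGroup]
  refine exists₂_congr fun m k => ?_
  rw [eq_comm]
  refine Eq.congr rfl ?_
  simp [squarePeriods, lat]
  ring

lemma isClosed_latGroup : IsClosed (latGroup : Set ℂ) := by
  convert! squarePeriods.isClosed_lattice using 1
  ext z
  exact mem_squarePeriods_lattice.symm

lemma notMem_latGroup_of_norm_lt {w : ℂ} (hw : ‖w‖ < π) (h0 : w ≠ 0) : w ∉ latGroup := by
  rintro ⟨m, k, rfl⟩
  have h1 := (Complex.abs_re_le_norm _).trans_lt hw
  have h2 := (Complex.abs_im_le_norm _).trans_lt hw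
  have key : ∀ i : ℤ, |2 * π * (i : ℝ)| < π → i = 0 := by
    intro i hi
    rw [abs_mul, abs_of_pos (by positivity)] at hi
    have : |(i : ℝ)| < 1 := by nlinarith [pi_pos]
    rw [← Int.abs_lt_one_iff]
    exact_mod_cast this
  rw [lat_re] at h1
  rw [lat_im] at h2
  rw [key m h1, key k h2, lat_zero] at h0
  exact h0 rfl

/-- For every `k ≥ 2` there is an elliptic function with a single pole of order `k` at `0`. -/
lemma exists_pole_function (k : ℕ) (hk : 2 ≤ k) : ∃ P : ℂ → ℂ, PeriodicC P ∧
    (∀ w ∉ latGroup, DifferentiableAt ℂ P w) ∧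
    ∃ H : ℂ → ℂ, DifferentiableOn ℂ H (Metric.ball 0 π) ∧ H 0 ≠ 0 ∧
      ∀ w : ℂ, w ≠ 0 → P w * w ^ k = H w := by
  set L := squarePeriods
  have hcoe : ∀ m k : ℤ, lat m k ∈ L.lattice := fun m k =>
    mem_squarePeriods_lattice.2 ⟨m, k, rfl⟩
  have hopen : IsOpen ((L.lattice : Set ℂ)ᶜ) := L.isClosed_lattice.isOpen_compl
  have hsub : Metric.ball (0 : ℂ) π ⊆ ((L.lattice : Set ℂ) \ {0})ᶜ := by
    rintro w hw ⟨h1, h2⟩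
    exact notMem_latGroup_of_norm_lt (by simpa using hw) h2 (mem_squarePeriods_lattice.1 h1)
  set Q₂ : ℂ → ℂ := fun w => L.weierstrassPExcept 0 w * w ^ 2 + 1 with hQ₂
  set Q₃ : ℂ → ℂ := fun w => L.derivWeierstrassPExcept 0 w * w ^ 3 - 2 with hQ₃
  have d₂ : DifferentiableOn ℂ Q₂ (Metric.ball 0 π) :=
    (((L.differentiableOn_weierstrassPExcept 0).mono hsub).mul
      (differentiable_pow 2).differentiableOn).add_const _
  have d₃ : DifferentiableOn ℂ Q₃ (Metric.ball 0 π) :=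
    (((L.differentiableOn_derivWeierstrassPExcept 0).mono hsub).mul
      (differentiable_pow 3).differentiableOn).sub_const _
  have e₂ : ∀ w : ℂ, w ≠ 0 → L.weierstrassP w * w ^ 2 = Q₂ w := by
    intro w hw
    have := L.weierstrassPExcept_add 0 w
    simp only [ZeroMemClass.coe_zero, sub_zero] at this
    rw [← this, hQ₂]
    field_simp
    ring
  have e₃ : ∀ w : ℂ, w ≠ 0 → L.derivWeierstrassP w * w ^ 3 = Q₃ w := by
    intro w hw
    have := L.derivWeierstrassPExcept_sub 0 w
    simp only [ZeroMemClass.coe_zero, sub_zero] at this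
    rw [← this, hQ₃]
    field_simp
  have D₂ : ∀ w ∉ latGroup, DifferentiableAt ℂ L.weierstrassP w := fun w hw =>
    L.differentiableOn_weierstrassP.differentiableAt
      (hopen.mem_nhds fun h => hw (mem_squarePeriods_lattice.1 h))
  have D₃ : ∀ w ∉ latGroup, DifferentiableAt ℂ L.derivWeierstrassP w := fun w hw =>
    L.differentiableOn_derivWeierstrassP.differentiableAt
      (hopen.mem_nhds fun h => hw (mem_squarePeriods_lattice.1 h))
  have p₂ : PeriodicC L.weierstrassP := PeriodicC.of_lat fun m k z =>
    L.weierstrassP_add_coe z ⟨lat m k, hcoe m k⟩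
  have p₃ : PeriodicC L.derivWeierstrassP := PeriodicC.of_lat fun m k z =>
    L.derivWeierstrassP_add_coe z ⟨lat m k, hcoe m k⟩
  have hab : ∃ a b : ℕ, k = 2 * a + 3 * b := by
    rcases Nat.even_or_odd' k with ⟨j, rfl | rfl⟩
    · exact ⟨j, 0, by ring⟩
    · exact ⟨j - 1, 1, by omega⟩
  obtain ⟨a, b, rfl⟩ := hab
  refine ⟨fun w => L.weierstrassP w ^ a * L.derivWeierstrassP w ^ b,
    p₂.comp₂ p₃ fun x y => x ^ a * y ^ b,
    fun w hw => ((D₂ w hw).pow a).mul ((D₃ w hw).pow b),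
    fun w => Q₂ w ^ a * Q₃ w ^ b, (d₂.pow a).mul (d₃.pow b), ?_, fun w hw => ?_⟩
  · simp [hQ₂, hQ₃]
  · beta_reduce
    rw [← e₂ w hw, ← e₃ w hw]
    ring

/-- Pointwise bound for the density of an orthonormal system of functions which become
holomorphic near `z` after multiplication by a common factor `A`. -/
lemma density_le_of_local_factor {ι : Type*} [Fintype ι] {g : ι → ℂ → ℂ} {W Φ : ℂ → ℝ} {A : ℂ → ℂ}
    {z a b : ℂ} {r R h B : ℝ} (hr : 0 < r) (hrR : r < R) (hrπ : r ≤ π) (hh : 0 < h) (hB : 0 < B)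
    (hper : ∀ c : ι → ℂ, PeriodicC (fun w => ‖∑ i, c i * g i w‖ ^ 2 * W w))
    (h_int : ∀ c : ι → ℂ, IntegrableOn (fun w => ‖∑ i, c i * g i w‖ ^ 2 * W w) Efd)
    (hW0 : ∀ w, 0 ≤ W w)
    (hA : ∀ i, DifferentiableOn ℂ (fun w => g i w * A w) (Metric.ball z R))
    (hΦ : ContinuousOn Φ (Metric.closedBall z r))
    (hT : ∀ w : ℂ, ‖w‖ ≤ r → Φ (z + w) ≤ Φ z + (a * w + b * w ^ 2).re + B / 4 * ‖w‖ ^ 2)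
    (hW : ∀ w ∈ Metric.closedBall z r, W w = ‖A w‖ ^ 2 * Real.exp (-2 * Φ w / h))
    (hbes : ∀ c : ι → ℂ, ∫ w in Efd, ‖∑ i, c i * g i w‖ ^ 2 * W w ≤ ∑ i, ‖c i‖ ^ 2) :
    (∑ i, ‖g i z‖ ^ 2) * W z ≤ B / (2 * π * h * (1 - Real.exp (-B * r ^ 2 / (2 * h)))) := by
  have hsub : Metric.closedBall z r ⊆ Metric.ball z R := Metric.closedBall_subset_ball hrR
  have hbes' : ∀ c : ι → ℂ, ∫ w in Metric.ball z r, ‖∑ j, c j * (g j w * A w)‖ ^ 2 *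
      Real.exp (-2 * Φ w / h) ≤ ∑ j, ‖c j‖ ^ 2 := by
    intro c
    refine le_trans (le_of_eq ?_) ((setIntegral_Efd_ball_le (hper c) (h_int c)
      (fun w => mul_nonneg (sq_nonneg _) (hW0 w)) hrπ z).trans (hbes c))
    refine setIntegral_congr_fun measurableSet_ball fun w hw => ?_
    rw [hW w (Metric.ball_subset_closedBall hw), ← mul_assoc, ← mul_pow, ← norm_mul, Finset.sum_mul]
    simp_rw [mul_assoc]
  have hM' : ∀ i : ι, ∀ ρ, 0 ≤ ρ → ρ < r → ‖∫ θ in (0 : ℝ)..2 * π,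
      (g i (z + circleMap 0 ρ θ) * A (z + circleMap 0 ρ θ) *
        Complex.exp (-(a * circleMap 0 ρ θ + b * circleMap 0 ρ θ ^ 2) / h) - g i z * A z)‖ ≤
        2 * π * 0 := by
    intro i ρ hρ0 hρ
    set G : ℂ → ℂ := fun w => g i (z + w) * A (z + w) *
      Complex.exp (-(a * w + b * w ^ 2) / h) with hG
    have hGd : DifferentiableOn ℂ G (Metric.ball 0 R) := by
      refine DifferentiableOn.mul ?_ (Differentiable.differentiableOn (by fun_prop))
      refine (hA i).comp (f := fun w => z + w) (by fun_prop) fun w hw => ?_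
      simpa using hw
    have hcl : DiffContOnCl ℂ G (Metric.ball 0 |ρ|) :=
      (hGd.mono (by
        refine Metric.closure_ball_subset_closedBall.trans (Metric.closedBall_subset_ball ?_)
        rw [abs_of_nonneg hρ0]; linarith)).diffContOnCl
    have hmean := hcl.circleAverage
    rw [Real.circleAverage] at hmean
    have hmean' : ∫ θ in (0 : ℝ)..2 * π, G (circleMap 0 ρ θ) = (2 * π : ℝ) • G 0 := by
      rw [← hmean, smul_smul, mul_inv_cancel₀ (by positivity), one_smul]
    have hGc : Continuous fun θ => G (circleMap 0 ρ θ) := by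
      refine hGd.continuousOn.comp_continuous (continuous_circleMap 0 ρ) fun θ => ?_
      rw [mem_ball_zero_iff, norm_circleMap_zero, abs_of_nonneg hρ0]
      linarith
    have hG0 : G 0 = g i z * A z := by simp [hG]
    have : ∫ θ in (0 : ℝ)..2 * π, (G (circleMap 0 ρ θ) - g i z * A z) = 0 := by
      rw [intervalIntegral.integral_sub (hGc.intervalIntegrable _ _) intervalIntegrable_const,
        hmean', intervalIntegral.integral_const, hG0, sub_zero, sub_self]
    simp only [hG] at this
    rw [this]
    simp
  obtain ⟨α, h1, h2⟩ := exists_approx_eval (u := fun i w => g i w * A w) (ψ := Φ) (z := z) (a := a)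
    (b := b) hr hh hB (fun i => (hA i).continuousOn.mono hsub) hΦ hT hbes' (fun _ => 0) hM'
  have e : ∀ i, α i = g i z * A z := fun i => by
    have := h1 i
    rw [norm_le_zero_iff, sub_eq_zero] at this
    exact this.symm
  rw [hW z (Metric.mem_closedBall_self hr.le)]
  refine le_trans (le_of_eq ?_) h2
  rw [← mul_assoc, Finset.sum_mul]
  congr 1
  exact Finset.sum_congr rfl fun i _ => by rw [e, norm_mul, mul_pow]

/-- Near any point, a pole function times a sufficiently high power of the local factor of
`poleWeight` is holomorphic. -/
lemma differentiableOn_pole_mul_pow {s : ℝ} {P : ℂ → ℂ} {k n : ℕ} (hkn : k < n) (hP : PeriodicC P)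
    (hd : ∀ w ∉ latGroup, DifferentiableAt ℂ P w) {H : ℂ → ℂ}
    (hH : DifferentiableOn ℂ H (Metric.ball 0 π)) (hPH : ∀ w : ℂ, w ≠ 0 → P w * w ^ k = H w)
    {w₀ : ℂ} {S : ℂ → ℂ}
    (hS : (∃ m k : ℤ, (∀ w, S w = w - lat m k) ∧
          ∀ w ∈ Metric.closedBall w₀ (s / 2), ‖w - lat m k‖ < π) ∨
        ((∀ w, S w = 1) ∧ ∀ w ∈ Metric.closedBall w₀ (s / 2), w ∉ latGroup)) :
    DifferentiableOn ℂ (fun w => P w * S w ^ n) (Metric.ball w₀ (s / 2)) := by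
  rcases hS with ⟨m, j, hS, hlt⟩ | ⟨hS, hnot⟩
  · have e : ∀ w, P w * S w ^ n = H (w - lat m j) * (w - lat m j) ^ (n - k) := by
      intro w
      have h1 : P w = P (w - lat m j) := by
        conv_lhs => rw [← sub_add_cancel w (lat m j), hP.add_lat]
      rw [hS, h1]
      rcases eq_or_ne (w - lat m j) 0 with h0 | h0
      · rw [h0, zero_pow (by omega), zero_pow (by omega), mul_zero, mul_zero]
      · rw [← hPH _ h0, mul_assoc, ← pow_add, Nat.add_sub_cancel' hkn.le]
    simp_rw [e]
    refine DifferentiableOn.mul ?_ (Differentiable.differentiableOn (by fun_prop))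
    refine hH.comp (f := fun w => w - lat m j) (by fun_prop) fun w hw => ?_
    rw [mem_ball_zero_iff]
    exact hlt w (Metric.ball_subset_closedBall hw)
  · intro w hw
    simp_rw [hS, one_pow, mul_one]
    exact (hd w (hnot w (Metric.ball_subset_closedBall hw))).differentiableWithinAt

/-- An elliptic function with a single pole of order `k` at the lattice points (`k ≥ 2`). -/
def poleFun (k : ℕ) (w : ℂ) : ℂ := if h : 2 ≤ k then (exists_pole_function k h).choose w else 0

lemma poleFun_eq {k : ℕ} (h : 2 ≤ k) : poleFun k = (exists_pole_function k h).choose := by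
  funext w; simp [poleFun, h]

lemma periodicC_poleFun {k : ℕ} (h : 2 ≤ k) : PeriodicC (poleFun k) := by
  rw [poleFun_eq h]; exact (exists_pole_function k h).choose_spec.1

lemma differentiableAt_poleFun {k : ℕ} (h : 2 ≤ k) {w : ℂ} (hw : w ∉ latGroup) :
    DifferentiableAt ℂ (poleFun k) w := by
  rw [poleFun_eq h]; exact (exists_pole_function k h).choose_spec.2.1 w hw

lemma exists_poleFun_factor {k : ℕ} (h : 2 ≤ k) :
    ∃ H : ℂ → ℂ, DifferentiableOn ℂ H (Metric.ball 0 π) ∧ H 0 ≠ 0 ∧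
      ∀ w : ℂ, w ≠ 0 → poleFun k w * w ^ k = H w := by
  rw [poleFun_eq h]; exact (exists_pole_function k h).choose_spec.2.2

/-- The elliptic functions with one pole, of order between `2` and `n - 1`, in the set `P`. -/
def poleSystem (P : Finset ℂ) (n : ℕ) (q : P × Fin (n - 2)) (z : ℂ) : ℂ :=
  poleFun (q.2 + 2) (z - q.1)

/-- The weight `e^{-2ψ/h}` damped to order `2n` at the points of `P`. -/
def poleSystemWeight (ψ : ℂ → ℝ) (s h : ℝ) (P : Finset ℂ) (n : ℕ) (z : ℂ) : ℝ :=
  Real.exp (-2 * ψ z / h) * ∏ p ∈ P, poleWeight s (z - p) ^ (2 * n)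

lemma PeriodicC.sub_const {α : Type*} {f : ℂ → α} (hf : PeriodicC f) (a : ℂ) :
    PeriodicC (fun z => f (z - a)) := by
  simpa [sub_eq_add_neg] using hf.shift (-a)

lemma periodicC_poleSystem (P : Finset ℂ) (n : ℕ) (q : P × Fin (n - 2)) :
    PeriodicC (poleSystem P n q) := (periodicC_poleFun (by omega)).sub_const _

lemma periodicC_poleSystemWeight {ψ : ℂ → ℝ} (hψp : PeriodicC ψ) (s h : ℝ) (P : Finset ℂ) (n : ℕ) :
    PeriodicC (poleSystemWeight ψ s h P n) := by
  have : PeriodicC (fun z => ∏ p ∈ P, poleWeight s (z - p) ^ (2 * n)) := fun z =>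
    ⟨Finset.prod_congr rfl fun p _ => congrArg (· ^ (2 * n)) ((periodicC_poleWeight s).sub_const p z).1,
     Finset.prod_congr rfl fun p _ => congrArg (· ^ (2 * n)) ((periodicC_poleWeight s).sub_const p z).2⟩
  exact hψp.comp₂ this fun x y => Real.exp (-2 * x / h) * y

lemma poleSystemWeight_nonneg (ψ : ℂ → ℝ) (s h : ℝ) (P : Finset ℂ) (n : ℕ) (z : ℂ) :
    0 ≤ poleSystemWeight ψ s h P n z :=
  mul_nonneg (Real.exp_pos _).le (Finset.prod_nonneg fun _ _ => pow_nonneg (poleWeight_nonneg _) _)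

lemma exists_taylor_upper_periodic {ψ : ℂ → ℝ} (hψ : ContDiff ℝ 2 ψ) (hψp : PeriodicC ψ)
    {ε : ℝ} (hε : 0 < ε) : ∃ r₀ > 0, ∀ z, ∃ a b : ℂ, ∀ w : ℂ, ‖w‖ ≤ r₀ →
      ψ (z + w) ≤ ψ z + (a * w + b * w ^ 2).re + (lapC ψ z + ε) / 4 * ‖w‖ ^ 2 := by
  obtain ⟨r, hr, h⟩ := exists_taylor_upper hψ (isCompact_closedBall (0 : ℂ) (4 * π)) hε
  refine ⟨r, hr, fun z => ?_⟩
  obtain ⟨m, k, hmk⟩ := exists_lat_mem_Sq 0 z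
  rw [Sq_zero] at hmk
  obtain ⟨a, b, hab⟩ := h _ (Efd_subset_closedBall hmk)
  refine ⟨a, b, fun w hw => ?_⟩
  have := hab w hw
  rwa [add_right_comm, hψp.add_lat, hψp.add_lat, hψp.lapC.add_lat] at this

lemma exists_local_poleSystem {ψ : ℂ → ℝ} (hψ : ContDiff ℝ 2 ψ) (hψp : PeriodicC ψ) {s : ℝ}
    (hs : 0 < s) (hsπ : 3 * s < π) (P : Finset ℂ) {K ε : ℝ} (hK : 0 ≤ K) (hε : 0 < ε) :
    ∃ r > 0, r < s / 2 ∧ ∀ (h : ℝ) (n : ℕ), 0 < h → h * n ≤ K → ∀ z, ∃ (A : ℂ → ℂ) (Φ : ℂ → ℝ),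
      Continuous Φ ∧ Differentiable ℂ A ∧
      (∀ q, DifferentiableOn ℂ (fun w => poleSystem P n q w * A w) (Metric.ball z (s / 2))) ∧
      (∀ w ∈ Metric.closedBall z (s / 2),
        poleSystemWeight ψ s h P n w = ‖A w‖ ^ 2 * Real.exp (-2 * Φ w / h)) ∧
      ∃ a b : ℂ, ∀ w : ℂ, ‖w‖ ≤ r → Φ (z + w) ≤ Φ z + (a * w + b * w ^ 2).re +
        (max (lapC ψ z + h * n * ∑ p ∈ P, poleDensity s (z - p)) 0 + ε) / 4 * ‖w‖ ^ 2 := by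
  obtain ⟨r₁, hr₁, hT₁⟩ := exists_taylor_upper_periodic hψ hψp (half_pos hε)
  set ε₁ := ε / (2 * (K * P.card + 1)) with hε₁
  have hε₁0 : 0 < ε₁ := by positivity
  obtain ⟨r₂, hr₂, hr₂s, hloc⟩ := exists_local_poleWeight hs hsπ hε₁0
  refine ⟨min r₁ (r₂ / 2), by positivity, (min_le_right _ _).trans_lt (by linarith),
    fun h n hh hn z => ?_⟩
  choose S ℓ hSd hℓc hWS hTay halt using fun p : ℂ => hloc (z - p)
  choose a b hab using hTay
  obtain ⟨a₀, b₀, h₀⟩ := hT₁ z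
  refine ⟨fun w => ∏ p ∈ P, S p (w - p) ^ n, fun w => ψ w + h * n * ∑ p ∈ P, ℓ p (w - p),
    ?_, ?_, ?_, ?_, a₀ + h * n * ∑ p ∈ P, a p, b₀ + h * n * ∑ p ∈ P, b p, ?_⟩
  · refine hψ.continuous.add (continuous_const.mul (continuous_finsetSum _ fun p _ => ?_))
    exact (hℓc p).comp (continuous_id.sub continuous_const)
  · refine Differentiable.fun_finsetProd fun p _ => ?_
    exact ((hSd p).comp (differentiable_id.sub_const p)).pow n
  · rintro ⟨⟨p, hp⟩, i⟩
    obtain ⟨H, hH, -, hPH⟩ := exists_poleFun_factor (k := i + 2) (by omega)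
    have h1 := differentiableOn_pole_mul_pow (s := s) (n := n) (k := i + 2) (by omega)
      (periodicC_poleFun (by omega)) (fun w hw => differentiableAt_poleFun (by omega) hw)
      hH hPH (halt p)
    have h2 : DifferentiableOn ℂ (fun w => poleFun (i + 2) (w - p) * S p (w - p) ^ n)
        (Metric.ball z (s / 2)) := by
      refine h1.comp (f := fun w => w - p) (by fun_prop) fun w hw => ?_
      rw [mem_ball_iff_norm] at hw ⊢
      simpa using hw
    have h3 : Differentiable ℂ (fun w => ∏ p' ∈ P.erase p, S p' (w - p') ^ n) :=
      Differentiable.fun_finsetProd fun p' _ =>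
        ((hSd p').comp (differentiable_id.sub_const p')).pow n
    refine (h2.mul h3.differentiableOn).congr fun w _ => ?_
    simp only [poleSystem, Pi.mul_apply]
    rw [← Finset.mul_prod_erase P (fun p' => S p' (w - p') ^ n) hp, mul_assoc]
  · intro w hw
    have e1 : ∀ p ∈ P, poleWeight s (w - p) ^ (2 * n) =
        ‖S p (w - p) ^ n‖ ^ 2 * Real.exp (-2 * (h * n * ℓ p (w - p)) / h) := by
      intro p _
      rw [hWS p (w - p) (by
        rw [mem_closedBall_iff_norm] at hw ⊢
        simpa using hw), mul_pow, norm_pow, ← pow_mul, mul_comm n 2, ← Real.exp_nat_mul]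
      congr 2
      field_simp
      push_cast
      ring
    rw [poleSystemWeight, Finset.prod_congr rfl e1, Finset.prod_mul_distrib, norm_prod,
      Finset.prod_pow, ← Real.exp_sum, mul_left_comm, ← Real.exp_add]
    congr 2
    rw [← Finset.sum_div, ← Finset.mul_sum, ← Finset.mul_sum]
    ring
  · intro w hw
    have t0 := h₀ w (hw.trans (min_le_left _ _))
    have hw2 : ‖w‖ ≤ r₂ := hw.trans ((min_le_right _ _).trans (by linarith))
    have t1 : ∑ p ∈ P, ℓ p (z + w - p) ≤ ∑ p ∈ P, (ℓ p (z - p) + (a p * w + b p * w ^ 2).re +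
        (poleDensity s (z - p) + ε₁) / 4 * ‖w‖ ^ 2) := by
      refine Finset.sum_le_sum fun p _ => ?_
      have := hab p w hw2
      rwa [sub_add_eq_add_sub] at this
    have hhn : (0 : ℝ) ≤ h * n := by positivity
    have t2 := mul_le_mul_of_nonneg_left t1 hhn
    have t3 : h * n * (P.card * ε₁) ≤ ε / 2 := by
      have : ε / 2 = (K * P.card + 1) * ε₁ := by rw [hε₁]; field_simp
      rw [this, ← mul_assoc]
      gcongr
      have : h * n * P.card ≤ K * P.card := by gcongr
      linarith
    have e2 : ∑ p ∈ P, (ℓ p (z - p) + (a p * w + b p * w ^ 2).re +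
        (poleDensity s (z - p) + ε₁) / 4 * ‖w‖ ^ 2) = ∑ p ∈ P, ℓ p (z - p) +
        ((∑ p ∈ P, a p) * w + (∑ p ∈ P, b p) * w ^ 2).re +
        (∑ p ∈ P, poleDensity s (z - p) + P.card * ε₁) / 4 * ‖w‖ ^ 2 := by
      rw [Finset.sum_add_distrib, Finset.sum_add_distrib, ← Finset.sum_mul, ← Finset.sum_div,
        Finset.sum_add_distrib, Finset.sum_const, nsmul_eq_mul, ← Complex.re_sum,
        Finset.sum_add_distrib, ← Finset.sum_mul, ← Finset.sum_mul]
    rw [e2] at t2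
    have e3 : ((a₀ + h * n * ∑ p ∈ P, a p) * w + (b₀ + h * n * ∑ p ∈ P, b p) * w ^ 2).re =
        (a₀ * w + b₀ * w ^ 2).re + h * n * ((∑ p ∈ P, a p) * w + (∑ p ∈ P, b p) * w ^ 2).re := by
      have : ((a₀ + h * n * ∑ p ∈ P, a p) * w + (b₀ + h * n * ∑ p ∈ P, b p) * w ^ 2) =
          (a₀ * w + b₀ * w ^ 2) + ((h * n : ℝ) : ℂ) *
            ((∑ p ∈ P, a p) * w + (∑ p ∈ P, b p) * w ^ 2) := by push_cast; ring
      rw [this, Complex.add_re, Complex.re_ofReal_mul]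
    rw [e3]
    have t4 : (lapC ψ z + ε / 2) + h * n * (∑ p ∈ P, poleDensity s (z - p) + P.card * ε₁) ≤
        max (lapC ψ z + h * n * ∑ p ∈ P, poleDensity s (z - p)) 0 + ε := by
      have := le_max_left (lapC ψ z + h * n * ∑ p ∈ P, poleDensity s (z - p)) 0
      linarith
    have t5 := mul_le_mul_of_nonneg_right t4 (by positivity : 0 ≤ ‖w‖ ^ 2 / 4)
    linarith

open Filter Topology in
/-- A nontrivial combination of pole functions does not vanish identically. -/
lemma exists_poleSystem_sum_ne_zero {P : Finset ℂ} (hP : (P : Set ℂ) ⊆ Efd) {n : ℕ}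
    {c : P × Fin (n - 2) → ℂ} (hc : c ≠ 0) :
    ∃ z, (∀ p ∈ P, z - p ∉ latGroup) ∧ ∑ q, c q * poleSystem P n q z ≠ 0 := by
  by_contra! hcon
  obtain ⟨⟨p, i₀⟩, hq₀⟩ := Function.ne_iff.1 hc
  obtain ⟨i, hi, hmax⟩ := Finset.exists_max_image (Finset.univ.filter fun i => c (p, i) ≠ 0) id
    ⟨i₀, by simpa using hq₀⟩
  have hci : c (p, i) ≠ 0 := by simpa using hi
  have hmax' : ∀ j, i < j → c (p, j) = 0 := by
    intro j hj
    by_contra hne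
    exact absurd (hmax j (by simpa using hne)) (not_le.2 hj)
  have hdist : ∀ p' ∈ P, p' ≠ p → (p : ℂ) - p' ∉ latGroup := by
    rintro p' hp' hne ⟨m, k, e⟩
    have h1 : p' + lat m k ∈ Sq 0 := by
      rw [Sq_zero, ← e, add_sub_cancel]; exact hP p.2
    have h2 : p' + lat 0 0 ∈ Sq 0 := by rw [Sq_zero, lat_zero, add_zero]; exact hP hp'
    obtain ⟨rfl, rfl⟩ := lat_unique_Sq h1 h2
    rw [lat_zero, sub_eq_zero] at e
    exact hne e.symm
  obtain ⟨H, hH, hH0, hPH⟩ := exists_poleFun_factor (k := i + 2) (by omega)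
  have hball : Metric.ball (0 : ℂ) π ∈ 𝓝 0 := Metric.ball_mem_nhds _ pi_pos
  have hid : Tendsto (fun w : ℂ => w) (𝓝[≠] 0) (𝓝 0) := tendsto_id.mono_left nhdsWithin_le_nhds
  have hT : Tendsto (fun w => ∑ q, c q * poleSystem P n q (p + w) * w ^ ((i : ℕ) + 2)) (𝓝[≠] 0)
      (𝓝 (∑ q, if q = (p, i) then c (p, i) * H 0 else 0)) := by
    refine tendsto_finsetSum _ fun q _ => ?_
    obtain ⟨p', j⟩ := q
    by_cases hpp : p' = p
    · subst hpp
      simp only [poleSystem, add_sub_cancel_left, Prod.mk.injEq, true_and]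
      rcases lt_trichotomy j i with hj | rfl | hj
      · obtain ⟨G, hG, -, hPG⟩ := exists_poleFun_factor (k := j + 2) (by omega)
        rw [if_neg hj.ne]
        have hGc : Tendsto G (𝓝[≠] 0) (𝓝 (G 0)) :=
          (hG.differentiableAt hball).continuousAt.tendsto.mono_left nhdsWithin_le_nhds
        have := ((hGc.const_mul (c (p', j))).mul (hid.pow ((i : ℕ) - j)))
        rw [zero_pow (by omega), mul_zero] at this
        refine this.congr' (eventually_nhdsWithin_of_forall fun w hw => ?_)
        rw [← hPG w hw]
        have : (i : ℕ) + 2 = (j + 2) + (i - j) := by omega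
        rw [this, pow_add]
        ring
      · rw [if_pos rfl]
        have hHc : Tendsto H (𝓝[≠] 0) (𝓝 (H 0)) :=
          (hH.differentiableAt hball).continuousAt.tendsto.mono_left nhdsWithin_le_nhds
        refine (hHc.const_mul (c (p', j))).congr' (eventually_nhdsWithin_of_forall fun w hw => ?_)
        rw [← hPH w hw]
        ring
      · rw [if_neg hj.ne', hmax' j hj]
        simp
    · rw [if_neg (by simp [hpp])]
      have hne : (p : ℂ) - p' ∉ latGroup := hdist p' p'.2 (fun h => hpp (Subtype.ext h))
      have hcont : ContinuousAt (fun w : ℂ => poleFun (j + 2) (p + w - p')) 0 := by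
        refine ContinuousAt.comp (g := poleFun (j + 2)) (f := fun w : ℂ => (p : ℂ) + w - p') ?_
          (by fun_prop)
        rw [add_zero]
        exact (differentiableAt_poleFun (by omega) hne).continuousAt
      have := ((hcont.tendsto.mono_left nhdsWithin_le_nhds).const_mul (c (p', j))).mul
        (hid.pow ((i : ℕ) + 2))
      rw [zero_pow (by omega), mul_zero] at this
      exact this
  have hzero : ∀ᶠ w in 𝓝[≠] (0 : ℂ),
      ∑ q, c q * poleSystem P n q (p + w) * w ^ ((i : ℕ) + 2) = 0 := by
    have h1 : ∀ᶠ w in 𝓝[≠] (0 : ℂ), ∀ p' ∈ P, (p : ℂ) + w - p' ∉ latGroup := by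
      rw [Filter.eventually_all_finset]
      intro p' hp'
      by_cases hpp : p' = p
      · subst hpp
        filter_upwards [self_mem_nhdsWithin, nhdsWithin_le_nhds hball] with w hw hwb
        rw [add_sub_cancel_left]
        exact notMem_latGroup_of_norm_lt (by simpa using hwb) hw
      · refine nhdsWithin_le_nhds ?_
        have hc : ContinuousAt (fun w : ℂ => (p : ℂ) + w - p') 0 := by fun_prop
        refine hc.preimage_mem_nhds (isClosed_latGroup.isOpen_compl.mem_nhds ?_)
        simpa using hdist p' hp' hpp
    filter_upwards [h1] with w hw
    rw [← Finset.sum_mul, hcon _ hw, zero_mul]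
  have hlim := tendsto_nhds_unique (tendsto_const_nhds.congr' (hzero.mono fun w h => h.symm)) hT
  rw [Finset.sum_ite_eq' Finset.univ (p, i)] at hlim
  simp only [Finset.mem_univ, if_true] at hlim
  exact mul_ne_zero hci hH0 hlim.symm

lemma poleSystemWeight_pos (ψ : ℂ → ℝ) (s h : ℝ) {P : Finset ℂ} (n : ℕ) {z : ℂ}
    (hz : ∀ p ∈ P, z - p ∉ latGroup) : 0 < poleSystemWeight ψ s h P n z := by
  refine mul_pos (Real.exp_pos _) (Finset.prod_pos fun p hp => pow_pos (poleWeight_pos ?_) _)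
  intro h0
  obtain ⟨m, k, e⟩ := exists_latRed_eq (z - p)
  rw [h0, eq_comm, sub_eq_zero] at e
  exact hz p hp ⟨m, k, e⟩

lemma continuous_poleSystem_mul {ψ : ℂ → ℝ} (hψ : ContDiff ℝ 2 ψ) (hψp : PeriodicC ψ) {s h : ℝ}
    (hs : 0 < s) (hsπ : 3 * s < π) (hh : 0 < h) (P : Finset ℂ) (n : ℕ) (q q' : P × Fin (n - 2)) :
    Continuous (fun z => (starRingEnd ℂ) (poleSystem P n q z) * poleSystem P n q' z *
      poleSystemWeight ψ s h P n z) := by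
  obtain ⟨r, -, -, hloc⟩ := exists_local_poleSystem hψ hψp hs hsπ P (K := h * n) (by positivity)
    one_pos
  rw [continuous_iff_continuousAt]
  intro z
  obtain ⟨A, Φ, hΦ, -, hA, hW, -⟩ := hloc h n hh le_rfl z
  have hb : Metric.ball z (s / 2) ∈ nhds z := Metric.ball_mem_nhds _ (by positivity)
  have hcq : ∀ q, ContinuousAt (fun w => poleSystem P n q w * A w) z := fun q =>
    ((hA q).differentiableAt hb).continuousAt
  have h2 : ContinuousAt (fun w => ((Real.exp (-2 * Φ w / h) : ℝ) : ℂ)) z := by fun_prop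
  refine ((((continuous_star.continuousAt (x := _)).comp (hcq q)).mul (hcq q')).mul h2).congr ?_
  filter_upwards [hb] with w hw
  rw [hW w (Metric.ball_subset_closedBall hw)]
  have : ((‖A w‖ ^ 2 : ℝ) : ℂ) = (starRingEnd ℂ) (A w) * A w := by
    rw [mul_comm, Complex.mul_conj, Complex.normSq_eq_norm_sq]
  change (starRingEnd ℂ) (poleSystem P n q w * A w) * _ * _ = _
  rw [Complex.ofReal_mul, this, map_mul]
  ring

lemma norm_sq_sum_mul_eq {ι : Type*} [Fintype ι] (c : ι → ℂ) (f : ι → ℂ → ℂ) (W : ℂ → ℝ) (z : ℂ) :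
    ((‖∑ q, c q * f q z‖ ^ 2 * W z : ℝ) : ℂ) = ∑ q, ∑ q', (starRingEnd ℂ) (c q) * c q' *
      ((starRingEnd ℂ) (f q z) * f q' z * W z) := by
  rw [Complex.ofReal_mul, ← Complex.normSq_eq_norm_sq, ← Complex.mul_conj,
    mul_comm (∑ q, c q * f q z), map_sum, Finset.sum_mul_sum, Finset.sum_mul]
  refine Finset.sum_congr rfl fun k _ => ?_
  rw [Finset.sum_mul]
  refine Finset.sum_congr rfl fun l _ => ?_
  rw [map_mul]; ring

lemma continuous_norm_sq_poleSystem {ψ : ℂ → ℝ} (hψ : ContDiff ℝ 2 ψ) (hψp : PeriodicC ψ) {s h : ℝ}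
    (hs : 0 < s) (hsπ : 3 * s < π) (hh : 0 < h) (P : Finset ℂ) (n : ℕ) (c : P × Fin (n - 2) → ℂ) :
    Continuous (fun z => ‖∑ q, c q * poleSystem P n q z‖ ^ 2 * poleSystemWeight ψ s h P n z) := by
  have : Continuous (fun z =>
      ((‖∑ q, c q * poleSystem P n q z‖ ^ 2 * poleSystemWeight ψ s h P n z : ℝ) : ℂ)) := by
    simp_rw [norm_sq_sum_mul_eq c (poleSystem P n) (poleSystemWeight ψ s h P n)]
    exact continuous_finsetSum _ fun q _ => continuous_finsetSum _ fun q' _ =>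
      continuous_const.mul (continuous_poleSystem_mul hψ hψp hs hsπ hh P n q q')
  exact (Complex.continuous_re.comp this).congr fun z => Complex.ofReal_re _

lemma periodicC_norm_sq_poleSystem {ψ : ℂ → ℝ} (hψp : PeriodicC ψ) (s h : ℝ)
    (P : Finset ℂ) (n : ℕ) (c : P × Fin (n - 2) → ℂ) :
    PeriodicC (fun z => ‖∑ q, c q * poleSystem P n q z‖ ^ 2 * poleSystemWeight ψ s h P n z) := by
  have h1 : PeriodicC (fun z => ∑ q, c q * poleSystem P n q z) := fun z =>
    ⟨Finset.sum_congr rfl fun q _ => congrArg (c q * ·) (periodicC_poleSystem P n q z).1,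
     Finset.sum_congr rfl fun q _ => congrArg (c q * ·) (periodicC_poleSystem P n q z).2⟩
  exact h1.comp₂ (periodicC_poleSystemWeight hψp s h P n) fun x y => ‖x‖ ^ 2 * y

lemma exists_poleSystem_basis {ψ : ℂ → ℝ} (hψ : ContDiff ℝ 2 ψ) (hψp : PeriodicC ψ) {s h : ℝ}
    (hs : 0 < s) (hsπ : 3 * s < π) (hh : 0 < h) {P : Finset ℂ} (hP : (P : Set ℂ) ⊆ Efd) (n : ℕ)
    {Ω : Set ℂ} (hΩ : MeasurableSet Ω) :
    ∃ (e : Fin (Fintype.card (P × Fin (n - 2))) → P × Fin (n - 2) → ℂ)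
      (lam : Fin (Fintype.card (P × Fin (n - 2))) → ℝ),
      (∀ c : Fin (Fintype.card (P × Fin (n - 2))) → ℂ,
        ∫ z in Efd, ‖∑ i, c i * ∑ q, e i q * poleSystem P n q z‖ ^ 2 *
          poleSystemWeight ψ s h P n z = ∑ i, ‖c i‖ ^ 2) ∧
      (∀ c : Fin (Fintype.card (P × Fin (n - 2))) → ℂ,
        ∫ z in Efd ∩ Ω, ‖∑ i, c i * ∑ q, e i q * poleSystem P n q z‖ ^ 2 *
          poleSystemWeight ψ s h P n z = ∑ i, lam i * ‖c i‖ ^ 2) := by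
  have hA : ∀ q q', Integrable (fun z => (starRingEnd ℂ) (poleSystem P n q z) * poleSystem P n q' z *
      poleSystemWeight ψ s h P n z) (volume.restrict Efd) := fun q q' =>
    (continuous_poleSystem_mul hψ hψp hs hsπ hh P n q q').integrableOn_Efd
  have hB : ∀ q q', Integrable (fun z => (starRingEnd ℂ) (poleSystem P n q z) * poleSystem P n q' z *
      (Ω.indicator (poleSystemWeight ψ s h P n) z : ℝ)) (volume.restrict Efd) := by
    intro q q'
    refine ((hA q q').indicator hΩ).congr (Filter.Eventually.of_forall fun z => ?_)
    by_cases hz : z ∈ Ω <;> simp [hz]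
  obtain ⟨e, lam, -, h1, h2⟩ := exists_simultaneous_functions hA hB (by
    intro c hc
    obtain ⟨z, hz, hne⟩ := exists_poleSystem_sum_ne_zero hP hc
    exact setIntegral_Efd_pos (periodicC_norm_sq_poleSystem hψp s h P n c)
      (continuous_norm_sq_poleSystem hψ hψp hs hsπ hh P n c)
      (fun z => mul_nonneg (sq_nonneg _) (poleSystemWeight_nonneg ψ s h P n z))
      ⟨z, mul_ne_zero (pow_ne_zero _ (norm_ne_zero_iff.2 hne))
        (poleSystemWeight_pos ψ s h n hz).ne'⟩)
  refine ⟨e, lam, h1, fun c => ?_⟩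
  rw [← h2 c, ← setIntegral_indicator hΩ]
  refine integral_congr_ae (Filter.Eventually.of_forall fun z => ?_)
  by_cases hz : z ∈ Ω <;> simp [hz]

/-- Trace of a restricted orthonormal system, bounded below through its density. -/
lemma sum_eigenvalues_ge {ι : Type*} [Fintype ι] {g : ι → ℂ → ℂ} {W B : ℂ → ℝ} {lam : ι → ℝ}
    {Ω : Set ℂ} (hΩ : MeasurableSet Ω) (hW : ∀ z, 0 ≤ W z)
    (h_int : ∀ i, IntegrableOn (fun z => ‖g i z‖ ^ 2 * W z) Efd)
    (hA : ∀ c : ι → ℂ, ∫ z in Efd, ‖∑ i, c i * g i z‖ ^ 2 * W z = ∑ i, ‖c i‖ ^ 2)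
    (hB : ∀ c : ι → ℂ, ∫ z in Efd ∩ Ω, ‖∑ i, c i * g i z‖ ^ 2 * W z = ∑ i, lam i * ‖c i‖ ^ 2)
    (hBint : IntegrableOn B Efd) (hd : ∀ z, (∑ i, ‖g i z‖ ^ 2) * W z ≤ B z) :
    (∀ i, 0 ≤ lam i ∧ lam i ≤ 1) ∧ (Fintype.card ι : ℝ) - (∫ z in Efd \ Ω, B z) ≤ ∑ i, lam i := by
  classical
  have h1 : ∀ i, ∫ z in Efd, ‖g i z‖ ^ 2 * W z = 1 := fun i => by
    have := hA (Pi.single i 1)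
    simpa [Pi.single_apply, ite_mul, apply_ite] using this
  have h2 : ∀ i, ∫ z in Efd ∩ Ω, ‖g i z‖ ^ 2 * W z = lam i := fun i => by
    have := hB (Pi.single i 1)
    simpa [Pi.single_apply, ite_mul, apply_ite] using this
  have h3 : ∀ i, lam i + ∫ z in Efd \ Ω, ‖g i z‖ ^ 2 * W z = 1 := fun i => by
    rw [← h1 i, ← h2 i, integral_inter_add_sdiff hΩ (h_int i)]
  have hnn : ∀ i z, 0 ≤ ‖g i z‖ ^ 2 * W z := fun i z => mul_nonneg (sq_nonneg _) (hW z)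
  refine ⟨fun i => ⟨?_, ?_⟩, ?_⟩
  · rw [← h2 i]; exact integral_nonneg (hnn i)
  · have : 0 ≤ ∫ z in Efd \ Ω, ‖g i z‖ ^ 2 * W z := integral_nonneg (hnn i)
    linarith [h3 i]
  · have e : (Fintype.card ι : ℝ) = ∑ i, lam i + ∑ i, ∫ z in Efd \ Ω, ‖g i z‖ ^ 2 * W z := by
      rw [← Finset.sum_add_distrib, Finset.sum_congr rfl fun i _ => h3 i]; simp
    have hi : ∀ i ∈ Finset.univ, IntegrableOn (fun z => ‖g i z‖ ^ 2 * W z) (Efd \ Ω) := fun i _ =>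
      (h_int i).mono_set Set.sdiff_subset
    have : ∑ i, ∫ z in Efd \ Ω, ‖g i z‖ ^ 2 * W z ≤ ∫ z in Efd \ Ω, B z := by
      rw [← integral_finsetSum _ hi]
      refine integral_mono (integrable_finsetSum _ hi) (hBint.mono_set Set.sdiff_subset) fun z => ?_
      simpa [Finset.sum_mul] using hd z
    linarith

/-- The number of eigenvalues above a threshold is controlled by the trace. -/
lemma sum_le_card_add {ι : Type*} [Fintype ι] {lam : ι → ℝ} (hl : ∀ i, lam i ≤ 1) {θ : ℝ}
    (hθ : 0 ≤ θ) : ∑ i, lam i ≤ (Fintype.card {i // θ ≤ lam i} : ℝ) + Fintype.card ι * θ := by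
  classical
  have : ∀ i, lam i ≤ (if θ ≤ lam i then 1 else 0) + θ := fun i => by
    split_ifs with h
    · linarith [hl i]
    · push Not at h; linarith
  refine (Finset.sum_le_sum fun i _ => this i).trans (le_of_eq ?_)
  rw [Finset.sum_add_distrib, Finset.sum_boole, Fintype.card_subtype]
  simp

/-- Integral bound for the local density off the set `{c₃ ≤ y}`. -/
lemma integral_density_le {ψ y : ℂ → ℝ} (hψ : ContDiff ℝ 2 ψ) (hψp : PeriodicC ψ)
    (hy : Continuous y) {s m ε c₀ c₃ : ℝ} (hs : 0 < s) (hsπ : 3 * s < π) (hm : 0 ≤ m) (hε : 0 ≤ ε)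
    (P : Finset ℂ)
    (hP : ∀ z, y z ≤ c₀ → 0 ≤ lapC ψ z + m * ∑ p ∈ P, poleDensity s (z - p)) :
    ∫ z in Efd \ {z | c₃ ≤ y z}, (max (lapC ψ z + m * ∑ p ∈ P, poleDensity s (z - p)) 0 + ε) ≤
      2 * π * m * P.card - (∫ z in Efd ∩ {z | c₃ ≤ y z}, lapC ψ z) +
      (∫ z in Efd ∩ {z | c₀ < y z ∧ y z < c₃}, max (-lapC ψ z) 0) + 4 * π ^ 2 * ε := by
  have hlap : Continuous (lapC ψ) := hψ.continuous_lapC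
  have hβ : Continuous (poleDensity s) := continuous_poleDensity hs hsπ
  set S : ℂ → ℝ := fun z => ∑ p ∈ P, poleDensity s (z - p) with hS
  have hSc : Continuous S := continuous_finsetSum _ fun p _ => hβ.comp (by fun_prop)
  have hS0 : ∀ z, 0 ≤ S z := fun z => Finset.sum_nonneg fun p _ => poleDensity_nonneg hs _
  have hSi : ∫ z in Efd, S z = 2 * π * P.card := by
    have hi : ∀ p ∈ P, IntegrableOn (fun z => poleDensity s (z - p)) Efd := fun p _ =>
      (hβ.comp (by fun_prop : Continuous fun z : ℂ => z - p)).integrableOn_Efd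
    rw [integral_finsetSum _ hi]
    simp_rw [sub_eq_add_neg, setIntegral_Efd_shift (periodicC_poleDensity s),
      integral_poleDensity hs hsπ]
    simp [mul_comm]
  have hΩ : MeasurableSet {z | c₃ ≤ y z} := measurableSet_le measurable_const hy.measurable
  have hU : MeasurableSet {z | c₀ < y z ∧ y z < c₃} :=
    (measurableSet_lt measurable_const hy.measurable).inter
      (measurableSet_lt hy.measurable measurable_const)
  set F : ℂ → ℝ := fun z => {z | c₀ < y z ∧ y z < c₃}.indicator (fun z => max (-lapC ψ z) 0) z
    with hF
  have hneg : Continuous (fun z => max (-lapC ψ z) 0) := by fun_prop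
  have hFi : IntegrableOn F Efd := hneg.integrableOn_Efd.indicator hU
  have hF0 : ∀ z, 0 ≤ F z := fun z => Set.indicator_nonneg (fun _ _ => le_max_right _ _) _
  have hlapi := hlap.integrableOn_Efd
  have hSci := (hSc.const_mul m).integrableOn_Efd
  have hci : IntegrableOn (fun _ : ℂ => ε) Efd := continuous_const.integrableOn_Efd
  have hlapsplit := integral_inter_add_sdiff hΩ hlapi
  rw [integral_Efd_lapC hψp hψ] at hlapsplit
  have hle : ∫ z in Efd \ {z | c₃ ≤ y z}, (max (lapC ψ z + m * S z) 0 + ε) ≤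
      ∫ z in Efd \ {z | c₃ ≤ y z}, (lapC ψ z + (m * S z + (F z + ε))) := by
    refine setIntegral_mono_on ?_ ?_ (measurableSet_Efd.diff hΩ) fun z hz => ?_
    · exact IntegrableOn.mono_set (Continuous.integrableOn_Efd (by fun_prop)) Set.sdiff_subset
    · exact (hlapi.add (hSci.add (hFi.add hci))).mono_set Set.sdiff_subset
    · have hz3 : y z < c₃ := not_le.1 hz.2
      have h0 := mul_nonneg hm (hS0 z)
      rcases le_or_gt (y z) c₀ with h | h
      · rw [max_eq_left (hP z h)]; linarith [hF0 z]
      · have : F z = max (-lapC ψ z) 0 := Set.indicator_of_mem (show z ∈ {z | c₀ < y z ∧ y z < c₃} from ⟨h, hz3⟩) _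
        rw [this]
        rcases max_cases (-lapC ψ z) 0 with h1 | h1 <;>
        rcases max_cases (lapC ψ z + m * S z) 0 with h2 | h2 <;> linarith
  refine hle.trans ?_
  have hd : Efd \ {z | c₃ ≤ y z} ⊆ Efd := Set.sdiff_subset
  have j1 : IntegrableOn (fun z => F z + ε) (Efd \ {z | c₃ ≤ y z}) := (hFi.add hci).mono_set hd
  have j2 : IntegrableOn (fun z => m * S z + (F z + ε)) (Efd \ {z | c₃ ≤ y z}) :=
    (hSci.mono_set hd).add j1
  rw [integral_add (hlapi.mono_set hd) j2, integral_add (hSci.mono_set hd) j1,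
    integral_add (hFi.mono_set hd) (hci.mono_set hd)]
  have i1 : ∫ z in Efd \ {z | c₃ ≤ y z}, m * S z ≤ 2 * π * m * P.card := by
    refine (setIntegral_mono_set hSci (Filter.Eventually.of_forall fun z => mul_nonneg hm (hS0 z))
      hd.eventuallyLE).trans (le_of_eq ?_)
    rw [integral_const_mul, hSi]; ring
  have i2 : ∫ z in Efd \ {z | c₃ ≤ y z}, F z ≤
      ∫ z in Efd ∩ {z | c₀ < y z ∧ y z < c₃}, max (-lapC ψ z) 0 := by
    refine (setIntegral_mono_set hFi (Filter.Eventually.of_forall hF0)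
      hd.eventuallyLE).trans (le_of_eq ?_)
    exact setIntegral_indicator hU
  have i3 : ∫ z in Efd \ {z | c₃ ≤ y z}, ε ≤ 4 * π ^ 2 * ε := by
    refine (setIntegral_mono_set hci (Filter.Eventually.of_forall fun z => hε)
      hd.eventuallyLE).trans (le_of_eq ?_)
    rw [setIntegral_const, volumeReal_Efd]; simp
  linarith

lemma exists_cutoff {y : ℂ → ℝ} (hy : ContDiff ℝ (⊤ : ℕ∞) y) (hyp : PeriodicC y) {c₁ c₂ : ℝ}
    (hc : c₁ < c₂) : ∃ χ : ℂ → ℂ, ContDiff ℝ (⊤ : ℕ∞) χ ∧ PeriodicC χ ∧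
      (∀ z, y z ≤ c₁ → χ z = 0) ∧ (∀ z, c₂ ≤ y z → χ z = 1) := by
  refine ⟨fun z => (Real.smoothTransition ((y z - c₁) / (c₂ - c₁)) : ℝ), ?_, ?_, ?_, ?_⟩
  · have h1 : ContDiff ℝ (⊤ : ℕ∞) (fun z => Real.smoothTransition ((y z - c₁) / (c₂ - c₁))) :=
      Real.smoothTransition.contDiff.comp ((hy.sub contDiff_const).div_const _)
    exact Complex.ofRealCLM.contDiff.comp h1
  · exact hyp.comp fun t => ((Real.smoothTransition ((t - c₁) / (c₂ - c₁)) : ℝ) : ℂ)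
  · intro z hz
    beta_reduce
    rw [Real.smoothTransition.zero_of_nonpos (div_nonpos_of_nonpos_of_nonneg (by linarith)
      (by linarith))]
    simp
  · intro z hz
    beta_reduce
    rw [Real.smoothTransition.one_of_one_le ((one_le_div (by linarith)).2 (by linarith))]
    simp

lemma dbar_congr {u v : ℂ → ℂ} {z : ℂ} (h : u =ᶠ[nhds z] v) : dbar u z = dbar v z := by
  rw [dbar, dbar, h.fderiv_eq]

lemma dbar_const (c z : ℂ) : dbar (fun _ => c) z = 0 := by
  simp [dbar]

/-- Cutting off a system of functions holomorphic near `{c₁ ≤ y}` produces quasimodes. -/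
lemma exists_quasimode_space {κ : Type*} [Fintype κ] {g : κ → ℂ → ℂ} {φ ψ y W : ℂ → ℝ} {χ : ℂ → ℂ}
    {U : Set ℂ} {τ η c₁ c₂ c₃ h K : ℝ}
    (hφ : Continuous φ) (hy : Continuous y) (h23 : c₂ ≤ c₃) (hh : 0 < h)
    (hχ : ContDiff ℝ (⊤ : ℕ∞) χ) (hχp : PeriodicC χ) (hχ0 : ∀ z, y z ≤ c₁ → χ z = 0)
    (hχ1 : ∀ z, c₂ ≤ y z → χ z = 1) (hK : ∀ z, ‖dbar χ z‖ ≤ K)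
    (hU : IsOpen U) (hUy : ∀ z, c₁ ≤ y z → z ∈ U)
    (hgd : ∀ i, DifferentiableOn ℂ (g i) U) (hgp : ∀ i, PeriodicC (g i))
    (hW0 : ∀ z, 0 ≤ W z) (hW : ∀ z, c₁ ≤ y z → W z = Real.exp (-2 * ψ z / h))
    (h_int : ∀ c : κ → ℂ, IntegrableOn (fun z => ‖∑ i, c i * g i z‖ ^ 2 * W z) Efd)
    (hA : ∀ c : κ → ℂ, ∫ z in Efd, ‖∑ i, c i * g i z‖ ^ 2 * W z ≤ ∑ i, ‖c i‖ ^ 2)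
    (hB : ∀ c : κ → ℂ, Real.exp (-η / h) * ∑ i, ‖c i‖ ^ 2 ≤
      ∫ z in Efd ∩ {z | c₃ ≤ y z}, ‖∑ i, c i * g i z‖ ^ 2 * W z)
    (hψ1 : ∀ z, c₁ ≤ y z → y z ≤ c₂ → ψ z ≤ φ z - τ - η) (hψ2 : ∀ z, c₃ ≤ y z → φ z ≤ ψ z)
    (hsmall : h ^ 2 * K ^ 2 * Real.exp (-η / h) ≤ 1) :
    ∃ V : Submodule ℂ (ℂ → ℂ), Module.finrank ℂ V = Fintype.card κ ∧
      (∀ u ∈ V, ContDiff ℝ (⊤ : ℕ∞) u ∧ PeriodicC u) ∧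
      (∀ u ∈ V, wInt φ h (fun z => (h : ℂ) * dbar u z) ≤
        Real.exp (-τ / h) ^ 2 * wInt φ h u) := by
  have hK0 : 0 ≤ K := (norm_nonneg _).trans (hK 0)
  have hΩ : MeasurableSet {z | c₃ ≤ y z} := measurableSet_le measurable_const hy.measurable
  set G : (κ → ℂ) → ℂ → ℂ := fun c z => ∑ i, c i * g i z with hG
  have hGd : ∀ c, DifferentiableOn ℂ (G c) U := fun c =>
    DifferentiableOn.fun_sum fun i _ => (hgd i).const_mul (c i)
  have hGp : ∀ c, PeriodicC (G c) := fun c z =>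
    ⟨Finset.sum_congr rfl fun i _ => congrArg (c i * ·) (hgp i z).1,
     Finset.sum_congr rfl fun i _ => congrArg (c i * ·) (hgp i z).2⟩
  have hzero : ∀ c z, y z < c₁ → (fun w => χ w * G c w) =ᶠ[nhds z] fun _ => 0 := by
    intro c z hz
    filter_upwards [hy.continuousAt.eventually_lt continuousAt_const hz] with w hw
    rw [hχ0 w hw.le, zero_mul]
  have hsm : ∀ c, ContDiff ℝ (⊤ : ℕ∞) (fun z => χ z * G c z) := by
    intro c
    rw [contDiff_iff_contDiffAt]
    intro z
    rcases lt_or_ge (y z) c₁ with hz | hz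
    · exact contDiffAt_const.congr_of_eventuallyEq (hzero c z hz)
    · have h1 : AnalyticAt ℂ (G c) z := (hGd c).analyticAt (hU.mem_nhds (hUy z hz))
      exact hχ.contDiffAt.mul (h1.contDiffAt.restrict_scalars ℝ)
  have hper : ∀ c, PeriodicC (fun z => χ z * G c z) := fun c => hχp.comp₂ (hGp c) fun a b => a * b
  have hdb : ∀ c z, ‖(h : ℂ) * dbar (fun w => χ w * G c w) z‖ ^ 2 * Real.exp (-2 * φ z / h) ≤
      h ^ 2 * K ^ 2 * Real.exp (-2 * (τ + η) / h) * (‖G c z‖ ^ 2 * W z) := by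
    intro c z
    have hnn : 0 ≤ h ^ 2 * K ^ 2 * Real.exp (-2 * (τ + η) / h) * (‖G c z‖ ^ 2 * W z) :=
      mul_nonneg (by positivity) (mul_nonneg (sq_nonneg _) (hW0 z))
    rcases lt_or_ge (y z) c₁ with hz | hz
    · rw [dbar_congr (hzero c z hz), dbar_const]; simpa using hnn
    have hd : DifferentiableAt ℂ (G c) z := (hGd c).differentiableAt (hU.mem_nhds (hUy z hz))
    rw [dbar_mul_of_differentiableAt (hχ.differentiable (by simp) z) hd]
    rcases lt_or_ge c₂ (y z) with hz2 | hz2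
    · have : χ =ᶠ[nhds z] fun _ => 1 := by
        filter_upwards [continuousAt_const.eventually_lt hy.continuousAt hz2] with w hw
        exact hχ1 w hw.le
      rw [dbar_congr this, dbar_const]; simpa using hnn
    rw [hW z hz]
    have h2 : Real.exp (-2 * φ z / h) ≤
        Real.exp (-2 * (τ + η) / h) * Real.exp (-2 * ψ z / h) := by
      rw [← Real.exp_add, Real.exp_le_exp, ← add_div]
      refine div_le_div_of_nonneg_right ?_ hh.le
      linarith [hψ1 z hz hz2]
    have h3 : ‖(h : ℂ) * (dbar χ z * G c z)‖ ^ 2 ≤ h ^ 2 * K ^ 2 * ‖G c z‖ ^ 2 := by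
      rw [norm_mul, norm_mul, mul_pow, mul_pow, Complex.norm_real, Real.norm_eq_abs, sq_abs, mul_assoc]
      gcongr
      exact hK z
    calc _ ≤ h ^ 2 * K ^ 2 * ‖G c z‖ ^ 2 *
          (Real.exp (-2 * (τ + η) / h) * Real.exp (-2 * ψ z / h)) := by gcongr
      _ = _ := by ring
  have hup : ∀ c, wInt φ h (fun z => (h : ℂ) * dbar (fun w => χ w * G c w) z) ≤
      h ^ 2 * K ^ 2 * Real.exp (-2 * (τ + η) / h) * ∑ i, ‖c i‖ ^ 2 := by
    intro c
    refine le_trans (integral_mono_of_nonneg (Filter.Eventually.of_forall fun z => by positivity)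
      ((h_int c).const_mul _) (Filter.Eventually.of_forall (hdb c))) ?_
    rw [integral_const_mul]
    exact mul_le_mul_of_nonneg_left (hA c) (by positivity)
  have hlow : ∀ c, Real.exp (-η / h) * ∑ i, ‖c i‖ ^ 2 ≤ wInt φ h (fun z => χ z * G c z) := by
    intro c
    have hc : Continuous (fun z => ‖χ z * G c z‖ ^ 2 * Real.exp (-2 * φ z / h)) :=
      ((hsm c).continuous.norm.pow 2).mul (by fun_prop)
    refine (hB c).trans (le_trans ?_ (setIntegral_mono_set hc.integrableOn_Efd
      (Filter.Eventually.of_forall fun z => by positivity) (LE.le.eventuallyLE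
        (Set.inter_subset_left : Efd ∩ {z | c₃ ≤ y z} ⊆ Efd))))
    refine setIntegral_mono_on ((h_int c).mono_set Set.inter_subset_left)
      (hc.integrableOn_Efd.mono_set Set.inter_subset_left) (measurableSet_Efd.inter hΩ)
      fun z hz => ?_
    have hz3 : c₃ ≤ y z := hz.2
    rcases lt_or_ge (y z) c₁ with hz1 | hz1
    · exfalso
      have a := hχ0 z hz1.le
      rw [hχ1 z (h23.trans hz3)] at a
      exact one_ne_zero a
    beta_reduce
    rw [hχ1 z (h23.trans hz3), one_mul, hW z hz1]
    refine mul_le_mul_of_nonneg_left (Real.exp_le_exp.2 ?_) (sq_nonneg _)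
    refine div_le_div_of_nonneg_right ?_ hh.le
    linarith [hψ2 z hz3]
  set u : κ → ℂ → ℂ := fun i z => χ z * g i z with hu
  have hsum : ∀ c : κ → ℂ, ∑ i, c i • u i = fun z => χ z * G c z := by
    intro c
    funext z
    simp only [hu, hG, Finset.sum_apply, Pi.smul_apply, smul_eq_mul, Finset.mul_sum]
    exact Finset.sum_congr rfl fun i _ => by ring
  have hli : LinearIndependent ℂ u := by
    rw [Fintype.linearIndependent_iff]
    intro c hc i
    have h1 := hlow c
    rw [← hsum c, hc] at h1
    have h2 : wInt φ h (0 : ℂ → ℂ) = 0 := by simp [wInt]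
    rw [h2] at h1
    have h3 : ∑ i, ‖c i‖ ^ 2 ≤ 0 := nonpos_of_mul_nonpos_right h1 (Real.exp_pos _)
    have h4 := (Finset.sum_eq_zero_iff_of_nonneg (fun i _ => sq_nonneg ‖c i‖)).1
      (le_antisymm h3 (Finset.sum_nonneg fun i _ => sq_nonneg _)) i (Finset.mem_univ i)
    simpa using h4
  refine ⟨Submodule.span ℂ (Set.range u), finrank_span_eq_card hli, fun v hv => ?_, fun v hv => ?_⟩
  · obtain ⟨c, rfl⟩ := (Submodule.mem_span_range_iff_exists_fun ℂ).1 hv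
    rw [hsum c]
    exact ⟨hsm c, hper c⟩
  · obtain ⟨c, rfl⟩ := (Submodule.mem_span_range_iff_exists_fun ℂ).1 hv
    rw [hsum c]
    refine (hup c).trans (le_trans ?_ (mul_le_mul_of_nonneg_left (hlow c) (by positivity)))
    have e : Real.exp (-2 * (τ + η) / h) = Real.exp (-τ / h) ^ 2 * (Real.exp (-η / h) * Real.exp (-η / h)) := by
      rw [← Real.exp_nat_mul, ← Real.exp_add, ← Real.exp_add]
      congr 1; push_cast; ring
    rw [e]
    have h5 : 0 ≤ Real.exp (-τ / h) ^ 2 * (Real.exp (-η / h) * ∑ i, ‖c i‖ ^ 2) := by positivity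
    nlinarith

lemma PeriodicC.exists_uniform_delta {F : Type*} [NormedAddCommGroup F] {f : ℂ → F}
    (hf : PeriodicC f) (hc : Continuous f) {ε : ℝ} (hε : 0 < ε) :
    ∃ δ > 0, ∀ z w : ℂ, dist z w ≤ δ → dist (f z) (f w) ≤ ε := by
  obtain ⟨δ, hδ, h⟩ := exists_delta_of_continuous_normed
    (isCompact_closedBall (0 : ℂ) (4 * π + 1)) hc hε
  refine ⟨min δ 1, by positivity, fun z w hzw => ?_⟩
  obtain ⟨m, k, hmk⟩ := exists_lat_mem_Sq 0 z
  rw [Sq_zero] at hmk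
  have hz := Efd_subset_closedBall hmk
  rw [mem_closedBall_zero_iff] at hz
  have hd : dist (z + lat m k) (w + lat m k) ≤ min δ 1 := by simpa using hzw
  have := h (z + lat m k) (by rw [mem_closedBall_zero_iff]; linarith) (w + lat m k) (by
    rw [mem_closedBall_zero_iff]
    have h1 := norm_le_norm_add_norm_sub (z + lat m k) (w + lat m k)
    rw [← dist_eq_norm] at h1
    linarith [hd.trans (min_le_right δ 1)]) (hd.trans (min_le_left _ _))
  rwa [hf.add_lat, hf.add_lat] at this

/-- A finite net, modulo the lattice, of a sublevel set of a periodic function. -/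
lemma exists_sublevel_net {y : ℂ → ℝ} (hy : Continuous y) (hyp : PeriodicC y) (c₀ : ℝ) {r : ℝ}
    (hr : 0 < r) : ∃ P : Finset ℂ, (P : Set ℂ) ⊆ Efd ∧ (∀ p ∈ P, y p ≤ c₀) ∧
      ∀ z, y z ≤ c₀ → ∃ p ∈ P, ∃ m k, ‖z - p - lat m k‖ ≤ r := by
  classical
  have hK : IsCompact (Metric.closedBall (0 : ℂ) (4 * π) ∩ {z | y z ≤ c₀}) :=
    (isCompact_closedBall _ _).inter_right (isClosed_le hy continuous_const)
  obtain ⟨t, htK, htf, hcov⟩ := hK.finite_cover_balls hr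
  have hred : ∀ z : ℂ, ∃ w : ℂ, w ∈ Efd ∧ ∃ m k, w = z + lat m k := fun z => by
    obtain ⟨m, k, hmk⟩ := exists_lat_mem_Sq 0 z
    rw [Sq_zero] at hmk
    exact ⟨_, hmk, m, k, rfl⟩
  choose R hRE hR using hred
  refine ⟨htf.toFinset.image R, ?_, ?_, ?_⟩
  · intro p hp
    obtain ⟨z, -, rfl⟩ := Finset.mem_image.1 (Finset.mem_coe.1 hp)
    exact hRE z
  · intro p hp
    obtain ⟨z, hz, rfl⟩ := Finset.mem_image.1 hp
    obtain ⟨m, k, e⟩ := hR z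
    rw [e, hyp.add_lat]
    exact (htK (htf.mem_toFinset.1 hz)).2
  · intro z hz
    obtain ⟨m, k, e⟩ := hR z
    have hmem : R z ∈ Metric.closedBall (0 : ℂ) (4 * π) ∩ {z | y z ≤ c₀} :=
      ⟨Efd_subset_closedBall (hRE z), by
        rw [Set.mem_ofPred_eq, e, hyp.add_lat]; exact hz⟩
    obtain ⟨x, hx, hxz⟩ := Set.mem_iUnion₂.1 (hcov hmem)
    obtain ⟨m', k', e'⟩ := hR x
    refine ⟨R x, Finset.mem_image_of_mem _ (htf.mem_toFinset.2 hx), -m - m', -k - k', ?_⟩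
    rw [Metric.mem_ball, dist_eq_norm, e] at hxz
    refine le_of_eq_of_le (congrArg _ ?_) hxz.le
    rw [e', lat_sub, lat_neg]; ring

lemma sum_mul_sum_comm {ι κ : Type*} [Fintype ι] [Fintype κ] (c : ι → ℂ) (e : ι → κ → ℂ)
    (f : κ → ℂ) : ∑ i, c i * ∑ q, e i q * f q = ∑ q, (∑ i, c i * e i q) * f q := by
  simp_rw [Finset.mul_sum, Finset.sum_mul]
  rw [Finset.sum_comm]
  simp_rw [mul_assoc]

lemma isOpen_off_poles (P : Finset ℂ) : IsOpen {z : ℂ | ∀ p ∈ P, z - p ∉ latGroup} := by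
  have : {z : ℂ | ∀ p ∈ P, z - p ∉ latGroup} =
      ⋂ p ∈ P, (fun z : ℂ => z - p) ⁻¹' (latGroup : Set ℂ)ᶜ := by
    ext z; simp
  rw [this]
  exact isOpen_biInter_finset fun p _ =>
    isClosed_latGroup.isOpen_compl.preimage (by fun_prop)

lemma differentiableOn_poleSystem (P : Finset ℂ) (n : ℕ) (q : P × Fin (n - 2)) :
    DifferentiableOn ℂ (poleSystem P n q) {z : ℂ | ∀ p ∈ P, z - p ∉ latGroup} := by
  intro z hz
  have h1 := differentiableAt_poleFun (k := (q.2 : ℕ) + 2) (by omega) (hz q.1 q.1.2)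
  exact (h1.comp z (by fun_prop : DifferentiableAt ℂ (fun z : ℂ => z - q.1) z)).differentiableWithinAt

/-- For fixed `h`, the number of small singular values is bounded below by the trace of the
restricted Bergman-type density. -/
lemma card_good_ge {φ ψ y : ℂ → ℝ} (hφ : Continuous φ) (hψ : ContDiff ℝ 2 ψ) (hψp : PeriodicC ψ)
    (hy : Continuous y) (hyp : PeriodicC y) {χ : ℂ → ℂ}
    {τ η c₀ c₁ c₂ c₃ h K s r ε : ℝ} {P : Finset ℂ} {n : ℕ}
    (h01 : c₀ < c₁) (h23 : c₂ ≤ c₃) (hh : 0 < h) (hs : 0 < s) (hsπ : 3 * s < π)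
    (hχ : ContDiff ℝ (⊤ : ℕ∞) χ) (hχp : PeriodicC χ) (hχ0 : ∀ z, y z ≤ c₁ → χ z = 0)
    (hχ1 : ∀ z, c₂ ≤ y z → χ z = 1) (hK : ∀ z, ‖dbar χ z‖ ≤ K)
    (hP : (P : Set ℂ) ⊆ Efd) (hPy : ∀ p ∈ P, y p ≤ c₀)
    (hys : ∀ z w : ℂ, dist z w ≤ s → dist (y z) (y w) ≤ (c₁ - c₀) / 2)
    (hψ1 : ∀ z, c₁ ≤ y z → y z ≤ c₂ → ψ z ≤ φ z - τ - η) (hψ2 : ∀ z, c₃ ≤ y z → φ z ≤ ψ z)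
    (hsmall : h ^ 2 * K ^ 2 * Real.exp (-η / h) ≤ 1)
    (hε : 0 < ε) (hr : 0 < r) (hrs : r < s / 2)
    (hloc : ∀ z, ∃ (A : ℂ → ℂ) (Φ : ℂ → ℝ),
      Continuous Φ ∧ Differentiable ℂ A ∧
      (∀ q, DifferentiableOn ℂ (fun w => poleSystem P n q w * A w) (Metric.ball z (s / 2))) ∧
      (∀ w ∈ Metric.closedBall z (s / 2),
        poleSystemWeight ψ s h P n w = ‖A w‖ ^ 2 * Real.exp (-2 * Φ w / h)) ∧
      ∃ a b : ℂ, ∀ w : ℂ, ‖w‖ ≤ r → Φ (z + w) ≤ Φ z + (a * w + b * w ^ 2).re +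
        (max (lapC ψ z + h * n * ∑ p ∈ P, poleDensity s (z - p)) 0 + ε) / 4 * ‖w‖ ^ 2) :
    ∃ V : Submodule ℂ (ℂ → ℂ), (∀ u ∈ V, ContDiff ℝ (⊤ : ℕ∞) u ∧ PeriodicC u) ∧
      (∀ u ∈ V, wInt φ h (fun z => (h : ℂ) * dbar u z) ≤ Real.exp (-τ / h) ^ 2 * wInt φ h u) ∧
      (P.card * (n - 2 : ℕ) : ℝ) - (∫ z in Efd \ {z | c₃ ≤ y z},
          (max (lapC ψ z + h * n * ∑ p ∈ P, poleDensity s (z - p)) 0 + ε)) /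
          (2 * π * h * (1 - Real.exp (-ε * r ^ 2 / (2 * h)))) ≤
        Module.finrank ℂ V + P.card * (n - 2 : ℕ) * Real.exp (-η / h) := by
  classical
  have hΩ : MeasurableSet {z | c₃ ≤ y z} := measurableSet_le measurable_const hy.measurable
  obtain ⟨e, lam, hA, hB⟩ := exists_poleSystem_basis hψ hψp hs hsπ hh hP n hΩ
  set W := poleSystemWeight ψ s h P n with hWdef
  have hW0 : ∀ z, 0 ≤ W z := poleSystemWeight_nonneg ψ s h P n
  set g : Fin (Fintype.card (P × Fin (n - 2))) → ℂ → ℂ :=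
    fun i z => ∑ q, e i q * poleSystem P n q z with hg
  have hcomb : ∀ (c : Fin (Fintype.card (P × Fin (n - 2))) → ℂ) z,
      ∑ i, c i * g i z = ∑ q, (∑ i, c i * e i q) * poleSystem P n q z := fun c z =>
    sum_mul_sum_comm c e fun q => poleSystem P n q z
  have hper : ∀ c : Fin (Fintype.card (P × Fin (n - 2))) → ℂ,
      PeriodicC (fun w => ‖∑ i, c i * g i w‖ ^ 2 * W w) := fun c => by
    simp_rw [hcomb c]; exact periodicC_norm_sq_poleSystem hψp s h P n _
  have h_int : ∀ c : Fin (Fintype.card (P × Fin (n - 2))) → ℂ,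
      IntegrableOn (fun w => ‖∑ i, c i * g i w‖ ^ 2 * W w) Efd := fun c => by
    simp_rw [hcomb c]
    exact (continuous_norm_sq_poleSystem hψ hψp hs hsπ hh P n _).integrableOn_Efd
  have hinti : ∀ i, IntegrableOn (fun w => ‖g i w‖ ^ 2 * W w) Efd := fun i =>
    (continuous_norm_sq_poleSystem hψ hψp hs hsπ hh P n (e i)).integrableOn_Efd
  set B : ℂ → ℝ := fun z => max (lapC ψ z + h * n * ∑ p ∈ P, poleDensity s (z - p)) 0 + ε with hBd
  have hBε : ∀ z, ε ≤ B z := fun z => by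
    have := le_max_right (lapC ψ z + h * n * ∑ p ∈ P, poleDensity s (z - p)) 0
    simp only [hBd]; linarith
  have hBc : Continuous B := by
    have h1 : Continuous (lapC ψ) := hψ.continuous_lapC
    have h2 : Continuous (fun z => ∑ p ∈ P, poleDensity s (z - p)) :=
      continuous_finsetSum _ fun p _ => (continuous_poleDensity hs hsπ).comp (by fun_prop)
    fun_prop
  have he0 : 0 < 1 - Real.exp (-ε * r ^ 2 / (2 * h)) := by
    rw [sub_pos, Real.exp_lt_one_iff]
    exact div_neg_of_neg_of_pos (by nlinarith [pow_pos hr 2]) (by positivity)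
  have hd : ∀ z, (∑ i, ‖g i z‖ ^ 2) * W z ≤
      B z / (2 * π * h * (1 - Real.exp (-ε * r ^ 2 / (2 * h)))) := by
    intro z
    obtain ⟨A, Φ, hΦ, -, hAd, hWA, a, b, hT⟩ := hloc z
    have hrπ : r ≤ π := by linarith
    refine (density_le_of_local_factor (R := s / 2) hr hrs hrπ hh (hε.trans_le (hBε z)) hper h_int hW0
      (A := A) (Φ := Φ) (a := a) (b := b) ?_ hΦ.continuousOn hT
      (fun w hw => hWA w (Metric.closedBall_subset_closedBall hrs.le hw))
      (fun c => (hA c).le)).trans ?_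
    · intro i
      have : (fun w => g i w * A w) = fun w => ∑ q, e i q * (poleSystem P n q w * A w) := by
        funext w; simp only [hg, Finset.sum_mul, mul_assoc]
      rw [this]
      exact DifferentiableOn.fun_sum fun q _ => (hAd q).const_mul _
    · refine div_le_div_of_nonneg_left (hε.le.trans (hBε z)) (by positivity) ?_
      refine mul_le_mul_of_nonneg_left (sub_le_sub_left (Real.exp_le_exp.2 ?_) _) (by positivity)
      refine div_le_div_of_nonneg_right ?_ (by positivity)
      nlinarith [hBε z, pow_pos hr 2]
  obtain ⟨hlam, htr⟩ := sum_eigenvalues_ge hΩ hW0 hinti hA hB (hBc.div_const _).integrableOn_Efd hd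
  have hcount := sum_le_card_add (fun i => (hlam i).2) (Real.exp_pos (-η / h)).le
  set θ := Real.exp (-η / h) with hθ
  have hcard : (Fintype.card (Fin (Fintype.card (P × Fin (n - 2)))) : ℝ) =
      P.card * (n - 2 : ℕ) := by simp
  rw [integral_div, hcard] at htr
  rw [hcard] at hcount
  have hext : ∀ (c : {i // θ ≤ lam i} → ℂ) (F : Fin (Fintype.card (P × Fin (n - 2))) → ℂ),
      ∑ j, c j * F j.1 = ∑ i, Function.extend Subtype.val c 0 i * F i := fun c F =>
    Fintype.sum_of_injective Subtype.val Subtype.val_injective _ _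
      (fun i hi => by rw [Function.extend_apply' _ _ _ (by simpa using hi)]; simp)
      (fun j => by rw [Subtype.val_injective.extend_apply])
  have hextR : ∀ (c : {i // θ ≤ lam i} → ℂ) (F : Fin (Fintype.card (P × Fin (n - 2))) → ℝ),
      ∑ j, F j.1 * ‖c j‖ ^ 2 = ∑ i, F i * ‖Function.extend Subtype.val c 0 i‖ ^ 2 := fun c F =>
    Fintype.sum_of_injective Subtype.val Subtype.val_injective _ _
      (fun i hi => by rw [Function.extend_apply' _ _ _ (by simpa using hi)]; simp)
      (fun j => by rw [Subtype.val_injective.extend_apply])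
  have hoff : ∀ z, c₁ ≤ y z → ∀ p ∈ P, s ≤ ‖latRed (z - p)‖ := by
    intro z hz p hp
    by_contra hcon
    push Not at hcon
    obtain ⟨m, k, e⟩ := exists_latRed_eq (z - p)
    have h1 := hys (z + lat (-m) (-k)) p (by
      rw [dist_eq_norm]
      refine le_trans (le_of_eq (congrArg _ ?_)) hcon.le
      rw [e, lat_neg]; ring)
    rw [hyp.add_lat, Real.dist_eq] at h1
    have := (abs_le.1 h1).2
    linarith [hPy p hp]
  obtain ⟨V, hV1, hV2, hV3⟩ := exists_quasimode_space (κ := {i // θ ≤ lam i}) (g := fun j => g j.1)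
    (φ := φ) (ψ := ψ) (y := y) (W := W) (χ := χ) (τ := τ) (η := η) (c₁ := c₁) (c₂ := c₂) (c₃ := c₃)
    (K := K) hφ hy h23 hh hχ hχp hχ0 hχ1 hK (isOpen_off_poles P)
    (fun z hz p hp hl => by
      obtain ⟨m, k, e⟩ := hl
      have : z = p + lat m k := by linear_combination e
      rw [this, hyp.add_lat] at hz
      linarith [hPy p hp])
    (fun j => DifferentiableOn.fun_sum fun q _ => (differentiableOn_poleSystem P n q).const_mul _)
    (fun j z => ⟨Finset.sum_congr rfl fun q _ =>
        congrArg (e j.1 q * ·) (periodicC_poleSystem P n q z).1,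
      Finset.sum_congr rfl fun q _ => congrArg (e j.1 q * ·) (periodicC_poleSystem P n q z).2⟩)
    hW0 (fun z hz => by
      rw [hWdef, poleSystemWeight, Finset.prod_eq_one, mul_one]
      intro p hp
      rw [poleWeight_eq_one hs (hoff z hz p hp), one_pow])
    (fun c => by simp_rw [fun z => hext c fun i => g i z]; exact h_int _)
    (fun c => by
      simp_rw [fun z => hext c fun i => g i z]
      have := hextR c 1
      simp only [Pi.one_apply, one_mul] at this
      rw [this]
      exact (hA _).le)
    (fun c => by
      simp_rw [fun z => hext c fun i => g i z]
      refine le_trans ?_ (hB _).ge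
      rw [← hextR c lam, Finset.mul_sum]
      exact Finset.sum_le_sum fun j _ => mul_le_mul_of_nonneg_right j.2 (sq_nonneg _))
    hψ1 hψ2 hsmall
  refine ⟨V, hV2, hV3, ?_⟩
  rw [hV1]
  linarith

lemma trace_arithmetic {J h K D X₀ e θ N A B ε : ℝ} {n : ℕ} (hJ0 : 0 ≤ J) (hh : 0 < h)
    (hn2 : h * n ≤ K) (hD0 : 0 ≤ D) (hDX : D ≤ X₀) (hE0 : 0 < e) (hE : e ≤ 1 / 2) (hθ : 0 ≤ θ)
    (hV : J * (n - 2 : ℕ) - D / (2 * π * h * (1 - e)) ≤ N + J * (n - 2 : ℕ) * θ)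
    (hX : D ≤ 2 * π * (h * n) * J - A + B + ε / 2)
    (hrem : 4 * π * J * h + 2 * X₀ * e + 2 * π * J * K * θ ≤ ε / 2) :
    A - B - ε ≤ 2 * π * h * N := by
  have hpi := Real.pi_pos
  have hdiv : D / (1 - e) ≤ D + 2 * X₀ * e := by
    rw [div_le_iff₀ (by linarith)]
    nlinarith [mul_le_mul_of_nonneg_right hDX hE0.le,
      mul_nonneg (mul_nonneg (hD0.trans hDX) hE0.le) (by linarith : (0 : ℝ) ≤ 1 / 2 - e)]
  have hn3 : (n : ℝ) - 2 ≤ ((n - 2 : ℕ) : ℝ) := by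
    have : (n : ℤ) - 2 ≤ ((n - 2 : ℕ) : ℤ) := by omega
    exact_mod_cast this
  have hn4 : ((n - 2 : ℕ) : ℝ) ≤ n := by exact_mod_cast Nat.sub_le n 2
  have hV4 := mul_le_mul_of_nonneg_left hV (by positivity : 0 ≤ 2 * π * h)
  have e1 : 2 * π * h * (D / (2 * π * h * (1 - e))) = D / (1 - e) := by
    rw [← mul_div_assoc, mul_div_mul_left _ _ (by positivity)]
  rw [mul_sub, e1, mul_add] at hV4
  have e2 : 2 * π * h * (J * (n - 2 : ℕ)) ≥ 2 * π * (h * n) * J - 4 * π * J * h := by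
    have : 2 * π * h * (J * ((n : ℝ) - 2)) ≤ 2 * π * h * (J * (n - 2 : ℕ)) := by gcongr
    linarith
  have e3 : 2 * π * h * (J * (n - 2 : ℕ) * θ) ≤ 2 * π * J * K * θ := by
    have h1 : h * (n - 2 : ℕ) ≤ K := (mul_le_mul_of_nonneg_left hn4 hh.le).trans hn2
    calc _ = 2 * π * J * (h * (n - 2 : ℕ)) * θ := by ring
      _ ≤ _ := by gcongr
  linarith

/-- Asymptotic lower bound for the counting function. -/
lemma le_two_pi_mul_countN {φ ψ y : ℂ → ℝ} (hφ : ContDiff ℝ 2 φ) (hφp : PeriodicC φ)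
    (hψ : ContDiff ℝ 2 ψ) (hψp : PeriodicC ψ) (hy : ContDiff ℝ (⊤ : ℕ∞) y) (hyp : PeriodicC y)
    {τ η c₀ c₁ c₂ c₃ ε : ℝ} (hτ : 0 < τ) (hη : 0 < η) (h01 : c₀ < c₁) (h12 : c₁ < c₂)
    (h23 : c₂ ≤ c₃) (hψ1 : ∀ z, c₁ ≤ y z → y z ≤ c₂ → ψ z ≤ φ z - τ - η)
    (hψ2 : ∀ z, c₃ ≤ y z → φ z ≤ ψ z) (hε : 0 < ε) :
    ∃ h₀ > 0, ∀ h : ℝ, 0 < h → h ≤ h₀ →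
      (∫ z in Efd ∩ {z | c₃ ≤ y z}, lapC ψ z) -
        (∫ z in Efd ∩ {z | c₀ < y z ∧ y z < c₃}, max (-lapC ψ z) 0) - ε ≤
      2 * π * h * countN φ (Real.exp (-τ / h)) h := by
  have hpi := Real.pi_pos
  obtain ⟨χ, hχ, hχp, hχ0, hχ1⟩ := exists_cutoff hy hyp h12
  obtain ⟨K, hK0, hK⟩ := hχp.dbar.bounded (hχ.of_le (by norm_cast)).continuous_dbar
  obtain ⟨δ, hδ, hys⟩ := hyp.exists_uniform_delta hy.continuous
    (by linarith : 0 < (c₁ - c₀) / 2)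
  obtain ⟨Cl, hCl, hlap⟩ := hψp.lapC.bounded hψ.continuous_lapC
  set s := min δ 1 with hs
  have hs0 : 0 < s := by positivity
  have hsπ : 3 * s < π := by
    have := min_le_right δ 1
    linarith [Real.pi_gt_three]
  obtain ⟨P, hP, hPy, hnet⟩ := exists_sublevel_net hy.continuous hyp c₀ (half_pos hs0)
  set C' := Cl * s ^ 2 / 3 with hC'
  have hC'0 : 0 < C' := by positivity
  set ε' := ε / (8 * π ^ 2) with hε'
  have hε'0 : 0 < ε' := by positivity
  obtain ⟨r, hr, hrs, hloc⟩ := exists_local_poleSystem hψ hψp hs0 hsπ P (K := C' + 1) (by positivity)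
    hε'0
  obtain ⟨h₁, hh₁, hcount⟩ := finrank_le_countN hφ hφp hτ
  set IΩ := ∫ z in Efd ∩ {z | c₃ ≤ y z}, lapC ψ z with hIΩ
  set Im := ∫ z in Efd ∩ {z | c₀ < y z ∧ y z < c₃}, max (-lapC ψ z) 0 with hIm
  set J : ℝ := (P.card : ℝ) with hJ
  have hJ0 : 0 ≤ J := by positivity
  set X₀ := 2 * π * (C' + 1) * J + |IΩ| + |Im| + 4 * π ^ 2 * ε' with hX₀
  set e₀ : ℝ → ℝ := fun h => Real.exp (-ε' * r ^ 2 / (2 * h)) with he₀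
  have te : Filter.Tendsto e₀ (nhdsWithin 0 (Set.Ioi 0)) (nhds 0) := by
    have := tendsto_exp_neg_div_div_pow (c := ε' * r ^ 2 / 2) (by positivity) 0
    refine this.congr fun h => ?_
    simp only [pow_zero, div_one, he₀]
    congr 1
    rw [neg_div', div_div, neg_mul]
  have tθ : Filter.Tendsto (fun h : ℝ => Real.exp (-η / h)) (nhdsWithin 0 (Set.Ioi 0)) (nhds 0) := by
    simpa using tendsto_exp_neg_div_div_pow hη 0
  have th : Filter.Tendsto (fun h : ℝ => h) (nhdsWithin 0 (Set.Ioi 0)) (nhds 0) :=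
    nhdsWithin_le_nhds
  have trem : Filter.Tendsto (fun h : ℝ => 4 * π * J * h + 2 * X₀ * e₀ h +
      2 * π * J * (C' + 1) * Real.exp (-η / h)) (nhdsWithin 0 (Set.Ioi 0)) (nhds 0) := by
    simpa using ((th.const_mul (4 * π * J)).add (te.const_mul (2 * X₀))).add
      (tθ.const_mul (2 * π * J * (C' + 1)))
  have tsm : Filter.Tendsto (fun h : ℝ => h ^ 2 * K ^ 2 * Real.exp (-η / h))
      (nhdsWithin 0 (Set.Ioi 0)) (nhds 0) := by
    simpa using ((th.pow 2).mul_const (K ^ 2)).mul tθ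
  have hev := (((te.eventually_le_const (by norm_num : (0 : ℝ) < 1 / 2)).and
    (th.eventually_le_const one_pos)).and
    (trem.eventually_le_const (half_pos hε))).and (tsm.eventually_le_const one_pos)
  obtain ⟨h₂, hh₂, hsub⟩ := (mem_nhdsGT_iff_exists_Ioc_subset).1 hev
  refine ⟨min h₁ h₂, lt_min hh₁ hh₂, fun h hh hle => ?_⟩
  obtain ⟨⟨⟨hE, h1⟩, hrem⟩, hsm⟩ := hsub ⟨hh, hle.trans (min_le_right _ _)⟩
  set n := ⌈C' / h⌉₊ with hn
  have hn1 : C' ≤ h * n := by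
    have := Nat.le_ceil (C' / h)
    rwa [div_le_iff₀ hh, mul_comm] at this
  have hn2 : h * n ≤ C' + 1 := by
    have := Nat.ceil_lt_add_one (div_pos hC'0 hh).le
    rw [← hn] at this
    have h3 : h * n ≤ h * (C' / h + 1) := mul_le_mul_of_nonneg_left this.le hh.le
    rw [mul_add, mul_div_cancel₀ _ hh.ne'] at h3
    linarith
  obtain ⟨V, hV1, hV2, hV3⟩ := card_good_ge (τ := τ) (η := η) (n := n) hφ.continuous hψ hψp
    hy.continuous hyp h01 h23 hh hs0 hsπ hχ hχp hχ0 hχ1 hK hP hPy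
    (fun z w hzw => hys z w (hzw.trans (min_le_left _ _))) hψ1 hψ2 hsm hε'0 hr hrs
    (hloc h n hh hn2)
  have hfin := hcount h hh (hle.trans (min_le_left _ _)) V hV1 hV2
  have hX := integral_density_le (c₀ := c₀) (c₃ := c₃) (m := h * n) hψ hψp hy.continuous hs0 hsπ
    (by positivity) hε'0.le P (fun z hz => by
      obtain ⟨p, hp, m, k, hd⟩ := hnet z hz
      have h3 : 3 / s ^ 2 ≤ ∑ p ∈ P, poleDensity s (z - p) :=
        (le_poleDensity hs0 (by linarith) hd).trans (Finset.single_le_sum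
          (f := fun p => poleDensity s (z - p)) (fun p _ => poleDensity_nonneg hs0 _) hp)
      have h4 : Cl ≤ h * n * ∑ p ∈ P, poleDensity s (z - p) := by
        calc Cl = C' * (3 / s ^ 2) := by rw [hC']; field_simp
          _ ≤ _ := mul_le_mul hn1 h3 (by positivity) (by positivity)
      have h5 := (abs_le.1 (hlap z)).1
      linarith)
  rw [← hIΩ, ← hIm, ← hJ] at hX
  set D := ∫ z in Efd \ {z | c₃ ≤ y z},
    (max (lapC ψ z + h * n * ∑ p ∈ P, poleDensity s (z - p)) 0 + ε') with hD
  have hD0 : 0 ≤ D := integral_nonneg fun z => add_nonneg (le_max_right _ _) hε'0.le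
  have hDX : D ≤ X₀ := by
    have : 2 * π * (h * n) * J ≤ 2 * π * (C' + 1) * J := by gcongr
    linarith [neg_abs_le IΩ, le_abs_self Im]
  have e4 : 4 * π ^ 2 * ε' = ε / 2 := by rw [hε']; field_simp; norm_num
  rw [e4] at hX
  have := trace_arithmetic hJ0 hh hn2 hD0 hDX (Real.exp_pos _) hE (Real.exp_pos (-η / h)).le hV3 hX
    hrem
  refine this.trans (mul_le_mul_of_nonneg_left (Nat.cast_le.2 hfin) (by positivity))

/-- The squared Euclidean norm of the gradient. -/
def gradSq (f : ℂ → ℝ) (z : ℂ) : ℝ := fderiv ℝ f z 1 ^ 2 + fderiv ℝ f z I ^ 2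

lemma gradSq_nonneg (f : ℂ → ℝ) (z : ℂ) : 0 ≤ gradSq f z := by unfold gradSq; positivity

lemma contDiff_gradSq {f : ℂ → ℝ} (hf : ContDiff ℝ (⊤ : ℕ∞) f) :
    ContDiff ℝ (⊤ : ℕ∞) (gradSq f) :=
  ((hf.fderiv_apply_const (by simp) 1).pow 2).add ((hf.fderiv_apply_const (by simp) I).pow 2)

lemma PeriodicC.gradSq {f : ℂ → ℝ} (hf : PeriodicC f) : PeriodicC (gradSq f) :=
  hf.fderiv.comp fun T => T 1 ^ 2 + T I ^ 2

/-- The normalising factor of `normFun`. -/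
def normFactor (ρ : ℂ → ℝ) (z : ℂ) : ℝ := gradSq ρ z + ρ z ^ 2

/-- A defining function of the zero set of `ρ`, normalised so that `y |∇y|² = ρ` to second order. -/
def normFun (ρ : ℂ → ℝ) (z : ℂ) : ℝ := ρ z * normFactor ρ z ^ (-(1 / 3) : ℝ)

lemma gradSq_ne_zero {ρ : ℂ → ℝ} {z : ℂ} (h : fderiv ℝ ρ z ≠ 0) : gradSq ρ z ≠ 0 := by
  contrapose! h
  have h1 : fderiv ℝ ρ z 1 = 0 := by
    unfold gradSq at h; nlinarith [sq_nonneg (fderiv ℝ ρ z 1), sq_nonneg (fderiv ℝ ρ z I)]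
  have h2 : fderiv ℝ ρ z I = 0 := by
    unfold gradSq at h; nlinarith [sq_nonneg (fderiv ℝ ρ z 1), sq_nonneg (fderiv ℝ ρ z I)]
  ext w
  have : w = w.re • (1 : ℂ) + w.im • I := by simp [Complex.re_add_im]
  rw [this, map_add, map_smul, map_smul, h1, h2]
  simp

lemma normFactor_pos {ρ : ℂ → ℝ} (hnd : ∀ z, ρ z = 0 → fderiv ℝ ρ z ≠ 0) (z : ℂ) :
    0 < normFactor ρ z := by
  have h0 := gradSq_nonneg ρ z
  rcases eq_or_ne (ρ z) 0 with h | h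
  · have := (gradSq_ne_zero (hnd z h)).lt_of_le' h0
    unfold normFactor; positivity
  · unfold normFactor; positivity

lemma contDiff_normFactor {ρ : ℂ → ℝ} (hρ : ContDiff ℝ (⊤ : ℕ∞) ρ) :
    ContDiff ℝ (⊤ : ℕ∞) (normFactor ρ) := (contDiff_gradSq hρ).add (hρ.pow 2)

lemma PeriodicC.normFactor {ρ : ℂ → ℝ} (hρ : PeriodicC ρ) : PeriodicC (normFactor ρ) :=
  hρ.gradSq.comp₂ hρ fun a b => a + b ^ 2

lemma contDiff_normFactor_rpow {ρ : ℂ → ℝ} (hρ : ContDiff ℝ (⊤ : ℕ∞) ρ)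
    (hnd : ∀ z, ρ z = 0 → fderiv ℝ ρ z ≠ 0) (p : ℝ) :
    ContDiff ℝ (⊤ : ℕ∞) (fun z => normFactor ρ z ^ p) :=
  (contDiff_normFactor hρ).rpow_const_of_ne fun z => (normFactor_pos hnd z).ne'

lemma contDiff_normFun {ρ : ℂ → ℝ} (hρ : ContDiff ℝ (⊤ : ℕ∞) ρ)
    (hnd : ∀ z, ρ z = 0 → fderiv ℝ ρ z ≠ 0) : ContDiff ℝ (⊤ : ℕ∞) (normFun ρ) :=
  hρ.mul (contDiff_normFactor_rpow hρ hnd _)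

lemma PeriodicC.normFun {ρ : ℂ → ℝ} (hρ : PeriodicC ρ) : PeriodicC (normFun ρ) :=
  hρ.comp₂ hρ.normFactor fun a b => a * b ^ (-(1 / 3) : ℝ)

lemma normFun_mul_rpow {ρ : ℂ → ℝ} (hnd : ∀ z, ρ z = 0 → fderiv ℝ ρ z ≠ 0) (z : ℂ) :
    normFun ρ z * normFactor ρ z ^ (1 / 3 : ℝ) = ρ z := by
  rw [normFun, mul_assoc, ← Real.rpow_add (normFactor_pos hnd z)]
  simp

lemma normFun_pos_iff {ρ : ℂ → ℝ} (hnd : ∀ z, ρ z = 0 → fderiv ℝ ρ z ≠ 0) (z : ℂ) :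
    0 < normFun ρ z ↔ 0 < ρ z := by
  rw [normFun, mul_pos_iff_of_pos_right (Real.rpow_pos_of_pos (normFactor_pos hnd z) _)]

lemma normFun_eq_zero_iff {ρ : ℂ → ℝ} (hnd : ∀ z, ρ z = 0 → fderiv ℝ ρ z ≠ 0) (z : ℂ) :
    normFun ρ z = 0 ↔ ρ z = 0 := by
  rw [normFun, mul_eq_zero_iff_right (Real.rpow_pos_of_pos (normFactor_pos hnd z) _).ne']

lemma exists_abs_le_mul_normFun {ρ : ℂ → ℝ} (hρ : ContDiff ℝ (⊤ : ℕ∞) ρ) (hρp : PeriodicC ρ)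
    (hnd : ∀ z, ρ z = 0 → fderiv ℝ ρ z ≠ 0) : ∃ C > 0, ∀ z, |ρ z| ≤ C * |normFun ρ z| := by
  obtain ⟨C, hC, h⟩ := (hρp.normFactor.comp fun a => a ^ (1 / 3 : ℝ)).bounded
    (contDiff_normFactor_rpow hρ hnd _).continuous
  refine ⟨C, hC, fun z => ?_⟩
  conv_lhs => rw [← normFun_mul_rpow hnd z]
  rw [abs_mul, mul_comm]
  exact mul_le_mul_of_nonneg_right (h z) (abs_nonneg _)

lemma fderiv_normFun {ρ : ℂ → ℝ} (hρ : ContDiff ℝ (⊤ : ℕ∞) ρ)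
    (hnd : ∀ z, ρ z = 0 → fderiv ℝ ρ z ≠ 0) (z v : ℂ) :
    fderiv ℝ (normFun ρ) z v = normFactor ρ z ^ (-(1 / 3) : ℝ) * fderiv ℝ ρ z v +
      ρ z * fderiv ℝ (fun z => normFactor ρ z ^ (-(1 / 3) : ℝ)) z v := by
  have h1 := ((hρ.differentiable (by simp) z).hasFDerivAt.mul
    ((contDiff_normFactor_rpow hρ hnd (-(1 / 3))).differentiable (by simp) z).hasFDerivAt)
  have h2 : HasFDerivAt (normFun ρ) _ z := h1
  rw [h2.fderiv]
  simp only [add_apply, smul_apply, smul_eq_mul]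
  ring

/-- The eikonal-type identity `y |∇y|² = ρ + O(y²)`. -/
lemma exists_abs_sub_normFun_mul_gradSq_le {ρ : ℂ → ℝ} (hρ : ContDiff ℝ (⊤ : ℕ∞) ρ)
    (hρp : PeriodicC ρ) (hnd : ∀ z, ρ z = 0 → fderiv ℝ ρ z ≠ 0) :
    ∃ C > 0, ∀ z, |ρ z - normFun ρ z * gradSq (normFun ρ) z| ≤ C * normFun ρ z ^ 2 := by
  set B : ℂ → ℝ := fun z => normFactor ρ z ^ (-(1 / 3) : ℝ) with hB
  have hBc : ContDiff ℝ (⊤ : ℕ∞) B := contDiff_normFactor_rpow hρ hnd _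
  have hBp : PeriodicC B := hρp.normFactor.comp fun a => a ^ (-(1 / 3) : ℝ)
  set A : ℂ → ℝ := fun z => normFactor ρ z ^ (1 / 3 : ℝ) with hA
  have hAc : ContDiff ℝ (⊤ : ℕ∞) A := contDiff_normFactor_rpow hρ hnd _
  have hAp : PeriodicC A := hρp.normFactor.comp fun a => a ^ (1 / 3 : ℝ)
  set R : ℂ → ℝ := fun z => 2 * B z * (fderiv ℝ ρ z 1 * fderiv ℝ B z 1 +
    fderiv ℝ ρ z I * fderiv ℝ B z I) + ρ z * gradSq B z with hR
  have hdc : ∀ {f : ℂ → ℝ}, ContDiff ℝ (⊤ : ℕ∞) f → ∀ v, Continuous fun z => fderiv ℝ f z v :=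
    fun hf v => (hf.fderiv_apply_const (m := (⊤ : ℕ∞)) (by simp) v).continuous
  have hdp : ∀ {f : ℂ → ℝ}, PeriodicC f → ∀ v, PeriodicC fun z => fderiv ℝ f z v :=
    fun hf v => hf.fderiv.comp fun T => T v
  have hRc : Continuous R := by
    have := hBc.continuous
    have := hρ.continuous
    have := hdc hρ 1
    have := hdc hρ I
    have := hdc hBc 1
    have := hdc hBc I
    have := (contDiff_gradSq hBc).continuous
    fun_prop
  have hRp : PeriodicC R := ((hBp.comp fun b => 2 * b).comp₂
    (((hdp hρp 1).comp₂ (hdp hBp 1) fun a b => a * b).comp₂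
      ((hdp hρp I).comp₂ (hdp hBp I) fun a b => a * b) fun a b => a + b) fun a b => a * b).comp₂
    (hρp.comp₂ hBp.gradSq fun a b => a * b) fun a b => a + b
  have hS : Continuous fun z => A z * (R z - B z ^ 2 * ρ z) := by
    have := hBc.continuous
    have := hAc.continuous
    have := hρ.continuous
    fun_prop
  have hSp : PeriodicC fun z => A z * (R z - B z ^ 2 * ρ z) :=
    hAp.comp₂ (hRp.comp₂ (hBp.comp₂ hρp fun a b => a ^ 2 * b) fun a b => a - b) fun a b => a * b
  obtain ⟨C, hC, h⟩ := hSp.bounded hS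
  refine ⟨C, hC, fun z => ?_⟩
  have e1 : gradSq (normFun ρ) z = B z ^ 2 * gradSq ρ z + ρ z * R z := by
    simp only [gradSq, fderiv_normFun hρ hnd, hR]
    ring
  have hD := normFactor_pos hnd z
  have e2 : B z ^ 2 * normFactor ρ z = A z := by
    simp only [hB, hA]
    rw [← Real.rpow_natCast, ← Real.rpow_mul hD.le]
    conv_lhs => rw [← Real.rpow_one (normFactor ρ z), ← Real.rpow_mul hD.le]
    rw [← Real.rpow_add hD]
    norm_num
  have e3 : gradSq ρ z = normFactor ρ z - ρ z ^ 2 := by rw [normFactor]; ring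
  have e4 := normFun_mul_rpow hnd z
  change normFun ρ z * A z = ρ z at e4
  have e5 : ρ z - normFun ρ z * gradSq (normFun ρ) z =
      -(normFun ρ z ^ 2 * (A z * (R z - B z ^ 2 * ρ z))) := by
    rw [e1, e3, mul_sub, e2]
    linear_combination -e4 + (normFun ρ z * (R z - B z ^ 2 * ρ z)) * e4
  rw [e5, abs_neg, abs_mul, abs_of_nonneg (sq_nonneg (normFun ρ z)), mul_comm]
  exact mul_le_mul_of_nonneg_right (h z) (sq_nonneg _)

/-- The Laplacian of a composition with a function of one real variable. -/
lemma lapC_comp {Θ Θ₁ Θ₂ : ℝ → ℝ} (h1 : ∀ x, HasDerivAt Θ (Θ₁ x) x)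
    (h2 : ∀ x, HasDerivAt Θ₁ (Θ₂ x) x) {y : ℂ → ℝ} (hy : ContDiff ℝ 2 y) (z : ℂ) :
    lapC (fun z => Θ (y z)) z = Θ₂ (y z) * gradSq y z + Θ₁ (y z) * lapC y z := by
  have hd : ∀ w, HasFDerivAt y (fderiv ℝ y w) w := fun w =>
    (hy.differentiable (by norm_num) w).hasFDerivAt
  have e : ∀ v w, fderiv ℝ (fun z => Θ (y z)) w v = Θ₁ (y w) * fderiv ℝ y w v := fun v w => by
    have : HasFDerivAt (fun z => Θ (y z)) _ w := (h1 (y w)).comp_hasFDerivAt w (hd w)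
    rw [this.fderiv]; simp
  have e2 : ∀ v, fderiv ℝ (fun w => Θ₁ (y w) * fderiv ℝ y w v) z v =
      Θ₂ (y z) * fderiv ℝ y z v ^ 2 + Θ₁ (y z) * fderiv ℝ (fun w => fderiv ℝ y w v) z v := fun v => by
    have h3 : HasFDerivAt (fun w => fderiv ℝ y w v) _ z :=
      ((hy.fderiv_apply_const (m := 1) (by norm_num) v).differentiable (by norm_num) z).hasFDerivAt
    have : HasFDerivAt (fun w => Θ₁ (y w) * fderiv ℝ y w v) _ z :=
      ((h2 (y z)).comp_hasFDerivAt z (hd z)).mul h3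
    rw [this.fderiv]
    simp only [add_apply, smul_apply, smul_eq_mul, Function.comp_apply]
    ring
  simp only [lapC, e, e2, gradSq]
  ring

lemma hasDerivAt_posPart_pow (n : ℕ) (x : ℝ) :
    HasDerivAt (fun x : ℝ => max x 0 ^ (n + 2)) ((n + 2) * max x 0 ^ (n + 1)) x := by
  rcases lt_trichotomy x 0 with hx | hx | hx
  · rw [max_eq_right hx.le]
    have : (fun x : ℝ => max x 0 ^ (n + 2)) =ᶠ[nhds x] fun _ => 0 := by
      filter_upwards [Iio_mem_nhds hx] with w hw
      rw [max_eq_right (le_of_lt hw)]; simp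
    simpa using (hasDerivAt_const x (0 : ℝ)).congr_of_eventuallyEq this
  · subst hx
    rw [hasDerivAt_iff_isLittleO]
    simp only [max_self, ne_eq, Nat.add_eq_zero_iff, OfNat.ofNat_ne_zero, and_false,
      not_false_eq_true, zero_pow, sub_zero, one_ne_zero, mul_zero, smul_zero]
    have h1 : (fun x : ℝ => max x 0 ^ (n + 2)) =O[nhds 0] fun x => x ^ (n + 2) := by
      refine Asymptotics.IsBigO.of_bound 1 (Filter.Eventually.of_forall fun w => ?_)
      rw [one_mul, norm_pow, norm_pow, Real.norm_eq_abs, Real.norm_eq_abs]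
      refine pow_le_pow_left₀ (abs_nonneg _) ?_ _
      rw [abs_of_nonneg (le_max_right w 0)]
      exact max_le (le_abs_self _) (abs_nonneg _)
    exact h1.trans_isLittleO (Asymptotics.isLittleO_pow_id (by omega))
  · rw [max_eq_left hx.le]
    have : (fun x : ℝ => max x 0 ^ (n + 2)) =ᶠ[nhds x] fun x => x ^ (n + 2) := by
      filter_upwards [Ioi_mem_nhds hx] with w hw
      rw [max_eq_left (le_of_lt hw)]
    have h := (hasDerivAt_pow (n + 2) x).congr_of_eventuallyEq this
    simpa using h

/-- The combination of truncated powers from which the transition profile is built. -/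
def splineComb (δ : ℝ) (n : ℕ) (x : ℝ) : ℝ :=
  ((1 - δ) * max (1 - x) 0 ^ n - max (1 - δ - x) 0 ^ n + max (-1 + δ - x) 0 ^ n
    - (1 - δ) * max (-1 - x) 0 ^ n) / δ

lemma hasDerivAt_splineComb (δ : ℝ) (n : ℕ) (x : ℝ) :
    HasDerivAt (splineComb δ (n + 2)) (-(n + 2) * splineComb δ (n + 1) x) x := by
  have h : ∀ c : ℝ, HasDerivAt (fun x => max (c - x) 0 ^ (n + 2))
      (-((n + 2) * max (c - x) 0 ^ (n + 1))) x := fun c => by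
    exact ((hasDerivAt_posPart_pow n (c - x)).comp x
      ((hasDerivAt_id x).const_sub c)).congr_deriv (by ring)
  have := (((((h 1).const_mul (1 - δ)).sub (h (1 - δ))).add (h (-1 + δ))).sub
    ((h (-1)).const_mul (1 - δ))).div_const δ
  refine this.congr_deriv ?_
  simp only [splineComb]
  ring

lemma continuous_splineComb (δ : ℝ) (n : ℕ) : Continuous (splineComb δ n) := by
  unfold splineComb; fun_prop

lemma splineComb_of_one_le {δ x : ℝ} (hδ : 0 < δ) (hδ1 : δ < 1) (n : ℕ) (hx : 1 ≤ x) :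
    splineComb δ (n + 1) x = 0 := by
  rw [splineComb, max_eq_right (by linarith), max_eq_right (by linarith),
    max_eq_right (by linarith), max_eq_right (by linarith)]
  simp

lemma splineComb_of_right {δ x : ℝ} (hδ : 0 < δ) (hδ1 : δ < 1) (n : ℕ) (hx : 1 - δ ≤ x)
    (hx1 : x ≤ 1) : splineComb δ (n + 1) x = (1 - δ) * (1 - x) ^ (n + 1) / δ := by
  rw [splineComb, max_eq_left (by linarith), max_eq_right (by linarith),
    max_eq_right (by linarith), max_eq_right (by linarith)]
  simp

lemma splineComb_of_mid {δ x : ℝ} (hδ : 0 < δ) (n : ℕ) (hx : -(1 - δ) ≤ x)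
    (hx1 : x ≤ 1 - δ) : splineComb δ (n + 1) x =
      ((1 - δ) * (1 - x) ^ (n + 1) - (1 - δ - x) ^ (n + 1)) / δ := by
  rw [splineComb, max_eq_left (by linarith), max_eq_left (by linarith),
    max_eq_right (by linarith), max_eq_right (by linarith)]
  simp

lemma splineComb_of_left {δ x : ℝ} (hδ : 0 < δ) (hδ1 : δ < 1) (n : ℕ) (hx : -1 ≤ x)
    (hx1 : x ≤ -(1 - δ)) : splineComb δ (n + 1) x =
      ((1 - δ) * (1 - x) ^ (n + 1) - (1 - δ - x) ^ (n + 1) + (-1 + δ - x) ^ (n + 1)) / δ := by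
  rw [splineComb, max_eq_left (by linarith), max_eq_left (by linarith),
    max_eq_left (by linarith), max_eq_right (by linarith)]
  simp

lemma splineComb_of_le_neg_one {δ x : ℝ} (hδ : 0 < δ) (hδ1 : δ < 1) (n : ℕ) (hx : x ≤ -1) :
    splineComb δ (n + 1) x =
      ((1 - δ) * (1 - x) ^ (n + 1) - (1 - δ - x) ^ (n + 1) + (-1 + δ - x) ^ (n + 1)
        - (1 - δ) * (-1 - x) ^ (n + 1)) / δ := by
  rw [splineComb, max_eq_left (by linarith), max_eq_left (by linarith),
    max_eq_left (by linarith), max_eq_left (by linarith)]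

lemma splineComb_one_mid {δ x : ℝ} (hδ : 0 < δ) (hx : |x| ≤ 1 - δ) :
    splineComb δ 1 x = x := by
  rw [abs_le] at hx
  rw [splineComb_of_mid hδ 0 hx.1 hx.2]
  field_simp
  ring

lemma splineComb_one_outer {δ x : ℝ} (hδ : 0 < δ) (hδ1 : δ < 1) (hx : 1 ≤ |x|) :
    splineComb δ 1 x = 0 := by
  rcases le_abs.1 hx with h | h
  · exact splineComb_of_one_le hδ hδ1 0 h
  · rw [splineComb_of_le_neg_one hδ hδ1 0 (by linarith)]
    field_simp
    ring

lemma splineComb_two_outer {δ x : ℝ} (hδ : 0 < δ) (hδ1 : δ < 1) (hx : 1 ≤ |x|) :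
    splineComb δ 2 x = 0 := by
  rcases le_abs.1 hx with h | h
  · exact splineComb_of_one_le hδ hδ1 1 h
  · rw [splineComb_of_le_neg_one hδ hδ1 1 (by linarith)]
    field_simp
    ring

lemma abs_sub_splineComb_one_le {δ x : ℝ} (hδ : 0 < δ) (hδ1 : δ < 1) (hx : |x| ≤ 1) :
    |x - splineComb δ 1 x| ≤ 1 := by
  rw [abs_le] at hx
  rcases le_total x (-(1 - δ)) with h | h
  · rw [splineComb_of_left hδ hδ1 0 hx.1 h]
    have e : ((1 - δ) * (1 - x) ^ (0 + 1) - (1 - δ - x) ^ (0 + 1) + (-1 + δ - x) ^ (0 + 1)) / δ =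
      -((1 - δ) * ((1 + x) / δ)) := by field_simp; ring
    rw [e]
    have h1 : 0 ≤ (1 + x) / δ := div_nonneg (by linarith) hδ.le
    have h2 : (1 + x) / δ ≤ 1 := by rw [div_le_one hδ]; linarith
    rw [abs_le]; constructor <;> nlinarith
  rcases le_total x (1 - δ) with h' | h'
  · rw [splineComb_one_mid hδ (abs_le.2 ⟨h, h'⟩)]; simp
  · rw [splineComb_of_right hδ hδ1 0 h' hx.2]
    have e : (1 - δ) * (1 - x) ^ (0 + 1) / δ = (1 - δ) * ((1 - x) / δ) := by ring
    rw [e]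
    have h1 : 0 ≤ (1 - x) / δ := div_nonneg (by linarith) hδ.le
    have h2 : (1 - x) / δ ≤ 1 := by rw [div_le_one hδ]; linarith
    rw [abs_le]; constructor <;> nlinarith

lemma splineComb_two_mem {δ : ℝ} (hδ : 0 < δ) (hδ1 : δ < 1) (x : ℝ) :
    0 ≤ splineComb δ 2 x ∧ splineComb δ 2 x ≤ 1 := by
  rcases le_total 1 |x| with hx | hx
  · rw [splineComb_two_outer hδ hδ1 hx]; norm_num
  rw [abs_le] at hx
  rcases le_total x (-(1 - δ)) with h | h
  · rw [splineComb_of_left hδ hδ1 1 hx.1 h]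
    have e : ((1 - δ) * (1 - x) ^ (1 + 1) - (1 - δ - x) ^ (1 + 1) + (-1 + δ - x) ^ (1 + 1)) / δ =
      (1 - δ) * (1 + x) * ((1 + x) / δ) := by field_simp; ring
    rw [e]
    have h1 : 0 ≤ (1 + x) / δ := div_nonneg (by linarith) hδ.le
    have h2 : (1 + x) / δ ≤ 1 := by rw [div_le_one hδ]; linarith
    have h3 : 0 ≤ (1 - δ) * (1 + x) := mul_nonneg (by linarith) (by linarith)
    exact ⟨mul_nonneg h3 h1, mul_le_one₀ (by nlinarith) h1 h2⟩
  rcases le_total x (1 - δ) with h' | h'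
  · rw [splineComb_of_mid hδ 1 h h']
    have e : ((1 - δ) * (1 - x) ^ (1 + 1) - (1 - δ - x) ^ (1 + 1)) / δ = 1 - δ - x ^ 2 := by
      field_simp; ring
    rw [e]; constructor <;> nlinarith
  · rw [splineComb_of_right hδ hδ1 1 h' hx.2]
    have e : (1 - δ) * (1 - x) ^ (1 + 1) / δ = (1 - δ) * (1 - x) * ((1 - x) / δ) := by ring
    rw [e]
    have h1 : 0 ≤ (1 - x) / δ := div_nonneg (by linarith) hδ.le
    have h2 : (1 - x) / δ ≤ 1 := by rw [div_le_one hδ]; linarith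
    have h3 : 0 ≤ (1 - δ) * (1 - x) := mul_nonneg (by linarith) (by linarith)
    exact ⟨mul_nonneg h3 h1, mul_le_one₀ (by nlinarith) h1 h2⟩

/-- The transition profile: it vanishes on `[1, ∞)` and is constant on `(-∞, -1]`. -/
def profile (δ x : ℝ) : ℝ := splineComb δ 3 x / 4

/-- The value of the transition profile on `(-∞, -1]`. -/
def profileMax (δ : ℝ) : ℝ := (1 - δ) * (2 - δ) / 2

lemma hasDerivAt_profile (δ x : ℝ) : HasDerivAt (profile δ) (-(3 / 4) * splineComb δ 2 x) x := by
  refine ((hasDerivAt_splineComb δ 1 x).div_const 4).congr_deriv ?_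
  norm_num; ring

lemma hasDerivAt_profile_deriv (δ x : ℝ) :
    HasDerivAt (fun x => -(3 / 4) * splineComb δ 2 x) (3 / 2 * splineComb δ 1 x) x := by
  refine ((hasDerivAt_splineComb δ 0 x).const_mul (-(3 / 4))).congr_deriv ?_
  norm_num; ring

lemma profile_of_one_le {δ x : ℝ} (hδ : 0 < δ) (hδ1 : δ < 1) (hx : 1 ≤ x) : profile δ x = 0 := by
  rw [profile, splineComb_of_one_le hδ hδ1 2 hx, zero_div]

lemma profile_of_le_neg_one {δ x : ℝ} (hδ : 0 < δ) (hδ1 : δ < 1) (hx : x ≤ -1) :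
    profile δ x = profileMax δ := by
  rw [profile, splineComb_of_le_neg_one hδ hδ1 2 hx, profileMax]
  field_simp
  ring

lemma antitone_profile {δ : ℝ} (hδ : 0 < δ) (hδ1 : δ < 1) : Antitone (profile δ) :=
  antitone_of_hasDerivAt_nonpos (hasDerivAt_profile δ) fun x => by
    have := (splineComb_two_mem hδ hδ1 x).1
    show -(3 / 4) * splineComb δ 2 x ≤ 0
    linarith

lemma profile_nonneg {δ : ℝ} (hδ : 0 < δ) (hδ1 : δ < 1) (x : ℝ) : 0 ≤ profile δ x := by
  rw [← profile_of_one_le hδ hδ1 (le_max_right x 1)]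
  exact antitone_profile hδ hδ1 (le_max_left _ _)

lemma profile_le {δ : ℝ} (hδ : 0 < δ) (hδ1 : δ < 1) (x : ℝ) : profile δ x ≤ profileMax δ := by
  rw [← profile_of_le_neg_one hδ hδ1 (min_le_right x (-1))]
  exact antitone_profile hδ hδ1 (min_le_left _ _)

lemma contDiff_two_of_hasDerivAt {f f₁ f₂ : ℝ → ℝ} (h1 : ∀ x, HasDerivAt f (f₁ x) x)
    (h2 : ∀ x, HasDerivAt f₁ (f₂ x) x) (hc : Continuous f₂) : ContDiff ℝ 2 f := by
  have e1 : deriv f = f₁ := funext fun x => (h1 x).deriv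
  have e2 : deriv f₁ = f₂ := funext fun x => (h2 x).deriv
  rw [show (2 : WithTop ℕ∞) = 1 + 1 by norm_num, contDiff_succ_iff_deriv, e1, contDiff_one_iff_deriv, e2]
  exact ⟨fun x => (h1 x).differentiableAt, by simp, fun x => (h2 x).differentiableAt, hc⟩

lemma contDiff_profile (δ : ℝ) : ContDiff ℝ 2 (profile δ) :=
  contDiff_two_of_hasDerivAt (hasDerivAt_profile δ) (hasDerivAt_profile_deriv δ)
    (continuous_const.mul (continuous_splineComb δ 1))

/-- The weight `φ` lowered by `(2/3) T³` times the transition profile in the variable `y / T`. -/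
def loweredWeight (φ y : ℂ → ℝ) (T δ : ℝ) (z : ℂ) : ℝ :=
  φ z - 2 / 3 * T ^ 3 * profile δ (y z / T)

lemma contDiff_loweredWeight {φ y : ℂ → ℝ} (hφ : ContDiff ℝ 2 φ) (hy : ContDiff ℝ 2 y) (T δ : ℝ) :
    ContDiff ℝ 2 (loweredWeight φ y T δ) :=
  hφ.sub (contDiff_const.mul ((contDiff_profile δ).comp (hy.div_const T)))

lemma PeriodicC.loweredWeight {φ y : ℂ → ℝ} (hφ : PeriodicC φ) (hy : PeriodicC y) (T δ : ℝ) :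
    PeriodicC (loweredWeight φ y T δ) :=
  hφ.comp₂ hy fun a b => a - 2 / 3 * T ^ 3 * profile δ (b / T)

lemma lapC_sub {f g : ℂ → ℝ} (hf : ContDiff ℝ 2 f) (hg : ContDiff ℝ 2 g) (z : ℂ) :
    lapC (fun z => f z - g z) z = lapC f z - lapC g z := by
  have e : ∀ v w, fderiv ℝ (fun z => f z - g z) w v = fderiv ℝ f w v - fderiv ℝ g w v :=
    fun v w => by
      rw [fderiv_fun_sub (hf.differentiable (by norm_num) w) (hg.differentiable (by norm_num) w)]
      simp
  have e2 : ∀ v, fderiv ℝ (fun w => fderiv ℝ f w v - fderiv ℝ g w v) z v =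
      fderiv ℝ (fun w => fderiv ℝ f w v) z v - fderiv ℝ (fun w => fderiv ℝ g w v) z v :=
    fun v => by
      rw [fderiv_fun_sub
        ((hf.fderiv_apply_const (m := 1) (by norm_num) v).differentiable (by norm_num) z)
        ((hg.fderiv_apply_const (m := 1) (by norm_num) v).differentiable (by norm_num) z)]
      simp
  simp only [lapC, e, e2]
  ring

lemma lapC_loweredWeight {φ y : ℂ → ℝ} (hφ : ContDiff ℝ 2 φ) (hy : ContDiff ℝ 2 y) {T : ℝ}
    (hT : 0 < T) (δ : ℝ) (z : ℂ) :
    lapC (loweredWeight φ y T δ) z = lapC φ z - T * splineComb δ 1 (y z / T) * gradSq y z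
      + 1 / 2 * T ^ 2 * splineComb δ 2 (y z / T) * lapC y z := by
  have h0 : ∀ x, HasDerivAt (fun x : ℝ => x / T) (1 / T) x := fun x => (hasDerivAt_id x).div_const T
  have h1 : ∀ x, HasDerivAt (fun x => 2 / 3 * T ^ 3 * profile δ (x / T))
      (-(1 / 2 * T ^ 2 * splineComb δ 2 (x / T))) x := fun x => by
    refine (((hasDerivAt_profile δ (x / T)).comp x (h0 x)).const_mul _).congr_deriv ?_
    field_simp
    ring
  have h2 : ∀ x, HasDerivAt (fun x => -(1 / 2 * T ^ 2 * splineComb δ 2 (x / T)))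
      (T * splineComb δ 1 (x / T)) x := fun x => by
    refine ((((hasDerivAt_splineComb δ 0 (x / T)).comp x (h0 x)).const_mul _).neg).congr_deriv ?_
    field_simp
    norm_num
  have hc : ContDiff ℝ 2 fun z => 2 / 3 * T ^ 3 * profile δ (y z / T) :=
    contDiff_const.mul ((contDiff_profile δ).comp (hy.div_const T))
  have := lapC_sub hφ hc z
  change lapC (loweredWeight φ y T δ) z = _ at this
  rw [this, lapC_comp h1 h2 hy]
  ring

lemma loweredWeight_le {φ y : ℂ → ℝ} {T δ : ℝ} (hT : 0 < T) (hδ : 0 < δ) (hδ1 : δ < 1) (z : ℂ) :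
    loweredWeight φ y T δ z ≤ φ z := by
  have := profile_nonneg hδ hδ1 (y z / T)
  rw [loweredWeight]
  have : 0 ≤ 2 / 3 * T ^ 3 * profile δ (y z / T) := by positivity
  linarith

lemma le_loweredWeight {φ y : ℂ → ℝ} {T δ : ℝ} (hT : 0 < T) (hδ : 0 < δ) (hδ1 : δ < 1) (z : ℂ) :
    φ z - 2 / 3 * T ^ 3 * profileMax δ ≤ loweredWeight φ y T δ z := by
  have := profile_le hδ hδ1 (y z / T)
  rw [loweredWeight]
  gcongr

lemma loweredWeight_of_le {φ y : ℂ → ℝ} {T δ : ℝ} (hT : 0 < T) (hδ : 0 < δ) (hδ1 : δ < 1) {z : ℂ}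
    (hz : T ≤ y z) : loweredWeight φ y T δ z = φ z := by
  rw [loweredWeight, profile_of_one_le hδ hδ1 ((one_le_div hT).2 hz)]
  ring

lemma loweredWeight_of_le_neg {φ y : ℂ → ℝ} {T δ : ℝ} (hT : 0 < T) (hδ : 0 < δ) (hδ1 : δ < 1)
    {z : ℂ} (hz : y z ≤ -T) :
    loweredWeight φ y T δ z = φ z - 2 / 3 * T ^ 3 * profileMax δ := by
  rw [loweredWeight, profile_of_le_neg_one hδ hδ1 ((div_le_iff₀ hT).2 (by linarith))]

lemma lapC_loweredWeight_outer {φ y : ℂ → ℝ} (hφ : ContDiff ℝ 2 φ) (hy : ContDiff ℝ 2 y)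
    {T δ : ℝ} (hT : 0 < T) (hδ : 0 < δ) (hδ1 : δ < 1) {z : ℂ} (hz : T ≤ |y z|) :
    lapC (loweredWeight φ y T δ) z = lapC φ z := by
  have h : 1 ≤ |y z / T| := by rw [abs_div, abs_of_pos hT]; exact (one_le_div hT).2 hz
  rw [lapC_loweredWeight hφ hy hT, splineComb_one_outer hδ hδ1 h, splineComb_two_outer hδ hδ1 h]
  ring

lemma exists_abs_lapC_loweredWeight_le {φ : ℂ → ℝ} (hφ : ContDiff ℝ (⊤ : ℕ∞) φ)
    (hφp : PeriodicC φ) (hnd : ∀ z, lapC φ z = 0 → fderiv ℝ (lapC φ) z ≠ 0) :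
    ∃ C > 0, ∀ T δ, 0 < T → T ≤ 1 → 0 < δ → δ < 1 → ∀ z, |normFun (lapC φ) z| ≤ T →
      |lapC (loweredWeight φ (normFun (lapC φ)) T δ) z| ≤ C * T ∧
      (|normFun (lapC φ) z| ≤ (1 - δ) * T →
        |lapC (loweredWeight φ (normFun (lapC φ)) T δ) z| ≤ C * T ^ 2) := by
  have hρ : ContDiff ℝ (⊤ : ℕ∞) (lapC φ) := hφ.lapC (le_of_eq rfl)
  have hρp : PeriodicC (lapC φ) := hφp.lapC
  set y := normFun (lapC φ) with hydef
  have hy : ContDiff ℝ (⊤ : ℕ∞) y := contDiff_normFun hρ hnd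
  have hyp : PeriodicC y := hρp.normFun
  obtain ⟨C₁, hC₁, h1⟩ := exists_abs_sub_normFun_mul_gradSq_le hρ hρp hnd
  obtain ⟨C₂, hC₂, h2⟩ := hyp.gradSq.bounded (contDiff_gradSq hy).continuous
  obtain ⟨C₃, hC₃, h3⟩ := hyp.lapC.bounded (ContDiff.lapC (m := 0) (n := 2) (hy.of_le (by norm_cast)) (by norm_num)).continuous
  refine ⟨C₁ + C₂ + C₃, by positivity, fun T δ hT hT1 hδ hδ1 z hz => ?_⟩
  have e := lapC_loweredWeight (hφ.of_le (by norm_cast)) (y := y) (hy.of_le (by norm_cast)) hT δ z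
  have hzT : |y z / T| ≤ 1 := by rw [abs_div, abs_of_pos hT]; exact (div_le_one hT).2 hz
  have e2 : lapC (loweredWeight φ y T δ) z = (lapC φ z - y z * gradSq y z)
      + T * (y z / T - splineComb δ 1 (y z / T)) * gradSq y z
      + 1 / 2 * T ^ 2 * splineComb δ 2 (y z / T) * lapC y z := by
    rw [e]; field_simp; ring
  have hs := splineComb_two_mem hδ hδ1 (y z / T)
  have b1 : |lapC φ z - y z * gradSq y z| ≤ C₁ * T ^ 2 := (h1 z).trans (by
    have := sq_le_sq' (by linarith [(abs_le.1 hz).1]) (abs_le.1 hz).2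
    gcongr)
  have b3 : |1 / 2 * T ^ 2 * splineComb δ 2 (y z / T) * lapC y z| ≤ C₃ * T ^ 2 := by
    rw [abs_mul, abs_of_nonneg (by have := hs.1; positivity : 0 ≤ 1 / 2 * T ^ 2 * splineComb δ 2 (y z / T))]
    have h4 : |lapC y z| ≤ C₃ := h3 z
    calc _ ≤ 1 / 2 * T ^ 2 * 1 * C₃ := by gcongr; exact hs.2
      _ ≤ C₃ * T ^ 2 := by nlinarith [mul_pos hC₃ (pow_pos hT 2)]
  have hTT : T ^ 2 ≤ T := by nlinarith
  constructor
  · have b2 : |T * (y z / T - splineComb δ 1 (y z / T)) * gradSq y z| ≤ C₂ * T := by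
      have h4 : |gradSq y z| ≤ C₂ := h2 z
      rw [abs_mul, abs_mul, abs_of_pos hT]
      calc _ ≤ T * 1 * C₂ := by
            gcongr
            exact abs_sub_splineComb_one_le hδ hδ1 hzT
        _ = C₂ * T := by ring
    rw [e2]
    refine (abs_add_three _ _ _).trans ?_
    nlinarith
  · intro hz'
    have : |y z / T| ≤ 1 - δ := by rw [abs_div, abs_of_pos hT]; exact (div_le_iff₀ hT).2 hz'
    rw [e2, splineComb_one_mid hδ this, sub_self, mul_zero, zero_mul, add_zero]
    refine (abs_add_le _ _).trans ?_
    nlinarith [mul_pos hC₂ (pow_pos hT 2)]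

/-- The zero set of a smooth periodic nondegenerate function, modulo the lattice, parametrised by
arclength with unit normal `ν` in the direction of increase. -/
structure IsZeroCurve (ρ : ℂ → ℝ) (L : ℝ) (g ν : ℝ → ℂ) : Prop where
  contDiff : ContDiff ℝ (⊤ : ℕ∞) ρ
  periodic : PeriodicC ρ
  nondegenerate : ∀ z, ρ z = 0 → fderiv ℝ ρ z ≠ 0
  length_pos : 0 < L
  contDiff_curve : ContDiff ℝ (⊤ : ℕ∞) g
  periodic_curve : Function.Periodic g L
  injOn_curve : Set.InjOn g (Set.Ico 0 L)
  speed : ∀ t, ‖deriv g t‖ = 1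
  zero : ∀ t, ρ (g t) = 0
  exhaust : ∀ z, ρ z = 0 → ∃ t, z - g t ∈ latGroup
  normal : (∀ t, ν t = I * deriv g t) ∨ ∀ t, ν t = -(I * deriv g t)
  pos : ∀ t, 0 < fderiv ℝ ρ (g t) (ν t)

/-- The real linear map of `ℂ` sending `1` to `a` and `I` to `b`. -/
def planeMap (a b : ℂ) : ℂ →L[ℝ] ℂ := reCLM.smulRight a + imCLM.smulRight b

lemma planeMap_apply (a b v : ℂ) : planeMap a b v = v.re • a + v.im • b := rfl

lemma det_planeMap (a b : ℂ) : (planeMap a b).det = a.re * b.im - a.im * b.re := by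
  rw [ContinuousLinearMap.det, ← LinearMap.det_toMatrix Complex.basisOneI, Matrix.det_fin_two]
  simp [LinearMap.toMatrix_apply, planeMap_apply]
  ring

/-- Normal coordinates along the curve `g`. -/
def tube (g ν : ℝ → ℂ) (w : ℂ) : ℂ := g w.re + w.im • ν w.re

lemma tube_ofReal (g ν : ℝ → ℂ) (t : ℝ) : tube g ν t = g t := by simp [tube]

namespace IsZeroCurve

variable {ρ : ℂ → ℝ} {L : ℝ} {g ν : ℝ → ℂ}

lemma contDiff_normal (h : IsZeroCurve ρ L g ν) : ContDiff ℝ (⊤ : ℕ∞) ν := by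
  have hd : ContDiff ℝ (⊤ : ℕ∞) (deriv g) := by
    have := h.contDiff_curve
    exact (contDiff_infty_iff_deriv.1 this).2
  rcases h.normal with e | e
  · rw [show ν = fun t => I * deriv g t from funext e]
    exact contDiff_const.mul hd
  · rw [show ν = fun t => -(I * deriv g t) from funext e]
    exact (contDiff_const.mul hd).neg

lemma norm_normal (h : IsZeroCurve ρ L g ν) (t : ℝ) : ‖ν t‖ = 1 := by
  rcases h.normal with e | e <;> simp [e, h.speed]

lemma periodic_deriv (h : IsZeroCurve ρ L g ν) : Function.Periodic (deriv g) L := fun t => by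
  rw [← deriv_comp_add_const]
  congr 1
  exact funext h.periodic_curve

lemma periodic_normal (h : IsZeroCurve ρ L g ν) : Function.Periodic ν L := fun t => by
  rcases h.normal with e | e <;> simp [e, h.periodic_deriv t]

lemma exists_bound {α : Type*} [NormedAddCommGroup α] {f : ℝ → α} (h : IsZeroCurve ρ L g ν)
    (hf : Function.Periodic f L) (hc : Continuous f) : ∃ C > 0, ∀ t, ‖f t‖ ≤ C := by
  obtain ⟨C, hC⟩ := isCompact_Icc.exists_bound_of_continuousOn (hc.continuousOn (s := Set.Icc 0 L))
  refine ⟨max C 1, by positivity, fun t => ?_⟩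
  obtain ⟨s, hs, e⟩ := hf.exists_mem_Ico₀ h.length_pos t
  rw [e]
  exact (hC s (Set.Ico_subset_Icc_self hs)).trans (le_max_left _ _)

lemma hasStrictFDerivAt_tube (h : IsZeroCurve ρ L g ν) (w : ℂ) :
    HasStrictFDerivAt (tube g ν)
      (planeMap (deriv g w.re + w.im • deriv ν w.re) (ν w.re)) w := by
  have hre : HasStrictFDerivAt (fun w : ℂ => w.re) reCLM w := reCLM.hasStrictFDerivAt
  have him : HasStrictFDerivAt (fun w : ℂ => w.im) imCLM w := imCLM.hasStrictFDerivAt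
  have hg : HasStrictDerivAt g (deriv g w.re) w.re :=
    h.contDiff_curve.contDiffAt.hasStrictDerivAt (by simp)
  have hν : HasStrictDerivAt ν (deriv ν w.re) w.re :=
    h.contDiff_normal.contDiffAt.hasStrictDerivAt (by simp)
  have := (hg.hasStrictFDerivAt.comp w hre).add (him.smul (hν.hasStrictFDerivAt.comp w hre))
  refine this.congr_fderiv ?_
  ext v
  simp [planeMap_apply]
  ring

lemma continuous_tube (h : IsZeroCurve ρ L g ν) : Continuous (tube g ν) :=
  continuous_iff_continuousAt.2 fun w => (h.hasStrictFDerivAt_tube w).continuousAt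

lemma tube_add (h : IsZeroCurve ρ L g ν) (w : ℂ) (j : ℤ) :
    tube g ν (w + ((j * L : ℝ) : ℂ)) = tube g ν w := by
  simp only [tube, add_re, ofReal_re, add_im, ofReal_im, add_zero]
  rw [h.periodic_curve.int_mul j w.re, h.periodic_normal.int_mul j w.re]

lemma cross_normal (h : IsZeroCurve ρ L g ν) (t : ℝ) :
    |(deriv g t).re * (ν t).im - (deriv g t).im * (ν t).re| = 1 := by
  have h1 : (deriv g t).re ^ 2 + (deriv g t).im ^ 2 = 1 := by
    have := h.speed t
    rw [← sq_eq_sq₀ (norm_nonneg _) zero_le_one, ← Complex.normSq_eq_norm_sq, normSq_apply] at this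
    linarith
  rcases h.normal with e | e
  · rw [e]; simp only [mul_re, mul_im, I_re, I_im]
    rw [show (deriv g t).re * (0 * (deriv g t).im + 1 * (deriv g t).re) - (deriv g t).im *
      (0 * (deriv g t).re - 1 * (deriv g t).im) = 1 by linarith]
    simp
  · rw [e]; simp only [neg_re, neg_im, mul_re, mul_im, I_re, I_im]
    rw [show (deriv g t).re * -(0 * (deriv g t).im + 1 * (deriv g t).re) - (deriv g t).im *
      -(0 * (deriv g t).re - 1 * (deriv g t).im) = -1 by linarith]
    simp

/-- The Jacobian determinant of normal coordinates. -/
def _root_.tubeJac (g ν : ℝ → ℂ) (w : ℂ) : ℝ :=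
  (planeMap (deriv g w.re + w.im • deriv ν w.re) (ν w.re)).det

lemma continuous_tubeJac (h : IsZeroCurve ρ L g ν) : Continuous (tubeJac g ν) := by
  have h1 : Continuous (deriv g) := h.contDiff_curve.continuous_deriv (by simp)
  have h2 : Continuous (deriv ν) := h.contDiff_normal.continuous_deriv (by simp)
  have h3 : Continuous ν := h.contDiff_normal.continuous
  have e : tubeJac g ν = fun w => (deriv g w.re + w.im • deriv ν w.re).re * (ν w.re).im -
      (deriv g w.re + w.im • deriv ν w.re).im * (ν w.re).re := funext fun w => det_planeMap _ _
  rw [e]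
  fun_prop

lemma exists_tubeJac_bound (h : IsZeroCurve ρ L g ν) :
    ∃ C > 0, ∀ w, |(|tubeJac g ν w|) - 1| ≤ C * |w.im| := by
  have hper : Function.Periodic (fun t => (deriv ν t).re * (ν t).im - (deriv ν t).im * (ν t).re) L :=
    fun t => by
      have : deriv ν (t + L) = deriv ν t := by
        rw [← deriv_comp_add_const]
        congr 1
        exact funext h.periodic_normal
      simp [this, h.periodic_normal t]
  have h2 : Continuous (deriv ν) := h.contDiff_normal.continuous_deriv (by simp)
  have h3 : Continuous ν := h.contDiff_normal.continuous
  obtain ⟨C, hC, hb⟩ := h.exists_bound hper (by fun_prop)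
  refine ⟨C, hC, fun w => ?_⟩
  have e : tubeJac g ν w = ((deriv g w.re).re * (ν w.re).im - (deriv g w.re).im * (ν w.re).re) +
      ((deriv ν w.re).re * (ν w.re).im - (deriv ν w.re).im * (ν w.re).re) * w.im := by
    rw [tubeJac, det_planeMap]; simp; ring
  have h4 := abs_abs_sub_abs_le (tubeJac g ν w)
    ((deriv g w.re).re * (ν w.re).im - (deriv g w.re).im * (ν w.re).re)
  rw [h.cross_normal] at h4
  refine h4.trans ?_
  rw [e, add_sub_cancel_left, abs_mul]
  exact mul_le_mul_of_nonneg_right (hb _) (abs_nonneg _)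

lemma tubeJac_ofReal_ne_zero (h : IsZeroCurve ρ L g ν) (t : ℝ) : tubeJac g ν t ≠ 0 := by
  have := h.cross_normal t
  rw [tubeJac, det_planeMap]
  intro h0
  simp at h0
  rw [h0] at this
  simp at this

lemma hasStrictFDerivAt_tube_equiv (h : IsZeroCurve ρ L g ν) (t : ℝ) :
    ∃ A : ℂ ≃L[ℝ] ℂ, HasStrictFDerivAt (tube g ν) (A : ℂ →L[ℝ] ℂ) (t : ℂ) :=
  ⟨ContinuousLinearMap.toContinuousLinearEquivOfDetNeZero _ (h.tubeJac_ofReal_ne_zero t), by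
    simpa using h.hasStrictFDerivAt_tube t⟩

lemma map_nhds_tube (h : IsZeroCurve ρ L g ν) (t : ℝ) :
    Filter.map (tube g ν) (nhds (t : ℂ)) = nhds (g t) := by
  obtain ⟨A, hA⟩ := h.hasStrictFDerivAt_tube_equiv t
  rw [hA.map_nhds_eq_of_equiv, tube_ofReal]

lemma exists_injOn_tube (h : IsZeroCurve ρ L g ν) (t : ℝ) :
    ∃ U ∈ nhds (t : ℂ), Set.InjOn (tube g ν) U := by
  obtain ⟨A, hA⟩ := h.hasStrictFDerivAt_tube_equiv t
  exact ⟨_, hA.toOpenPartialHomeomorph.open_source.mem_nhds hA.mem_toOpenPartialHomeomorph_source,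
    hA.toOpenPartialHomeomorph.injOn⟩

end IsZeroCurve

lemma exists_lipschitz_fderiv_of_periodic {f : ℂ → ℝ} (hfp : PeriodicC f)
    (hf : ContDiff ℝ 2 f) :
    ∃ C > 0, ∀ z w, ‖fderiv ℝ f z - fderiv ℝ f w‖ ≤ C * ‖z - w‖ := by
  have h1 : ContDiff ℝ 1 (fderiv ℝ f) := hf.fderiv_right (by norm_num)
  have h2 : Continuous (fderiv ℝ (fderiv ℝ f)) := h1.continuous_fderiv (by norm_num)
  obtain ⟨C, hC, hb⟩ := hfp.fderiv.fderiv.bounded h2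
  refine ⟨C, hC, fun z w => ?_⟩
  exact convex_univ.norm_image_sub_le_of_norm_fderiv_le (𝕜 := ℝ)
    (fun x _ => h1.differentiable (by norm_num) x) (fun x _ => hb x) (Set.mem_univ w)
    (Set.mem_univ z)

/-- Second order Taylor estimate with a uniform constant. -/
lemma exists_taylor_of_periodic {f : ℂ → ℝ} (hfp : PeriodicC f) (hf : ContDiff ℝ 2 f) :
    ∃ C > 0, (∀ z w, |f (z + w) - f z - fderiv ℝ f z w| ≤ C * ‖w‖ ^ 2) ∧
      ∀ z w, ‖fderiv ℝ f z - fderiv ℝ f w‖ ≤ C * ‖z - w‖ := by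
  obtain ⟨C, hC, hl⟩ := exists_lipschitz_fderiv_of_periodic hfp hf
  refine ⟨C, hC, fun z w => ?_, hl⟩
  have := (convex_closedBall z ‖w‖).norm_image_sub_le_of_norm_hasFDerivWithin_le'
    (f := f) (f' := fderiv ℝ f) (φ := fderiv ℝ f z) (C := C * ‖w‖) (x := z) (y := z + w)
    (fun x _ => (hf.differentiable (by norm_num) x).hasFDerivAt.hasFDerivWithinAt)
    (fun x hx => (hl x z).trans (by
      gcongr
      simpa [dist_eq_norm] using hx)) (by simp) (by simp)
  simp only [add_sub_cancel_left, Real.norm_eq_abs] at this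
  linarith [this, sq ‖w‖, mul_assoc C ‖w‖ ‖w‖]

namespace IsZeroCurve

variable {ρ : ℂ → ℝ} {L : ℝ} {g ν : ℝ → ℂ}

lemma exists_slice_taylor (h : IsZeroCurve ρ L g ν) {f : ℂ → ℝ} (hfp : PeriodicC f)
    (hf : ContDiff ℝ 2 f) (hf0 : ∀ t, f (g t) = 0) :
    ∃ C > 0, ∀ w, |f (tube g ν w) - fderiv ℝ f (g w.re) (ν w.re) * w.im| ≤ C * w.im ^ 2 := by
  obtain ⟨C, hC, h1, -⟩ := exists_taylor_of_periodic hfp hf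
  refine ⟨C, hC, fun w => ?_⟩
  have := h1 (g w.re) (w.im • ν w.re)
  rw [hf0, map_smul, norm_smul, h.norm_normal] at this
  simpa [tube, mul_comm] using this

/-- A function that increases across the curve increases along the normals near it. -/
lemma exists_slice_mono (h : IsZeroCurve ρ L g ν) {f : ℂ → ℝ} (hfp : PeriodicC f)
    (hf : ContDiff ℝ 2 f) {c : ℝ} (hc : 0 < c) (hfc : ∀ t, c ≤ fderiv ℝ f (g t) (ν t)) :
    ∃ s₁ > 0, ∀ t s s' : ℝ, |s| ≤ s₁ → |s'| ≤ s₁ → s' ≤ s →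
      c / 2 * (s - s') ≤ f (g t + s • ν t) - f (g t + s' • ν t) := by
  obtain ⟨C, hC, h1, h2⟩ := exists_taylor_of_periodic hfp hf
  refine ⟨c / (6 * C), by positivity, fun t s s' hs hs' hss => ?_⟩
  have hC6 : C * (c / (6 * C)) = c / 6 := by field_simp
  have a1 := h1 (g t + s' • ν t) ((s - s') • ν t)
  rw [map_smul, norm_smul, h.norm_normal, mul_one, Real.norm_eq_abs, sq_abs, smul_eq_mul] at a1
  have e : g t + s' • ν t + (s - s') • ν t = g t + s • ν t := by rw [sub_smul]; abel
  rw [e] at a1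
  have a2 : |fderiv ℝ f (g t + s' • ν t) (ν t) - fderiv ℝ f (g t) (ν t)| ≤ c / 6 := by
    have := (fderiv ℝ f (g t + s' • ν t) - fderiv ℝ f (g t)).le_opNorm (ν t)
    rw [h.norm_normal, mul_one] at this
    have h3 := h2 (g t + s' • ν t) (g t)
    rw [add_sub_cancel_left, norm_smul, h.norm_normal, mul_one, Real.norm_eq_abs] at h3
    calc _ ≤ _ := this
      _ ≤ C * |s'| := h3
      _ ≤ c / 6 := by rw [← hC6]; gcongr
  have a3 : C * (s - s') ^ 2 ≤ c / 3 * (s - s') := by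
    have : s - s' ≤ 2 * (c / (6 * C)) := by
      linarith [(abs_le.1 hs).2, (abs_le.1 hs').1]
    calc C * (s - s') ^ 2 = C * (s - s') * (s - s') := by ring
      _ ≤ C * (2 * (c / (6 * C))) * (s - s') := by gcongr
      _ = c / 3 * (s - s') := by rw [show C * (2 * (c / (6 * C))) = 2 * (C * (c / (6 * C))) by ring, hC6]; ring
  have a4 := (abs_le.1 a1).1
  have a5 := (abs_le.1 a2).1
  have a6 := hfc t
  nlinarith

lemma exists_normal_deriv_ge (h : IsZeroCurve ρ L g ν) : ∃ c > 0, ∀ t, c ≤ fderiv ℝ ρ (g t) (ν t) := by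
  have hc : Continuous fun t => fderiv ℝ ρ (g t) (ν t) :=
    ((h.contDiff.continuous_fderiv (by simp)).comp h.contDiff_curve.continuous).clm_apply
      h.contDiff_normal.continuous
  obtain ⟨t₀, -, ht₀⟩ := isCompact_Icc.exists_isMinOn ⟨0, Set.left_mem_Icc.2 h.length_pos.le⟩
    (hc.continuousOn (s := Set.Icc 0 L))
  refine ⟨_, h.pos t₀, fun t => ?_⟩
  have hp : Function.Periodic (fun t => fderiv ℝ ρ (g t) (ν t)) L := fun t => by
    simp only [h.periodic_curve t, h.periodic_normal t]
  obtain ⟨s, hs, e⟩ := hp.exists_mem_Ico₀ h.length_pos t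
  rw [e]
  exact ht₀ (Set.Ico_subset_Icc_self hs)

lemma exists_im_eq_zero (h : IsZeroCurve ρ L g ν) :
    ∃ s₁ > 0, ∀ w : ℂ, |w.im| ≤ s₁ → ρ (tube g ν w) = 0 → w.im = 0 := by
  obtain ⟨c, hc, hcb⟩ := h.exists_normal_deriv_ge
  obtain ⟨s₁, hs₁, hm⟩ := h.exists_slice_mono h.periodic (h.contDiff.of_le (by norm_cast)) hc hcb
  refine ⟨s₁, hs₁, fun w hw h0 => ?_⟩
  have h0' : ρ (g w.re + w.im • ν w.re) = 0 := h0
  have hz : ρ (g w.re + (0 : ℝ) • ν w.re) = 0 := by simpa using h.zero w.re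
  rcases le_total 0 w.im with hp | hp
  · have := hm w.re w.im 0 hw (by simpa using hs₁.le) hp
    rw [h0', hz] at this
    nlinarith
  · have := hm w.re 0 w.im (by simpa using hs₁.le) hw hp
    rw [h0', hz] at this
    nlinarith

lemma isCompact_range (h : IsZeroCurve ρ L g ν) : IsCompact (Set.range g) := by
  have : Set.range g = g '' Set.Icc 0 L := by
    refine Set.Subset.antisymm ?_ (Set.image_subset_range _ _)
    rintro _ ⟨t, rfl⟩
    obtain ⟨s, hs, e⟩ := h.periodic_curve.exists_mem_Ico₀ h.length_pos t
    exact ⟨s, Set.Ico_subset_Icc_self hs, e.symm⟩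
  rw [this]
  exact isCompact_Icc.image h.contDiff_curve.continuous

/-- The curve is simple modulo the lattice. -/
lemma curve_eq_of_sub_mem (h : IsZeroCurve ρ L g ν) {t t' : ℝ} (hm : g t - g t' ∈ latGroup) :
    g t = g t' := by
  set l := g t - g t' with hl
  have hρl : ∀ z, ρ (z - l) = ρ z := fun z => by
    obtain ⟨m, k, e⟩ := neg_mem hm
    rw [sub_eq_add_neg]
    exact e ▸ h.periodic.add_lat m k z
  obtain ⟨s₁, hs₁, h0⟩ := h.exists_im_eq_zero
  have hcl : IsClopen {r | g r - l ∈ Set.range g} := by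
    constructor
    · exact h.isCompact_range.isClosed.preimage
        (h.contDiff_curve.continuous.sub continuous_const)
    · rw [isOpen_iff_mem_nhds]
      rintro r ⟨r', hr'⟩
      have hV : {w : ℂ | |w.im| < s₁} ∈ nhds (r' : ℂ) :=
        (isOpen_lt (continuous_abs.comp continuous_im) continuous_const).mem_nhds (by simpa using hs₁)
      have hV' : tube g ν '' {w : ℂ | |w.im| < s₁} ∈ nhds (g r - l) := by
        rw [← hr', ← h.map_nhds_tube r']
        exact Filter.image_mem_map hV
      have hc : Continuous fun r => g r - l := h.contDiff_curve.continuous.sub continuous_const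
      filter_upwards [hc.continuousAt.preimage_mem_nhds hV'] with q hq
      obtain ⟨w, hw, e⟩ := hq
      beta_reduce at e
      have hw0 := h0 w (le_of_lt hw) (by rw [e, hρl, h.zero])
      refine ⟨w.re, ?_⟩
      rw [← e, tube, hw0, zero_smul, add_zero]
  have huniv := hcl.eq_univ ⟨t, t', by rw [hl]; abel⟩
  have hstep : ∀ r, g r - l ∈ Set.range g := fun r => by
    have : r ∈ {r | g r - l ∈ Set.range g} := huniv ▸ Set.mem_univ r
    exact this
  have hit : ∀ n : ℕ, g t - (n : ℝ) • l ∈ Set.range g := fun n => by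
    induction n with
    | zero => simp
    | succ n ih =>
      obtain ⟨r, hr⟩ := ih
      have := hstep r
      rw [hr] at this
      convert this using 1
      push_cast
      rw [add_smul, one_smul]
      abel
  obtain ⟨B, hB, hb⟩ := h.exists_bound h.periodic_curve h.contDiff_curve.continuous
  have hl0 : ‖l‖ = 0 := by
    by_contra hne
    have hlp : 0 < ‖l‖ := (norm_nonneg l).lt_of_ne' hne
    obtain ⟨n, hn⟩ := exists_nat_gt (2 * B / ‖l‖)
    rw [div_lt_iff₀ hlp] at hn
    obtain ⟨r, hr⟩ := hit n
    have : (n : ℝ) * ‖l‖ ≤ 2 * B := by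
      calc (n : ℝ) * ‖l‖ = ‖(n : ℝ) • l‖ := by rw [norm_smul]; simp
        _ = ‖g t - g r‖ := by rw [hr]; congr 1; abel
        _ ≤ ‖g t‖ + ‖g r‖ := norm_sub_le _ _
        _ ≤ 2 * B := by linarith [hb t, hb r]
    linarith
  exact sub_eq_zero.1 (norm_eq_zero.1 hl0)

lemma exists_int_of_curve_eq (h : IsZeroCurve ρ L g ν) {t t' : ℝ} (he : g t = g t') :
    ∃ j : ℤ, t' = t + j * L := by
  have hL := h.length_pos
  have e : ∀ t, g (toIcoMod hL 0 t) = g t := fun t => by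
    rw [toIcoMod]
    exact h.periodic_curve.sub_zsmul_eq _
  have hm : ∀ t, toIcoMod hL 0 t ∈ Set.Ico 0 L := fun t => by simpa using toIcoMod_mem_Ico hL 0 t
  have := h.injOn_curve (hm t) (hm t') (by rw [e, e, he])
  rw [toIcoMod, toIcoMod] at this
  refine ⟨toIcoDiv hL 0 t' - toIcoDiv hL 0 t, ?_⟩
  simp only [zsmul_eq_mul] at this
  push_cast
  linarith

end IsZeroCurve

/-- The strip on which normal coordinates are used. -/
def tubeDom (L s : ℝ) : Set ℂ := {w | w.re ∈ Set.Ico 0 L ∧ w.im ∈ Set.Ioo (-s) s}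

lemma measurableSet_tubeDom (L s : ℝ) : MeasurableSet (tubeDom L s) :=
  (measurable_re measurableSet_Ico).inter (measurable_im measurableSet_Ioo)

lemma setIntegral_tubeDom (L s : ℝ) {F : ℂ → ℝ} (hF : IntegrableOn F (tubeDom L s)) :
    ∫ w in tubeDom L s, F w =
      ∫ t in Set.Ico 0 L, ∫ r in Set.Ioo (-s) s, F (t + r * I) := by
  have hmp := Complex.volume_preserving_equiv_real_prod.symm
  have hpre : Complex.measurableEquivRealProd.symm ⁻¹' (tubeDom L s) =
      Set.Ico 0 L ×ˢ Set.Ioo (-s) s := by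
    ext p; simp [tubeDom, Complex.measurableEquivRealProd]
  have e := hmp.setIntegral_preimage_emb (MeasurableEquiv.measurableEmbedding _) F (tubeDom L s)
  rw [hpre] at e
  have hF' := (hmp.integrableOn_comp_preimage (MeasurableEquiv.measurableEmbedding _)).2 hF
  rw [hpre] at hF'
  rw [← e, Measure.volume_eq_prod]
  rw [setIntegral_prod _ (by rw [← Measure.volume_eq_prod]; exact hF')]
  refine integral_congr_ae (Filter.Eventually.of_forall fun t => ?_)
  refine integral_congr_ae (Filter.Eventually.of_forall fun r => ?_)
  change F ⟨t, r⟩ = _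
  congr 1
  apply Complex.ext <;> simp

lemma volume_tubeDom_lt_top (L s : ℝ) : volume (tubeDom L s) < ⊤ := by
  refine lt_of_le_of_lt (measure_mono (t := Metric.closedBall 0 (|L| + |s|)) ?_)
    measure_closedBall_lt_top
  rintro w ⟨⟨h1, h2⟩, h3, h4⟩
  rw [mem_closedBall_zero_iff]
  refine (Complex.norm_le_abs_re_add_abs_im w).trans (add_le_add ?_ ?_)
  · rw [abs_of_nonneg h1]; exact h2.le.trans (le_abs_self L)
  · exact (abs_lt.2 ⟨h3, h4⟩).le.trans (le_abs_self s)

/-- The integral over a period cell may be computed on any measurable set of representatives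
carrying the integrand. -/
lemma setIntegral_Efd_eq_of_representatives {A : Set ℂ} (hA : MeasurableSet A)
    (hinj : ∀ a ∈ A, ∀ b ∈ A, a - b ∈ latGroup → a = b) {f : ℂ → ℝ} (hf : PeriodicC f)
    (hsupp : ∀ z, f z ≠ 0 → ∃ a ∈ A, z - a ∈ latGroup) :
    ∫ z in Efd, f z = ∫ z in A, f z := by
  set B : Set ℂ := {z | ∃ a ∈ A, z - a ∈ latGroup} with hB
  have hBm : MeasurableSet B := by
    have : B = ⋃ l : latGroup, (fun z => z - (l : ℂ)) ⁻¹' A := by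
      ext z
      simp only [hB, Set.mem_ofPred_eq, Set.mem_iUnion, Set.mem_preimage, Subtype.exists, exists_prop]
      constructor
      · rintro ⟨a, ha, hm⟩
        exact ⟨z - a, hm, by simpa using ha⟩
      · rintro ⟨l, hl, hm⟩
        exact ⟨z - l, hm, by simpa using hl⟩
    rw [this]
    exact MeasurableSet.iUnion fun l => (measurable_id.sub_const _) hA
  have hAB : A ⊆ B := fun a ha => ⟨a, ha, by simp⟩
  have hBinv : ∀ z l, l ∈ latGroup → (l + z ∈ B ↔ z ∈ B) := fun z l hl => by
    constructor
    · rintro ⟨a, ha, hm⟩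
      refine ⟨a, ha, ?_⟩
      have := sub_mem hm hl
      rwa [show l + z - a - l = z - a by ring] at this
    · rintro ⟨a, ha, hm⟩
      refine ⟨a, ha, ?_⟩
      have := add_mem hm hl
      rwa [show z - a + l = l + z - a by ring] at this
  have hfd : IsAddFundamentalDomain latGroup (A ∪ (Efd \ B)) (volume : Measure ℂ) := by
    refine IsAddFundamentalDomain.mk' (hA.union (measurableSet_Efd.diff hBm)).nullMeasurableSet
      fun z => ?_
    by_cases hz : z ∈ B
    · obtain ⟨a, ha, hm⟩ := hz
      refine ⟨⟨a - z, by simpa using neg_mem hm⟩, Or.inl (by change a - z + z ∈ A; simpa using ha), ?_⟩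
      rintro ⟨l, hl⟩ hlz
      change l + z ∈ A ∪ (Efd \ B) at hlz
      rcases hlz with h1 | h1
      · have := hinj _ h1 _ ha (by
          have := add_mem hl hm
          rwa [show l + (z - a) = l + z - a by ring] at this)
        exact Subtype.ext (eq_sub_of_add_eq this)
      · exact absurd ((hBinv z l hl).2 ⟨a, ha, hm⟩) h1.2
    · obtain ⟨m, k, h⟩ := exists_lat_mem_Sq 0 z
      rw [Sq_zero, add_comm] at h
      refine ⟨⟨lat m k, m, k, rfl⟩, Or.inr ⟨h, fun hb => hz ((hBinv z _ ⟨m, k, rfl⟩).1 hb)⟩, ?_⟩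
      rintro ⟨l, m', k', rfl⟩ hlz
      change lat m' k' + z ∈ A ∪ (Efd \ B) at hlz
      rcases hlz with h1 | h1
      · exact absurd ((hBinv z _ ⟨m', k', rfl⟩).1 (hAB h1)) hz
      · have := lat_unique_Sq (a := 0) (z := z) (m := m') (k := k') (m' := m) (k' := k)
          (by rw [Sq_zero, add_comm]; exact h1.1) (by rw [Sq_zero, add_comm]; exact h)
        exact Subtype.ext (by rw [this.1, this.2])
  rw [isAddFundamentalDomain_Efd.setIntegral_eq hfd fun l z => hf.vadd l z]
  refine setIntegral_eq_of_subset_of_forall_sdiff_eq_zero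
    (hA.union (measurableSet_Efd.diff hBm)) Set.subset_union_left fun z hz => ?_
  by_contra hne
  rcases hz.1 with h1 | h1
  · exact hz.2 h1
  · exact h1.2 (hsupp z hne)

namespace IsZeroCurve

variable {ρ : ℂ → ℝ} {L : ℝ} {g ν : ℝ → ℂ}

lemma tendsto_im_zero {u : ℕ → ℂ} {z : ℂ} (hu : Filter.Tendsto u Filter.atTop (nhds z))
    {φ : ℕ → ℕ} (hφ : StrictMono φ) (hi : ∀ n, |(u n).im| ≤ 1 / ((φ n : ℝ) + 1)) : z.im = 0 := by
  have h1 : Filter.Tendsto (fun n => (u n).im) Filter.atTop (nhds z.im) :=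
    (continuous_im.tendsto z).comp hu
  have h2 : Filter.Tendsto (fun n => 1 / ((φ n : ℝ) + 1)) Filter.atTop (nhds 0) :=
    tendsto_one_div_add_atTop_nhds_zero_nat.comp hφ.tendsto_atTop
  exact tendsto_nhds_unique h1 (squeeze_zero_norm hi h2)

/-- Normal coordinates are injective modulo the lattice on a thin strip. -/
lemma exists_tube_inj (h : IsZeroCurve ρ L g ν) : ∃ s₀ > 0, ∀ w ∈ tubeDom L s₀, ∀ w' ∈ tubeDom L s₀,
    tube g ν w - tube g ν w' ∈ latGroup → w = w' := by
  by_contra! hcon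
  have hseq : ∀ n : ℕ, ∃ w w' : ℂ, (w.re ∈ Set.Ico 0 L ∧ |w.im| ≤ 1 / ((n : ℝ) + 1)) ∧
      (w'.re ∈ Set.Ico 0 L ∧ |w'.im| ≤ 1 / ((n : ℝ) + 1)) ∧
      tube g ν w - tube g ν w' ∈ latGroup ∧ w ≠ w' := fun n => by
    obtain ⟨w, hw, w', hw', h1, h2⟩ := hcon (1 / ((n : ℝ) + 1)) (by positivity)
    exact ⟨w, w', ⟨hw.1, (abs_lt.2 hw.2).le⟩, ⟨hw'.1, (abs_lt.2 hw'.2).le⟩, h1, h2⟩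
  choose w w' hw hw' hm hne using hseq
  have hball : ∀ (u : ℂ) (n : ℕ), u.re ∈ Set.Ico 0 L ∧ |u.im| ≤ 1 / ((n : ℝ) + 1) →
      u ∈ Metric.closedBall (0 : ℂ) (L + 1) := fun u n hu => by
    rw [mem_closedBall_zero_iff]
    refine (Complex.norm_le_abs_re_add_abs_im u).trans (add_le_add ?_ ?_)
    · rw [abs_of_nonneg hu.1.1]; exact hu.1.2.le
    · refine hu.2.trans ?_
      rw [div_le_one (by positivity)]
      linarith [n.cast_nonneg (α := ℝ)]
  obtain ⟨p, -, κ, hκ, hp⟩ := ((isCompact_closedBall (0 : ℂ) (L + 1)).prod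
    (isCompact_closedBall (0 : ℂ) (L + 1))).tendsto_subseq
    (x := fun n => (w n, w' n)) fun n => ⟨hball _ n (hw n), hball _ n (hw' n)⟩
  have hp1 : Filter.Tendsto (fun n => w (κ n)) Filter.atTop (nhds p.1) :=
    (continuous_fst.tendsto p).comp hp
  have hp2 : Filter.Tendsto (fun n => w' (κ n)) Filter.atTop (nhds p.2) :=
    (continuous_snd.tendsto p).comp hp
  have e1 : p.1 = (p.1.re : ℂ) :=
    Complex.ext (by simp) (by simpa using tendsto_im_zero hp1 hκ fun n => (hw (κ n)).2)
  have e2 : p.2 = (p.2.re : ℂ) :=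
    Complex.ext (by simp) (by simpa using tendsto_im_zero hp2 hκ fun n => (hw' (κ n)).2)
  have ht1 := (h.continuous_tube.tendsto p.1).comp hp1
  have ht2 := (h.continuous_tube.tendsto p.2).comp hp2
  have ht := ht1.sub ht2
  have hlim : tube g ν p.1 - tube g ν p.2 ∈ latGroup :=
    isClosed_latGroup.mem_of_tendsto ht (Filter.Eventually.of_forall fun n => hm (κ n))
  rw [e1, e2, tube_ofReal, tube_ofReal] at hlim
  have hg := h.curve_eq_of_sub_mem hlim
  obtain ⟨j, hj⟩ := h.exists_int_of_curve_eq hg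
  have h0 : tube g ν p.1 - tube g ν p.2 = 0 := by
    rw [e1, e2, tube_ofReal, tube_ofReal, hg, sub_self]
  rw [h0] at ht
  obtain ⟨U, hU, hUinj⟩ := h.exists_injOn_tube p.2.re
  rw [← e2] at hU
  have hp1' : Filter.Tendsto (fun n => w (κ n) + ((j * L : ℝ) : ℂ)) Filter.atTop (nhds p.2) := by
    have : p.2 = p.1 + ((j * L : ℝ) : ℂ) := by rw [e1, e2, hj]; push_cast; ring
    rw [this]
    exact hp1.add_const _
  have hsmall := (Metric.tendsto_nhds.1 ht) π Real.pi_pos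
  obtain ⟨n, hn1, hn2, hn3⟩ :=
    ((hp1'.eventually_mem hU).and ((hp2.eventually_mem hU).and hsmall)).exists
  simp only [Function.comp_apply, dist_zero_right] at hn3
  have heq : tube g ν (w (κ n)) - tube g ν (w' (κ n)) = 0 := by
    by_contra hne0
    exact notMem_latGroup_of_norm_lt hn3 hne0 (hm (κ n))
  have hww := hUinj hn1 hn2 (by rw [h.tube_add]; exact sub_eq_zero.1 heq)
  have hre := congrArg Complex.re hww
  simp only [add_re, ofReal_re] at hre
  have hL := h.length_pos
  obtain ⟨⟨a1, a2⟩, -⟩ := hw (κ n)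
  obtain ⟨⟨b1, b2⟩, -⟩ := hw' (κ n)
  have hj0 : j = 0 := by
    have l1 : (j : ℝ) < 1 := by by_contra! hc; nlinarith
    have l2 : (-1 : ℝ) < j := by by_contra! hc; nlinarith
    have l1' : j < 1 := by exact_mod_cast l1
    have l2' : -1 < j := by exact_mod_cast l2
    omega
  apply hne (κ n)
  simpa [hj0] using hww

/-- Points at which a defining function is small lie in the tube. -/
lemma exists_tube_cover (h : IsZeroCurve ρ L g ν) {y : ℂ → ℝ} (hy : Continuous y)
    (hyp : PeriodicC y) (hy0 : ∀ z, y z = 0 → ρ z = 0) {s₀ : ℝ} (hs₀ : 0 < s₀) :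
    ∃ b₀ > 0, ∀ z, |y z| ≤ b₀ → ∃ w ∈ tubeDom L s₀, z - tube g ν w ∈ latGroup := by
  by_contra! hcon
  have hseq : ∀ n : ℕ, ∃ z ∈ Metric.closedBall (0 : ℂ) (4 * π), |y z| ≤ 1 / ((n : ℝ) + 1) ∧
      ∀ w ∈ tubeDom L s₀, z - tube g ν w ∉ latGroup := fun n => by
    obtain ⟨z, hz, h1⟩ := hcon (1 / ((n : ℝ) + 1)) (by positivity)
    obtain ⟨m, k, hmk⟩ := exists_lat_mem_Sq 0 z
    rw [Sq_zero] at hmk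
    refine ⟨z + lat m k, Efd_subset_closedBall hmk, by rwa [hyp.add_lat], fun w hw hm => ?_⟩
    refine h1 w hw ?_
    have := sub_mem hm (⟨m, k, rfl⟩ : lat m k ∈ latGroup)
    rwa [show z + lat m k - tube g ν w - lat m k = z - tube g ν w by ring] at this
  choose u hu hyu hnot using hseq
  obtain ⟨z, -, κ, hκ, hp⟩ := (isCompact_closedBall (0 : ℂ) (4 * π)).tendsto_subseq hu
  have hyz : y z = 0 := by
    have h2 : Filter.Tendsto (fun n => 1 / ((κ n : ℝ) + 1)) Filter.atTop (nhds 0) :=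
      tendsto_one_div_add_atTop_nhds_zero_nat.comp hκ.tendsto_atTop
    exact tendsto_nhds_unique ((hy.tendsto z).comp hp) (squeeze_zero_norm (fun n => hyu (κ n)) h2)
  obtain ⟨t, ht⟩ := h.exhaust z (hy0 z hyz)
  have hlim : Filter.Tendsto (fun n => u (κ n) - (z - g t)) Filter.atTop (nhds (g t)) := by
    have := hp.sub_const (z - g t)
    rwa [sub_sub_cancel] at this
  have hV : {w : ℂ | w.im ∈ Set.Ioo (-s₀) s₀} ∈ nhds (t : ℂ) :=
    (isOpen_Ioo.preimage continuous_im).mem_nhds (by simpa using hs₀)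
  have hV' : tube g ν '' {w : ℂ | w.im ∈ Set.Ioo (-s₀) s₀} ∈ nhds (g t) := by
    rw [← h.map_nhds_tube t]
    exact Filter.image_mem_map hV
  obtain ⟨n, w, hw, e⟩ := (hlim.eventually_mem hV').exists
  set j := toIcoDiv h.length_pos 0 w.re with hj
  refine hnot (κ n) (w + (((-j : ℤ) * L : ℝ) : ℂ)) ⟨?_, by simpa using hw⟩ ?_
  · have := toIcoMod_mem_Ico h.length_pos 0 w.re
    rw [toIcoMod, zero_add, zsmul_eq_mul, ← hj] at this
    constructor <;> simp only [add_re, ofReal_re, Int.cast_neg] <;> linarith [this.1, this.2]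
  · rw [h.tube_add, e]
    simpa using ht

end IsZeroCurve

lemma integrableOn_tubeDom_slices (L s : ℝ) {F : ℂ → ℝ} (hF : IntegrableOn F (tubeDom L s)) :
    IntegrableOn (fun t : ℝ => ∫ r in Set.Ioo (-s) s, F (t + r * I)) (Set.Ico 0 L) := by
  have hmp := Complex.volume_preserving_equiv_real_prod.symm
  have hpre : Complex.measurableEquivRealProd.symm ⁻¹' (tubeDom L s) =
      Set.Ico 0 L ×ˢ Set.Ioo (-s) s := by
    ext p; simp [tubeDom, Complex.measurableEquivRealProd]
  have hF' := (hmp.integrableOn_comp_preimage (MeasurableEquiv.measurableEmbedding _)).2 hF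
  rw [hpre, IntegrableOn, Measure.volume_eq_prod, ← Measure.prod_restrict] at hF'
  refine hF'.integral_prod_left.congr (Filter.Eventually.of_forall fun t => ?_)
  refine integral_congr_ae (Filter.Eventually.of_forall fun r => ?_)
  change F ⟨t, r⟩ = _
  congr 1
  apply Complex.ext <;> simp

lemma abs_setIntegral_tubeDom_sub_le {L s e : ℝ} (hL : 0 ≤ L) {F : ℂ → ℝ}
    (hF : IntegrableOn F (tubeDom L s)) {c : ℝ → ℝ} (hc : Continuous c)
    (hb : ∀ t : ℝ, |(∫ r in Set.Ioo (-s) s, F (t + r * I)) - c t| ≤ e) :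
    |(∫ w in tubeDom L s, F w) - ∫ t in (0 : ℝ)..L, c t| ≤ L * e := by
  have hci : IntegrableOn c (Set.Ico 0 L) :=
    (hc.continuousOn.integrableOn_compact isCompact_Icc).mono_set Set.Ico_subset_Icc_self
  rw [setIntegral_tubeDom L s hF, intervalIntegral.integral_of_le hL, ← integral_Ico_eq_integral_Ioc,
    ← integral_sub (integrableOn_tubeDom_slices L s hF) hci]
  have := norm_setIntegral_le_of_norm_le_const (μ := volume) (s := Set.Ico 0 L) (C := e)
    (f := fun t : ℝ => (∫ r in Set.Ioo (-s) s, F (t + r * I)) - c t) (by simp) fun t _ => hb t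
  rw [Real.norm_eq_abs] at this
  refine this.trans_eq ?_
  simp [Measure.real, hL, mul_comm]

namespace IsZeroCurve

variable {ρ : ℂ → ℝ} {L : ℝ} {g ν : ℝ → ℂ}

/-- Integrals of periodic functions carried by a neighbourhood of the curve can be computed
slice by slice in normal coordinates. -/
lemma exists_abs_setIntegral_sub_le (h : IsZeroCurve ρ L g ν) {y : ℂ → ℝ} (hy : Continuous y)
    (hyp : PeriodicC y) (hy0 : ∀ z, y z = 0 → ρ z = 0) {s₁ : ℝ} (hs₁ : 0 < s₁) :
    ∃ s₀ > 0, s₀ ≤ s₁ ∧ ∃ b₀ > 0, ∀ f : ℂ → ℝ, Measurable f → PeriodicC f →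
      (∃ B, ∀ z, |f z| ≤ B) → (∀ z, f z ≠ 0 → |y z| ≤ b₀) → ∀ c : ℝ → ℝ, Continuous c → ∀ e : ℝ,
      (∀ t : ℝ, |(∫ r in Set.Ioo (-s₀) s₀,
        |tubeJac g ν (t + r * I)| * f (g t + r • ν t)) - c t| ≤ e) →
      |(∫ z in Efd, f z) - ∫ t in (0 : ℝ)..L, c t| ≤ L * e := by
  obtain ⟨s₂, hs₂, hinj⟩ := h.exists_tube_inj
  have hs : 0 < min s₁ s₂ := lt_min hs₁ hs₂
  obtain ⟨b₀, hb₀, hcov⟩ := h.exists_tube_cover hy hyp hy0 hs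
  refine ⟨min s₁ s₂, hs, min_le_left _ _, b₀, hb₀, fun f hfm hfp hfB hfs c hc e hb => ?_⟩
  set s₀ := min s₁ s₂ with hs₀
  have hsub : tubeDom L s₀ ⊆ tubeDom L s₂ := fun w hw =>
    ⟨hw.1, by linarith [hw.2.1, min_le_right s₁ s₂], by linarith [hw.2.2, min_le_right s₁ s₂]⟩
  have hinj' : ∀ w ∈ tubeDom L s₀, ∀ w' ∈ tubeDom L s₀,
      tube g ν w - tube g ν w' ∈ latGroup → w = w' := fun w hw w' hw' =>
    hinj w (hsub hw) w' (hsub hw')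
  have hinjOn : Set.InjOn (tube g ν) (tubeDom L s₀) := fun w hw w' hw' e => by
    exact hinj' w hw w' hw' (by rw [e, sub_self]; exact zero_mem _)
  have hAm : MeasurableSet (tube g ν '' tubeDom L s₀) :=
    (measurableSet_tubeDom L s₀).image_of_continuousOn_injOn h.continuous_tube.continuousOn hinjOn
  have e1 : ∫ z in Efd, f z = ∫ z in tube g ν '' tubeDom L s₀, f z := by
    refine setIntegral_Efd_eq_of_representatives hAm ?_ hfp fun z hz => ?_
    · rintro _ ⟨w, hw, rfl⟩ _ ⟨w', hw', rfl⟩ hm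
      rw [hinj' w hw w' hw' hm]
    · obtain ⟨w, hw, hm⟩ := hcov z (hfs z hz)
      exact ⟨_, ⟨w, hw, rfl⟩, hm⟩
  have e2 := integral_image_eq_integral_abs_det_fderiv_smul volume (measurableSet_tubeDom L s₀)
    (fun w _ => (h.hasStrictFDerivAt_tube w).hasFDerivAt.hasFDerivWithinAt) hinjOn f
  rw [e1, e2]
  simp only [smul_eq_mul]
  have hbd : ∃ K, ∀ w ∈ tubeDom L s₀, |tubeJac g ν w| ≤ K := by
    obtain ⟨C, hC, hj⟩ := h.exists_tubeJac_bound
    refine ⟨1 + C * s₀, fun w hw => ?_⟩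
    have h1 := (abs_le.1 (hj w)).2
    have h2 : C * |w.im| ≤ C * s₀ := mul_le_mul_of_nonneg_left (abs_lt.2 hw.2).le hC.le
    linarith
  have hF : IntegrableOn (fun w => |tubeJac g ν w| * f (tube g ν w)) (tubeDom L s₀) := by
    obtain ⟨K, hK⟩ := hbd
    obtain ⟨B, hB⟩ := hfB
    refine IntegrableOn.of_bound (volume_tubeDom_lt_top L s₀) ?_ (K * B) ?_
    · exact ((h.continuous_tubeJac.abs.measurable).mul
        (hfm.comp h.continuous_tube.measurable)).aestronglyMeasurable
    · refine (ae_restrict_iff' (measurableSet_tubeDom L s₀)).2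
        (Filter.Eventually.of_forall fun w hw => ?_)
      rw [norm_mul, Real.norm_eq_abs, Real.norm_eq_abs, abs_abs]
      exact mul_le_mul (hK w hw) (hB _) (abs_nonneg _) ((abs_nonneg _).trans (hK w hw))
  refine abs_setIntegral_tubeDom_sub_le h.length_pos.le hF hc fun t => ?_
  refine le_trans (le_of_eq ?_) (hb t)
  simp [tube]

end IsZeroCurve

lemma mul_mul_sub_bound {J R a s C K : ℝ} (hC : 0 ≤ C) (hs : 0 ≤ s) (hs1 : s ≤ 1)
    (ha : |a| ≤ K) (hJ : |J - 1| ≤ C * s) (hR : |R - a * s| ≤ C * s ^ 2) :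
    |J * R - a * s| ≤ (C * (K + C) + C) * s ^ 2 ∧ |J * R| ≤ (1 + C) * (K + C) * s := by
  have hR' : |R| ≤ (K + C) * s := by
    calc |R| = |(R - a * s) + a * s| := by ring_nf
      _ ≤ |R - a * s| + |a * s| := abs_add_le _ _
      _ ≤ C * s ^ 2 + K * s := by rw [abs_mul a s, abs_of_nonneg hs]; gcongr
      _ ≤ (K + C) * s := by nlinarith [mul_nonneg hC hs]
  have hJ' : |J| ≤ 1 + C := by
    calc |J| = |(J - 1) + 1| := by ring_nf
      _ ≤ |J - 1| + |(1 : ℝ)| := abs_add_le _ _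
      _ ≤ 1 + C := by rw [abs_one]; nlinarith
  constructor
  · calc |J * R - a * s| = |(J - 1) * R + (R - a * s)| := by ring_nf
      _ ≤ |J - 1| * |R| + |R - a * s| := by rw [← abs_mul]; exact abs_add_le _ _
      _ ≤ C * s * ((K + C) * s) + C * s ^ 2 := by gcongr
      _ = _ := by ring
  · rw [abs_mul]
    calc |J| * |R| ≤ (1 + C) * ((K + C) * s) := by gcongr
      _ = _ := by ring

/-- The one dimensional profile estimate behind the area expansion of thin bands. -/
lemma abs_slice_integral_sub_le {Y R J : ℝ → ℝ} (hYc : Continuous Y) (hRc : Continuous R)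
    (hJc : Continuous J) {s₀ c C K a α b : ℝ} (hs₀ : 0 < s₀) (hs₀1 : s₀ ≤ 1) (hc : 0 < c)
    (hC : 0 < C) (hK : 0 < K) (ha : 0 < a) (haK : a ≤ K) (hα : c ≤ α) (hb : 0 < b)
    (hb₀ : b < c * s₀) (hY0 : Y 0 = 0)
    (hY : ∀ s s', |s| ≤ s₀ → |s'| ≤ s₀ → s' ≤ s → c * (s - s') ≤ Y s - Y s')
    (hYα : ∀ s, |Y s - α * s| ≤ C * s ^ 2) (hR : ∀ s, |R s - a * s| ≤ C * s ^ 2)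
    (hJ : ∀ s, |J s - 1| ≤ C * |s|) :
    |(∫ s in Set.Ioo (-s₀) s₀, J s * {s | 0 < Y s ∧ Y s ≤ b}.indicator R s)
      - a * (b / α) ^ 2 / 2| ≤
      ((C * (K + C) + C) / c ^ 3 + 2 * ((1 + C) * (K + C) / c) * (C / c ^ 3)) * b ^ 3 := by
  have hα0 : 0 < α := hc.trans_le hα
  set F : ℝ → ℝ := fun s => J s * {s | 0 < Y s ∧ Y s ≤ b}.indicator R s with hF
  set F₀ : ℝ → ℝ := (Set.Ioc 0 (b / α)).indicator fun s => a * s with hF₀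
  set K₁ := (C * (K + C) + C) / c ^ 2 with hK₁
  set K₂ := (1 + C) * (K + C) / c with hK₂
  set K₃ := C / c ^ 3 with hK₃
  have hK₁0 : 0 ≤ K₁ := by positivity
  have hK₂0 : 0 ≤ K₂ := by positivity
  have hK₃0 : 0 ≤ K₃ := by positivity
  set H : ℝ → ℝ := fun s => (Set.Ioc 0 (b / c)).indicator (fun _ => K₁ * b ^ 2) s +
    (Set.Icc (b / α - K₃ * b ^ 2) (b / α + K₃ * b ^ 2)).indicator (fun _ => K₂ * b) s with hH
  have hbα : b / α ≤ b / c := div_le_div_of_nonneg_left hb.le hc hα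
  have hbc : b / c < s₀ := by rw [div_lt_iff₀ hc]; linarith
  have hH1 : ∀ s, 0 ≤ (Set.Ioc 0 (b / c)).indicator (fun _ : ℝ => K₁ * b ^ 2) s := fun s =>
    Set.indicator_nonneg (fun _ _ => by positivity) s
  have hH2 : ∀ s, 0 ≤ (Set.Icc (b / α - K₃ * b ^ 2) (b / α + K₃ * b ^ 2)).indicator
      (fun _ : ℝ => K₂ * b) s := fun s => Set.indicator_nonneg (fun _ _ => by positivity) s
  have hsq : ∀ s, 0 < s → s ≤ b / c → C * s ^ 2 / α ≤ K₃ * b ^ 2 := fun s hs hsb => by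
    calc C * s ^ 2 / α ≤ C * (b / c) ^ 2 / c := by gcongr
      _ = K₃ * b ^ 2 := by rw [hK₃]; field_simp
  have hpos : ∀ s, |s| ≤ s₀ → 0 < Y s → 0 < s := fun s hs hYs => by
    by_contra! hneg
    have := hY 0 s (by simpa using hs₀.le) hs hneg
    nlinarith
  have hpt : ∀ s ∈ Set.Ioo (-s₀) s₀, ‖F s - F₀ s‖ ≤ H s := fun s hs => by
    have hsa : |s| ≤ s₀ := (abs_lt.2 hs).le
    rw [Real.norm_eq_abs]
    by_cases hW : 0 < Y s ∧ Y s ≤ b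
    · have hs0 := hpos s hsa hW.1
      have hsc : s ≤ b / c := by
        have := hY s 0 hsa (by simpa using hs₀.le) hs0.le
        rw [le_div_iff₀ hc]; nlinarith [hW.2]
      have hJs := hJ s
      rw [abs_of_pos hs0] at hJs
      obtain ⟨m1, m2⟩ := mul_mul_sub_bound (J := J s) (K := K) hC.le hs0.le (hs.2.le.trans hs₀1)
        (by rwa [abs_of_pos ha]) hJs (hR s)
      have hFs : F s = J s * R s := by simp [hF, Set.indicator_of_mem (s := {s | 0 < Y s ∧ Y s ≤ b}) hW]
      by_cases hsα : s ≤ b / α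
      · have hF₀s : F₀ s = a * s := Set.indicator_of_mem (s := Set.Ioc 0 (b / α)) ⟨hs0, hsα⟩ _
        rw [hFs, hF₀s]
        refine m1.trans (le_trans ?_ (le_add_of_nonneg_right (hH2 s)))
        rw [Set.indicator_of_mem (s := Set.Ioc 0 (b / c)) ⟨hs0, hsc⟩]
        calc (C * (K + C) + C) * s ^ 2 ≤ (C * (K + C) + C) * (b / c) ^ 2 := by gcongr
          _ = K₁ * b ^ 2 := by rw [hK₁]; field_simp
      · have hF₀s : F₀ s = 0 := Set.indicator_of_notMem (fun hm => hsα hm.2) _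
        rw [hFs, hF₀s, sub_zero]
        push Not at hsα
        refine m2.trans (le_trans ?_ (le_add_of_nonneg_left (hH1 s)))
        rw [Set.indicator_of_mem (s := Set.Icc (b / α - K₃ * b ^ 2) (b / α + K₃ * b ^ 2))]
        · calc (1 + C) * (K + C) * s ≤ (1 + C) * (K + C) * (b / c) := by gcongr
            _ = K₂ * b := by rw [hK₂]; field_simp
        · constructor
          · nlinarith [mul_nonneg hK₃0 (sq_nonneg b)]
          · have h1 : s ≤ b / α + C * s ^ 2 / α := by
              rw [← add_div, le_div_iff₀ hα0]
              linarith [(abs_le.1 (hYα s)).1, hW.2]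
            linarith [hsq s hs0 hsc]
    · have hFs : F s = 0 := by
        simp only [hF]
        rw [Set.indicator_of_notMem (s := {s | 0 < Y s ∧ Y s ≤ b}) hW, mul_zero]
      by_cases hm : s ∈ Set.Ioc 0 (b / α)
      · have hF₀s : F₀ s = a * s := Set.indicator_of_mem hm _
        rw [hFs, hF₀s, zero_sub, abs_neg, abs_of_pos (mul_pos ha hm.1)]
        have hYs : 0 < Y s := by
          have := hY s 0 hsa (by simpa using hs₀.le) hm.1.le
          nlinarith [hm.1]
        have hYb : b < Y s := by
          by_contra! hc'
          exact hW ⟨hYs, hc'⟩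
        refine le_trans ?_ (le_add_of_nonneg_left (hH1 s))
        rw [Set.indicator_of_mem (s := Set.Icc (b / α - K₃ * b ^ 2) (b / α + K₃ * b ^ 2))]
        · calc a * s ≤ K * (b / c) := by
                have := hm.2.trans hbα
                have := hm.1
                gcongr
            _ ≤ (1 + C) * (K + C) * (b / c) := by
                have : K ≤ (1 + C) * (K + C) := by nlinarith
                gcongr
            _ = K₂ * b := by rw [hK₂]; field_simp
        · constructor
          · have h1 : b / α ≤ s + C * s ^ 2 / α := by
              rw [div_le_iff₀ hα0, add_mul, div_mul_cancel₀ _ hα0.ne']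
              linarith [(abs_le.1 (hYα s)).2]
            linarith [hsq s hm.1 (hm.2.trans hbα)]
          · linarith [hm.2, mul_nonneg hK₃0 (sq_nonneg b)]
      · have hF₀s : F₀ s = 0 := Set.indicator_of_notMem hm _
        rw [hFs, hF₀s, sub_zero, abs_zero]
        exact add_nonneg (hH1 s) (hH2 s)
  have hvol : volume (Set.Ioo (-s₀) s₀) ≠ ⊤ := by simp
  have hI : ∀ {f : ℝ → ℝ}, Continuous f → IntegrableOn f (Set.Ioo (-s₀) s₀) := fun hf =>
    (hf.continuousOn.integrableOn_compact isCompact_Icc).mono_set Set.Ioo_subset_Icc_self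
  have hWm : MeasurableSet {s | 0 < Y s ∧ Y s ≤ b} :=
    (measurableSet_lt measurable_const hYc.measurable).inter
      (measurableSet_le hYc.measurable measurable_const)
  have hFi : IntegrableOn F (Set.Ioo (-s₀) s₀) := by
    have : F = {s | 0 < Y s ∧ Y s ≤ b}.indicator fun s => J s * R s := by
      funext s
      simp only [hF, Set.indicator_apply]
      split_ifs <;> simp
    rw [this]
    exact Integrable.indicator (hI (hJc.mul hRc)) hWm
  have hF₀i : IntegrableOn F₀ (Set.Ioo (-s₀) s₀) :=
    Integrable.indicator (hI (continuous_const.mul continuous_id)) measurableSet_Ioc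
  have hc1 : IntegrableOn (fun s => (Set.Ioc 0 (b / c)).indicator (fun _ => K₁ * b ^ 2) s)
      (Set.Ioo (-s₀) s₀) := Integrable.indicator (hI continuous_const) measurableSet_Ioc
  have hc2 : IntegrableOn (fun s => (Set.Icc (b / α - K₃ * b ^ 2) (b / α + K₃ * b ^ 2)).indicator
      (fun _ => K₂ * b) s) (Set.Ioo (-s₀) s₀) :=
    Integrable.indicator (hI continuous_const) measurableSet_Icc
  have hF₀int : ∫ s in Set.Ioo (-s₀) s₀, F₀ s = a * (b / α) ^ 2 / 2 := by
    rw [hF₀, setIntegral_indicator measurableSet_Ioc]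
    have : Set.Ioo (-s₀) s₀ ∩ Set.Ioc 0 (b / α) = Set.Ioc 0 (b / α) := by
      refine Set.inter_eq_right.2 fun s hs => ⟨by linarith [hs.1], by linarith [hs.2]⟩
    rw [this, ← intervalIntegral.integral_of_le (by positivity), intervalIntegral.integral_const_mul,
      integral_id]
    ring
  rw [← hF₀int, ← integral_sub hFi hF₀i]
  have := norm_integral_le_of_norm_le (hc1.add hc2) ((ae_restrict_iff' measurableSet_Ioo).2
    (Filter.Eventually.of_forall hpt))
  rw [Real.norm_eq_abs] at this
  refine this.trans ?_
  have h_int : ∫ s in Set.Ioo (-s₀) s₀, ((fun s => (Set.Ioc 0 (b / c)).indicator (fun _ => K₁ * b ^ 2) s) +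
      fun s => (Set.Icc (b / α - K₃ * b ^ 2) (b / α + K₃ * b ^ 2)).indicator (fun _ => K₂ * b) s) s =
      (∫ s in Set.Ioo (-s₀) s₀, (Set.Ioc 0 (b / c)).indicator (fun _ => K₁ * b ^ 2) s) +
      ∫ s in Set.Ioo (-s₀) s₀, (Set.Icc (b / α - K₃ * b ^ 2) (b / α + K₃ * b ^ 2)).indicator (fun _ => K₂ * b) s :=
    integral_add hc1 hc2
  rw [h_int, setIntegral_indicator measurableSet_Ioc, setIntegral_indicator measurableSet_Icc,
    setIntegral_const, setIntegral_const]
  have v1 : volume.real (Set.Ioo (-s₀) s₀ ∩ Set.Ioc 0 (b / c)) ≤ b / c := by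
    refine (measureReal_mono Set.inter_subset_right (by simp)).trans_eq ?_
    rw [Real.volume_real_Ioc_of_le (by positivity), sub_zero]
  have v2 : volume.real (Set.Ioo (-s₀) s₀ ∩
      Set.Icc (b / α - K₃ * b ^ 2) (b / α + K₃ * b ^ 2)) ≤ 2 * (K₃ * b ^ 2) := by
    refine (measureReal_mono Set.inter_subset_right (by simp)).trans_eq ?_
    rw [Real.volume_real_Icc_of_le (by linarith [mul_nonneg hK₃0 (sq_nonneg b)])]
    ring
  rw [smul_eq_mul, smul_eq_mul]
  calc _ ≤ b / c * (K₁ * b ^ 2) + 2 * (K₃ * b ^ 2) * (K₂ * b) := by gcongr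
    _ = ((C * (K + C) + C) / c ^ 3 + 2 * K₂ * K₃) * b ^ 3 := by rw [hK₁]; field_simp

namespace IsZeroCurve

variable {ρ : ℂ → ℝ} {L : ℝ} {g ν : ℝ → ℂ}

lemma fderiv_tangent (h : IsZeroCurve ρ L g ν) (t : ℝ) : fderiv ℝ ρ (g t) (deriv g t) = 0 := by
  have h1 : HasDerivAt (fun t => ρ (g t)) (fderiv ℝ ρ (g t) (deriv g t)) t :=
    (h.contDiff.differentiable (by simp) (g t)).hasFDerivAt.comp_hasDerivAt t
      (h.contDiff_curve.differentiable (by simp) t).hasDerivAt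
  have h2 : (fun t => ρ (g t)) = fun _ => 0 := funext h.zero
  rw [h2] at h1
  exact h1.unique (hasDerivAt_const t 0)

lemma gradSq_curve (h : IsZeroCurve ρ L g ν) (t : ℝ) :
    gradSq ρ (g t) = fderiv ℝ ρ (g t) (ν t) ^ 2 := by
  have h1 : (deriv g t).re ^ 2 + (deriv g t).im ^ 2 = 1 := by
    have := h.speed t
    rw [← sq_eq_sq₀ (norm_nonneg _) zero_le_one, ← Complex.normSq_eq_norm_sq, normSq_apply] at this
    linarith
  have e : ∀ w : ℂ, fderiv ℝ ρ (g t) w = w.re * fderiv ℝ ρ (g t) 1 + w.im * fderiv ℝ ρ (g t) I :=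
    fun w => by
      have : w = w.re • (1 : ℂ) + w.im • I := by simp [Complex.re_add_im]
      conv_lhs => rw [this, map_add, map_smul, map_smul]
      simp
  have h2 := h.fderiv_tangent t
  rw [e] at h2
  rw [gradSq, e (ν t)]
  set A := fderiv ℝ ρ (g t) 1
  set B := fderiv ℝ ρ (g t) I
  rcases h.normal with hn | hn <;> rw [hn] <;> simp <;>
    linear_combination (-(A ^ 2 + B ^ 2)) * h1 +
      ((deriv g t).re * A + (deriv g t).im * B) * h2

lemma fderiv_normFun_normal (h : IsZeroCurve ρ L g ν) (t : ℝ) :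
    fderiv ℝ (normFun ρ) (g t) (ν t) = fderiv ℝ ρ (g t) (ν t) ^ (1 / 3 : ℝ) := by
  have ha := h.pos t
  rw [fderiv_normFun h.contDiff h.nondegenerate, h.zero, zero_mul, add_zero, normFactor, h.zero,
    h.gradSq_curve]
  simp only [ne_eq, OfNat.ofNat_ne_zero, not_false_eq_true, zero_pow, add_zero]
  rw [← Real.rpow_natCast, ← Real.rpow_mul ha.le]
  conv_lhs => rhs; rw [← Real.rpow_one (fderiv ℝ ρ (g t) (ν t))]
  rw [← Real.rpow_add ha]
  norm_num

lemma exists_normFun_normal_ge (h : IsZeroCurve ρ L g ν) :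
    ∃ c > 0, ∀ t, c ≤ fderiv ℝ (normFun ρ) (g t) (ν t) := by
  obtain ⟨c, hc, hb⟩ := h.exists_normal_deriv_ge
  refine ⟨c ^ (1 / 3 : ℝ), by positivity, fun t => ?_⟩
  rw [h.fderiv_normFun_normal]
  exact Real.rpow_le_rpow hc.le (hb t) (by norm_num)

lemma continuous_normal_deriv (h : IsZeroCurve ρ L g ν) :
    Continuous fun t => fderiv ℝ ρ (g t) (ν t) :=
  ((h.contDiff.continuous_fderiv (by simp)).comp h.contDiff_curve.continuous).clm_apply
    h.contDiff_normal.continuous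

lemma exists_normal_deriv_le (h : IsZeroCurve ρ L g ν) : ∃ K > 0, ∀ t, fderiv ℝ ρ (g t) (ν t) ≤ K := by
  have hp : Function.Periodic (fun t => fderiv ℝ ρ (g t) (ν t)) L := fun t => by
    simp only [h.periodic_curve t, h.periodic_normal t]
  obtain ⟨K, hK, hb⟩ := h.exists_bound hp h.continuous_normal_deriv
  exact ⟨K, hK, fun t => (le_abs_self _).trans (hb t)⟩

/-- The measure of a band `{p ≤ y ≤ q}` close to the curve is at most proportional to `q - p`. -/
lemma exists_band_volume_le (h : IsZeroCurve ρ L g ν) : ∃ C > 0, ∃ b₀ > 0, ∀ p q : ℝ,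
    -b₀ ≤ p → p ≤ q → q ≤ b₀ →
    volume.real (Efd ∩ {z | p ≤ normFun ρ z ∧ normFun ρ z ≤ q}) ≤ C * (q - p) := by
  have hy := contDiff_normFun h.contDiff h.nondegenerate
  have hyp : PeriodicC (normFun ρ) := h.periodic.normFun
  obtain ⟨c, hc, hcb⟩ := h.exists_normFun_normal_ge
  obtain ⟨s₁, hs₁, hmono⟩ := h.exists_slice_mono hyp (hy.of_le (by norm_cast)) hc hcb
  obtain ⟨CJ, hCJ, hJ⟩ := h.exists_tubeJac_bound
  obtain ⟨s₀, hs₀, hs₀1, b₀, hb₀, key⟩ := h.exists_abs_setIntegral_sub_le hy.continuous hyp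
    (fun z hz => (normFun_eq_zero_iff h.nondegenerate z).1 hz) (lt_min hs₁ zero_lt_one)
  have hL := h.length_pos
  refine ⟨L * ((1 + CJ) * (2 / c)), by positivity, b₀, hb₀, fun p q hp hpq hq => ?_⟩
  set S : Set ℂ := {z | p ≤ normFun ρ z ∧ normFun ρ z ≤ q} with hS
  have hSm : MeasurableSet S :=
    (measurableSet_le measurable_const hy.continuous.measurable).inter
      (measurableSet_le hy.continuous.measurable measurable_const)
  have hper : PeriodicC (S.indicator fun _ => (1 : ℝ)) := by
    classical
    have : S.indicator (fun _ => (1 : ℝ)) =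
        fun z => if p ≤ normFun ρ z ∧ normFun ρ z ≤ q then 1 else 0 := by
      funext z; simp [Set.indicator_apply, hS]
    rw [this]
    exact hyp.comp fun a => if p ≤ a ∧ a ≤ q then (1 : ℝ) else 0
  have := key (S.indicator fun _ => (1 : ℝ)) (measurable_const.indicator hSm) hper
    ⟨1, fun z => by by_cases hz : z ∈ S <;> simp [hz]⟩ (fun z hz => by
      have hzS : z ∈ S := by
        by_contra hn
        exact hz (Set.indicator_of_notMem hn _)
      exact abs_le.2 ⟨by linarith [hzS.1], by linarith [hzS.2]⟩) (fun _ => 0) continuous_const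
    ((1 + CJ) * (2 / c * (q - p))) fun t => by
      rw [sub_zero]
      set W : Set ℝ := {r | g t + r • ν t ∈ S} with hW
      have e : ∀ r : ℝ, |tubeJac g ν (t + r * I)| * S.indicator (fun _ => (1 : ℝ)) (g t + r • ν t) =
          W.indicator (fun r : ℝ => |tubeJac g ν (t + r * I)|) r := fun r => by
        by_cases hr : g t + r • ν t ∈ S
        · rw [Set.indicator_of_mem hr, Set.indicator_of_mem (s := W) hr, mul_one]
        · rw [Set.indicator_of_notMem hr, Set.indicator_of_notMem (s := W) hr, mul_zero]
      simp only [e]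
      have hWm : MeasurableSet W := by
        have hcont : Continuous fun r : ℝ => g t + r • ν t := by fun_prop
        exact hcont.measurable hSm
      rw [setIntegral_indicator hWm]
      have hle : ∀ r ∈ Set.Ioo (-s₀) s₀ ∩ W, ‖|tubeJac g ν (t + r * I)|‖ ≤ 1 + CJ := fun r hr => by
        rw [Real.norm_eq_abs, abs_abs]
        have h1 := (abs_le.1 (hJ (t + r * I))).2
        have h2 : |((t : ℂ) + r * I).im| ≤ 1 := by
          simpa using (abs_lt.2 hr.1).le.trans (hs₀1.trans (min_le_right _ _))
        nlinarith
      have hvol : volume (Set.Ioo (-s₀) s₀ ∩ W) ≤ ENNReal.ofReal (2 / c * (q - p)) := by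
        refine (Real.volume_le_diam _).trans (Metric.ediam_le_of_forall_dist_le ?_)
        have hone : ∀ r ∈ Set.Ioo (-s₀) s₀ ∩ W, ∀ r' ∈ Set.Ioo (-s₀) s₀ ∩ W, r' ≤ r →
            r - r' ≤ 2 / c * (q - p) := fun r hr r' hr' hrr => by
          have hs : s₀ ≤ s₁ := hs₀1.trans (min_le_left _ _)
          have h1 := hmono t r r' ((abs_lt.2 hr.1).le.trans hs) ((abs_lt.2 hr'.1).le.trans hs) hrr
          have h2 := hr.2.2
          have h3 := hr'.2.1
          rw [div_mul_eq_mul_div, le_div_iff₀ hc]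
          nlinarith
        intro r hr r' hr'
        rw [Real.dist_eq]
        rcases le_total r' r with hrr | hrr
        · rw [abs_of_nonneg (by linarith)]; exact hone r hr r' hr' hrr
        · rw [abs_sub_comm, abs_of_nonneg (by linarith)]; exact hone r' hr' r hr hrr
      have hn := norm_setIntegral_le_of_norm_le_const (hvol.trans_lt ENNReal.ofReal_lt_top) hle
      rw [Real.norm_eq_abs] at hn
      refine hn.trans ?_
      gcongr
      exact ENNReal.toReal_le_of_le_ofReal (mul_nonneg (by positivity) (by linarith)) hvol
  rw [setIntegral_indicator hSm, setIntegral_const, intervalIntegral.integral_zero, sub_zero,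
    smul_eq_mul, mul_one, abs_of_nonneg measureReal_nonneg] at this
  linarith

/-- The integral of `ρ` over the band `{0 < y ≤ b}` to leading order. -/
lemma exists_band_integral (h : IsZeroCurve ρ L g ν) : ∃ C > 0, ∃ b₀ > 0, ∀ b : ℝ, 0 < b → b ≤ b₀ →
    |(∫ z in Efd ∩ {z | 0 < normFun ρ z ∧ normFun ρ z ≤ b}, ρ z) -
      b ^ 2 / 2 * ∫ t in (0 : ℝ)..L, fderiv ℝ ρ (g t) (ν t) ^ (1 / 3 : ℝ)| ≤ C * b ^ 3 := by
  have hy := contDiff_normFun h.contDiff h.nondegenerate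
  have hyp : PeriodicC (normFun ρ) := h.periodic.normFun
  have hρc := h.contDiff.continuous
  have hy0 : ∀ t, normFun ρ (g t) = 0 := fun t =>
    (normFun_eq_zero_iff h.nondegenerate _).2 (h.zero t)
  obtain ⟨c, hc, hcb⟩ := h.exists_normFun_normal_ge
  obtain ⟨K, hK, hKb⟩ := h.exists_normal_deriv_le
  obtain ⟨s₁, hs₁, hmono⟩ := h.exists_slice_mono hyp (hy.of_le (by norm_cast)) hc hcb
  obtain ⟨C₁, hC₁, hJ⟩ := h.exists_tubeJac_bound
  obtain ⟨C₂, hC₂, hY⟩ := h.exists_slice_taylor hyp (hy.of_le (by norm_cast)) hy0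
  obtain ⟨C₃, hC₃, hR⟩ := h.exists_slice_taylor h.periodic (h.contDiff.of_le (by norm_cast)) h.zero
  obtain ⟨s₀, hs₀, hs₀1, b₀, hb₀, key⟩ := h.exists_abs_setIntegral_sub_le hy.continuous hyp
    (fun z hz => (normFun_eq_zero_iff h.nondegenerate z).1 hz) (lt_min hs₁ zero_lt_one)
  have hL := h.length_pos
  obtain ⟨B, hB, hBb⟩ := h.periodic.bounded hρc
  set C := C₁ + C₂ + C₃ with hCdef
  have hC : 0 < C := by positivity
  set c' := c / 2 with hc'
  have hc'0 : 0 < c' := by positivity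
  set D := (C * (K + C) + C) / c' ^ 3 + 2 * ((1 + C) * (K + C) / c') * (C / c' ^ 3) with hD
  refine ⟨L * D, by positivity, min b₀ (c' * s₀ / 2), by positivity, fun b hb hbb => ?_⟩
  set S : Set ℂ := {z | 0 < normFun ρ z ∧ normFun ρ z ≤ b} with hS
  have hSm : MeasurableSet S :=
    (measurableSet_lt measurable_const hy.continuous.measurable).inter
      (measurableSet_le hy.continuous.measurable measurable_const)
  have hper : PeriodicC (S.indicator ρ) := by
    classical
    have : S.indicator ρ =
        fun z => if 0 < normFun ρ z ∧ normFun ρ z ≤ b then ρ z else 0 := by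
      funext z; simp [Set.indicator_apply, hS]
    rw [this]
    exact hyp.comp₂ h.periodic fun a r => if 0 < a ∧ a ≤ b then r else 0
  have hac : Continuous fun t => fderiv ℝ ρ (g t) (ν t) ^ (1 / 3 : ℝ) :=
    h.continuous_normal_deriv.rpow_const fun t => Or.inr (by norm_num)
  have := key (S.indicator ρ) (hρc.measurable.indicator hSm) hper
    ⟨B, fun z => (Set.indicator_apply S ρ z ▸ by
      split_ifs
      · exact hBb z
      · simpa using hB.le)⟩ (fun z hz => by
      have hzS : z ∈ S := by
        by_contra hn
        exact hz (Set.indicator_of_notMem hn _)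
      have := hzS.1
      exact abs_le.2 ⟨by linarith, hzS.2.trans (hbb.trans (min_le_left _ _))⟩)
    (fun t => b ^ 2 / 2 * fderiv ℝ ρ (g t) (ν t) ^ (1 / 3 : ℝ)) (continuous_const.mul hac)
    (D * b ^ 3) fun t => by
      have ha := h.pos t
      set a := fderiv ℝ ρ (g t) (ν t) with hadef
      have hα : fderiv ℝ (normFun ρ) (g t) (ν t) = a ^ (1 / 3 : ℝ) := h.fderiv_normFun_normal t
      have hα0 : 0 < a ^ (1 / 3 : ℝ) := by positivity
      have hline : Continuous fun r : ℝ => g t + r • ν t := by fun_prop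
      have hs : s₀ ≤ s₁ := hs₀1.trans (min_le_left _ _)
      have htube : ∀ r : ℝ, tube g ν (t + r * I) = g t + r • ν t := fun r => by simp [tube]
      have est := abs_slice_integral_sub_le (Y := fun r => normFun ρ (g t + r • ν t))
        (R := fun r => ρ (g t + r • ν t)) (J := fun r : ℝ => |tubeJac g ν (t + r * I)|)
        (hy.continuous.comp hline) (hρc.comp hline)
        (h.continuous_tubeJac.abs.comp (by fun_prop)) (c := c') (C := C) (K := K) (a := a)
        (α := a ^ (1 / 3 : ℝ)) (b := b) hs₀ (hs₀1.trans (min_le_right _ _)) hc'0 hC hK ha (hKb t)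
        (by rw [← hα]; linarith [hcb t]) hb
        (by linarith [hbb.trans (min_le_right _ _), mul_pos hc'0 hs₀]) (by simpa using hy0 t)
        (fun s s' h1 h2 h3 => hmono t s s' (h1.trans hs) (h2.trans hs) h3)
        (fun r => by
          have := hY (t + r * I)
          rw [htube] at this
          simp only [add_re, ofReal_re, mul_re, I_re, mul_zero, ofReal_im, I_im, mul_one, sub_self,
            add_zero, add_im, mul_im, zero_add, hα] at this
          refine this.trans ?_
          gcongr
          linarith)
        (fun r => by
          have := hR (t + r * I)
          rw [htube] at this
          simp only [add_re, ofReal_re, mul_re, I_re, mul_zero, ofReal_im, I_im, mul_one, sub_self,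
            add_zero, add_im, mul_im, zero_add] at this
          refine this.trans ?_
          gcongr
          linarith)
        (fun r => by
          have := hJ (t + r * I)
          simp only [add_im, ofReal_im, mul_im, ofReal_re, I_im, mul_one, I_re, mul_zero,
            add_zero, zero_add] at this
          refine this.trans ?_
          gcongr
          linarith)
      have e1 : a * (b / a ^ (1 / 3 : ℝ)) ^ 2 / 2 = b ^ 2 / 2 * a ^ (1 / 3 : ℝ) := by
        have e3 : (a ^ (1 / 3 : ℝ)) ^ 3 = a := by
          rw [← Real.rpow_natCast, ← Real.rpow_mul ha.le]; norm_num
        set α := a ^ (1 / 3 : ℝ)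
        rw [← e3]
        field_simp
      rw [e1] at est
      exact est
  rw [setIntegral_indicator hSm, intervalIntegral.integral_const_mul] at this
  linarith

end IsZeroCurve

lemma setIntegral_le_add_of_subset_union {f : ℂ → ℝ} (hf : Continuous f) (hf0 : ∀ z, 0 ≤ f z)
    {s t u : Set ℂ} (h : s ⊆ t ∪ u) (ht : MeasurableSet t) (hu : MeasurableSet u) :
    (∫ z in Efd ∩ s, f z) ≤ (∫ z in Efd ∩ t, f z) + ∫ z in Efd ∩ u, f z := by
  have hi : ∀ v : Set ℂ, IntegrableOn f (Efd ∩ v) := fun v =>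
    hf.integrableOn_Efd.mono_set Set.inter_subset_left
  have e : Efd ∩ (t ∪ u) = (Efd ∩ t) ∪ (Efd ∩ (u \ t)) := by
    rw [← Set.inter_union_distrib_left, Set.union_sdiff_self]
  calc (∫ z in Efd ∩ s, f z) ≤ ∫ z in Efd ∩ (t ∪ u), f z :=
        setIntegral_mono_set (hi _) (ae_of_all _ hf0)
          (Set.inter_subset_inter_right _ h).eventuallyLE
    _ = (∫ z in Efd ∩ t, f z) + ∫ z in Efd ∩ (u \ t), f z := by
        rw [e, setIntegral_union _ (measurableSet_Efd.inter (hu.diff ht)) (hi _) (hi _)]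
        exact Set.disjoint_left.2 fun z hz hz' => hz'.2.2 hz.2
    _ ≤ _ := by
        gcongr 1
        exact setIntegral_mono_set (hi _) (ae_of_all _ hf0)
          (Set.inter_subset_inter_right _ Set.sdiff_subset).eventuallyLE

lemma setIntegral_abs_le_mul_volume {f : ℂ → ℝ} {s : Set ℂ} {c : ℝ}
    (h : ∀ z ∈ Efd ∩ s, |f z| ≤ c) : (∫ z in Efd ∩ s, |f z|) ≤ c * volume.real (Efd ∩ s) := by
  refine (Real.le_norm_self _).trans ?_
  exact norm_setIntegral_le_of_norm_le_const
    ((measure_mono Set.inter_subset_left).trans_lt volume_Efd_lt_top) fun z hz =>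
      (norm_abs_eq_norm (f z)).trans_le (h z hz)

lemma measurableSet_band {y : ℂ → ℝ} (hy : Continuous y) (p q : ℝ) :
    MeasurableSet {z | p ≤ y z ∧ y z ≤ q} :=
  ((isClosed_le continuous_const hy).inter (isClosed_le hy continuous_const)).measurableSet

lemma volume_band_le_volume_band {y : ℂ → ℝ} {p q p' q' : ℝ} (hp : p' ≤ p) (hq : q ≤ q') :
    volume.real (Efd ∩ {z | p ≤ y z ∧ y z ≤ q}) ≤ volume.real (Efd ∩ {z | p' ≤ y z ∧ y z ≤ q'}) :=
  measureReal_mono (Set.inter_subset_inter_right _ fun _ hz => ⟨hp.trans hz.1, hz.2.trans hq⟩)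
    ((measure_mono Set.inter_subset_left).trans_lt volume_Efd_lt_top).ne

/-- The Laplacian of the lowered weight is small in mean over the band `|y| ≤ T`. -/
lemma exists_integral_abs_lapC_loweredWeight_le {φ : ℂ → ℝ} {L : ℝ} {g ν : ℝ → ℂ}
    (hφ : ContDiff ℝ (⊤ : ℕ∞) φ) (hφp : PeriodicC φ) (h : IsZeroCurve (lapC φ) L g ν) :
    ∃ C > 0, ∃ T₀ > 0, ∀ T δ, 0 < T → T ≤ T₀ → 0 < δ → δ < 1 →
      (∫ z in Efd ∩ {z | -T ≤ normFun (lapC φ) z ∧ normFun (lapC φ) z ≤ T},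
        |lapC (loweredWeight φ (normFun (lapC φ)) T δ) z|) ≤ C * (T ^ 2 * (T + δ)) := by
  obtain ⟨A, hA, HA⟩ := exists_abs_lapC_loweredWeight_le hφ hφp h.nondegenerate
  obtain ⟨B, hB, b₀, hb₀, HB⟩ := h.exists_band_volume_le
  have hy := contDiff_normFun h.contDiff h.nondegenerate
  refine ⟨2 * A * B, by positivity, min b₀ 1, lt_min hb₀ one_pos, fun T δ hT hT₀ hδ hδ1 => ?_⟩
  have hTb := hT₀.trans (min_le_left _ _)
  have hT1 := hT₀.trans (min_le_right _ _)
  have HA := HA T δ hT hT1 hδ hδ1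
  have hψ : ContDiff ℝ 2 (loweredWeight φ (normFun (lapC φ)) T δ) :=
    contDiff_loweredWeight (hφ.of_le (by norm_cast)) (hy.of_le (by norm_cast)) T δ
  have hc := (ContDiff.lapC (m := 0) (n := 2) hψ (by norm_num)).continuous.abs
  set y := normFun (lapC φ)
  set F := lapC (loweredWeight φ y T δ)
  have hm := measurableSet_band hy.continuous
  have hδT : δ * T ≤ T := by nlinarith
  have hδT0 : 0 < δ * T := by positivity
  have h1 := setIntegral_le_add_of_subset_union hc (fun z => abs_nonneg (F z))
    (s := {z | -T ≤ y z ∧ y z ≤ T})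
    (t := {z | -T ≤ y z ∧ y z ≤ -((1 - δ) * T)}) (u := {z | -((1 - δ) * T) ≤ y z ∧ y z ≤ T})
    (fun z hz => (le_total (y z) (-((1 - δ) * T))).imp (fun a => ⟨hz.1, a⟩) fun a => ⟨a, hz.2⟩)
    (hm _ _) (hm _ _)
  have h2 := setIntegral_le_add_of_subset_union hc (fun z => abs_nonneg (F z))
    (s := {z | -((1 - δ) * T) ≤ y z ∧ y z ≤ T})
    (t := {z | -((1 - δ) * T) ≤ y z ∧ y z ≤ (1 - δ) * T}) (u := {z | (1 - δ) * T ≤ y z ∧ y z ≤ T})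
    (fun z hz => (le_total (y z) ((1 - δ) * T)).imp (fun a => ⟨hz.1, a⟩) fun a => ⟨a, hz.2⟩)
    (hm _ _) (hm _ _)
  have h3 : (∫ z in Efd ∩ {z | -T ≤ y z ∧ y z ≤ -((1 - δ) * T)}, |F z|) ≤
      A * T * (B * (-((1 - δ) * T) - -T)) :=
    (setIntegral_abs_le_mul_volume fun z hz => (HA z
      (abs_le.2 ⟨hz.2.1, hz.2.2.trans (by nlinarith)⟩)).1).trans (by
        gcongr; exact HB _ _ (by linarith) (by nlinarith) (by nlinarith))
  have h4 : (∫ z in Efd ∩ {z | (1 - δ) * T ≤ y z ∧ y z ≤ T}, |F z|) ≤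
      A * T * (B * (T - (1 - δ) * T)) :=
    (setIntegral_abs_le_mul_volume fun z hz => (HA z
      (abs_le.2 ⟨le_trans (by nlinarith) hz.2.1, hz.2.2⟩)).1).trans (by
        gcongr; exact HB _ _ (by nlinarith) (by nlinarith) (by linarith))
  have h5 : (∫ z in Efd ∩ {z | -((1 - δ) * T) ≤ y z ∧ y z ≤ (1 - δ) * T}, |F z|) ≤
      A * T ^ 2 * (B * (T - -T)) :=
    (setIntegral_abs_le_mul_volume fun z hz => (HA z
      ((abs_le.2 hz.2).trans (by nlinarith))).2 (abs_le.2 hz.2)).trans (by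
        gcongr
        exact (volume_band_le_volume_band (by nlinarith) (by nlinarith)).trans
          (HB _ _ (by linarith) (by linarith) hTb))
  calc _ ≤ _ := h1
    _ ≤ _ := add_le_add h3 (h2.trans (add_le_add h5 h4))
    _ = _ := by ring

/-- The two-sided estimate of the Laplacian masses of the lowered weight. -/
lemma exists_loweredWeight_mass_bounds {φ : ℂ → ℝ} {L : ℝ} {g ν : ℝ → ℂ}
    (hφ : ContDiff ℝ (⊤ : ℕ∞) φ) (hφp : PeriodicC φ) (h : IsZeroCurve (lapC φ) L g ν) :
    ∃ C > 0, ∃ T₀ > 0, ∀ T δ, 0 < T → T ≤ T₀ → 0 < δ → δ < 1 →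
      (∫ z in Efd, max (lapC (loweredWeight φ (normFun (lapC φ)) T δ) z) 0) ≤
        (∫ z in {z | 0 < lapC φ z} ∩ Efd, lapC φ z) -
          T ^ 2 / 2 * (∫ t in (0 : ℝ)..L, fderiv ℝ (lapC φ) (g t) (ν t) ^ (1 / 3 : ℝ)) +
          C * (T ^ 2 * (T + δ)) ∧
      (∫ z in {z | 0 < lapC φ z} ∩ Efd, lapC φ z) -
          T ^ 2 / 2 * (∫ t in (0 : ℝ)..L, fderiv ℝ (lapC φ) (g t) (ν t) ^ (1 / 3 : ℝ)) -
          C * (T ^ 2 * (T + δ)) ≤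
        (∫ z in Efd ∩ {z | T ≤ normFun (lapC φ) z},
            lapC (loweredWeight φ (normFun (lapC φ)) T δ) z) -
          ∫ z in Efd ∩ {z | -(T * (1 + δ)) < normFun (lapC φ) z ∧ normFun (lapC φ) z < T},
            max (-lapC (loweredWeight φ (normFun (lapC φ)) T δ) z) 0 := by
  obtain ⟨A, hA, T₁, hT₁, HA⟩ := exists_integral_abs_lapC_loweredWeight_le hφ hφp h
  obtain ⟨B, hB, b₀, hb₀, HB⟩ := h.exists_band_volume_le
  obtain ⟨D, hD, b₁, hb₁, HD⟩ := h.exists_band_integral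
  obtain ⟨K, hK, HK⟩ := exists_abs_le_mul_normFun h.contDiff h.periodic h.nondegenerate
  have hy := contDiff_normFun h.contDiff h.nondegenerate
  have hρc := h.contDiff.continuous
  refine ⟨A + D + K * 2 * B, by positivity, min T₁ (min (b₀ / 2) b₁), by positivity,
    fun T δ hT hT₀ hδ hδ1 => ?_⟩
  have hTT₁ : T ≤ T₁ := hT₀.trans (min_le_left _ _)
  have hTb₀ : T ≤ b₀ / 2 := (hT₀.trans (min_le_right _ _)).trans (min_le_left _ _)
  have hTb₁ : T ≤ b₁ := (hT₀.trans (min_le_right _ _)).trans (min_le_right _ _)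
  have HA := HA T δ hT hTT₁ hδ hδ1
  have HD := abs_le.1 (HD T hT hTb₁)
  have hψ : ContDiff ℝ 2 (loweredWeight φ (normFun (lapC φ)) T δ) :=
    contDiff_loweredWeight (hφ.of_le (by norm_cast)) (hy.of_le (by norm_cast)) T δ
  have hc := (ContDiff.lapC (m := 0) (n := 2) hψ (by norm_num)).continuous
  have houter : ∀ z, T ≤ |normFun (lapC φ) z| →
      lapC (loweredWeight φ (normFun (lapC φ)) T δ) z = lapC φ z := fun z hz =>
    lapC_loweredWeight_outer (hφ.of_le (by norm_cast)) (hy.of_le (by norm_cast)) hT hδ hδ1 hz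
  have hyρ := normFun_pos_iff h.nondegenerate
  set ρ := lapC φ
  set y := normFun ρ
  set F := lapC (loweredWeight φ y T δ)
  set I₀ := ∫ t in (0 : ℝ)..L, fderiv ℝ ρ (g t) (ν t) ^ (1 / 3 : ℝ)
  have hm := measurableSet_band hy.continuous
  have hmax : Continuous fun z => max (ρ z) 0 := hρc.max continuous_const
  have hmaxF : Continuous fun z => max (F z) 0 := hc.max continuous_const
  have hP : (∫ z in {z | 0 < ρ z} ∩ Efd, ρ z) = ∫ z in Efd, max (ρ z) 0 := by
    have hpos : MeasurableSet {z | 0 < ρ z} := (isOpen_lt continuous_const hρc).measurableSet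
    rw [Set.inter_comm, ← setIntegral_indicator hpos]
    refine setIntegral_congr_fun measurableSet_Efd fun z _ => ?_
    by_cases hz : 0 < ρ z
    · rw [Set.indicator_of_mem (by exact hz), max_eq_left hz.le]
    · rw [Set.indicator_of_notMem (by exact hz), max_eq_right (not_lt.1 hz)]
  have hband : (∫ z in Efd ∩ {z | 0 < y z ∧ y z ≤ T}, ρ z) =
      ∫ z in Efd ∩ {z | -T ≤ y z ∧ y z ≤ T}, max (ρ z) 0 := by
    have e : (∫ z in Efd ∩ {z | 0 < y z ∧ y z ≤ T}, ρ z) =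
        ∫ z in Efd ∩ {z | 0 < y z ∧ y z ≤ T}, max (ρ z) 0 := by
      refine setIntegral_congr_fun ?_ fun z hz => (max_eq_left ((hyρ z).1 hz.2.1).le).symm
      exact measurableSet_Efd.inter ((isOpen_lt continuous_const hy.continuous).measurableSet.inter
        (isClosed_le hy.continuous continuous_const).measurableSet)
    rw [e]
    refine (setIntegral_eq_of_subset_of_forall_sdiff_eq_zero (measurableSet_Efd.inter (hm _ _))
      (Set.inter_subset_inter_right _ fun z hz => ⟨by linarith [hz.1], hz.2⟩) fun z hz => ?_).symm
    refine max_eq_right (not_lt.1 fun hp => hz.2 ⟨hz.1.1, (hyρ z).2 hp, hz.1.2.2⟩)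
  have hsplit := integral_inter_add_sdiff (hm (-T) T) hmax.integrableOn_Efd
  have hsplitF := integral_inter_add_sdiff (hm (-T) T) hmaxF.integrableOn_Efd
  have hTT : 0 ≤ T ^ 2 * δ := by positivity
  rw [hP]
  rw [hband] at HD
  constructor
  · have e1 : (∫ z in Efd \ {z | -T ≤ y z ∧ y z ≤ T}, max (F z) 0) =
        ∫ z in Efd \ {z | -T ≤ y z ∧ y z ≤ T}, max (ρ z) 0 := by
      refine setIntegral_congr_fun (measurableSet_Efd.diff (hm _ _)) fun z hz => ?_
      have : T ≤ |y z| := le_of_not_ge fun hle => hz.2 (abs_le.1 hle)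
      simp only [houter z this]
    have e2 : (∫ z in Efd ∩ {z | -T ≤ y z ∧ y z ≤ T}, max (F z) 0) ≤
        ∫ z in Efd ∩ {z | -T ≤ y z ∧ y z ≤ T}, |F z| :=
      setIntegral_mono (hmaxF.integrableOn_Efd.mono_set Set.inter_subset_left)
        (hc.abs.integrableOn_Efd.mono_set Set.inter_subset_left)
        fun z => max_le (le_abs_self _) (abs_nonneg _)
    have : 0 ≤ K * 2 * B * (T ^ 2 * (T + δ)) := by positivity
    have : 0 ≤ D * (T ^ 2 * δ) := by positivity
    linarith
  · have e1 : (∫ z in Efd ∩ {z | T ≤ y z}, F z) = ∫ z in Efd ∩ {z | T ≤ y z}, max (ρ z) 0 := by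
      refine setIntegral_congr_fun (measurableSet_Efd.inter
        (isClosed_le continuous_const hy.continuous).measurableSet) fun z hz => ?_
      have hTy : T ≤ y z := hz.2
      simp only [houter z (hTy.trans (le_abs_self _))]
      exact (max_eq_left ((hyρ z).1 (hT.trans_le hTy)).le).symm
    have e2 : (∫ z in Efd \ {z | -T ≤ y z ∧ y z ≤ T}, max (ρ z) 0) ≤
        ∫ z in Efd ∩ {z | T ≤ y z}, max (ρ z) 0 := by
      have hsub : Efd ∩ {z | T < y z} ⊆ Efd \ {z | -T ≤ y z ∧ y z ≤ T} :=
        fun z hz => ⟨hz.1, fun hz' => absurd hz.2 (not_lt.2 hz'.2)⟩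
      rw [setIntegral_eq_of_subset_of_forall_sdiff_eq_zero (measurableSet_Efd.diff (hm _ _)) hsub
        fun z hz => max_eq_right (not_lt.1 fun hp => hz.2 ⟨hz.1.1, not_le.1 fun hle =>
          hz.1.2 ⟨by linarith [(hyρ z).2 hp], hle⟩⟩)]
      exact setIntegral_mono_set (hmax.integrableOn_Efd.mono_set Set.inter_subset_left)
        (ae_of_all _ fun z => le_max_right _ _)
        (Set.inter_subset_inter_right _ fun z (hz : T < y z) => hz.le).eventuallyLE
    have e3 : (∫ z in Efd ∩ {z | -(T * (1 + δ)) < y z ∧ y z < T}, max (-F z) 0) ≤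
        ∫ z in Efd ∩ {z | -(T * (1 + δ)) < y z ∧ y z < T}, |F z| :=
      setIntegral_mono
        ((hc.neg.max continuous_const).integrableOn_Efd.mono_set Set.inter_subset_left)
        (hc.abs.integrableOn_Efd.mono_set Set.inter_subset_left)
        fun z => max_le (neg_le_abs _) (abs_nonneg _)
    have e4 := setIntegral_le_add_of_subset_union hc.abs (fun z => abs_nonneg (F z))
      (s := {z | -(T * (1 + δ)) < y z ∧ y z < T}) (t := {z | -T ≤ y z ∧ y z ≤ T})
      (u := {z | -(T * (1 + δ)) ≤ y z ∧ y z ≤ -T})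
      (fun z hz => (le_total (-T) (y z)).imp (fun a => ⟨a, hz.2.le⟩) fun a => ⟨hz.1.le, a⟩)
      (hm _ _) (hm _ _)
    have hTδ : T * δ ≤ T := by nlinarith
    have hTδ0 : 0 < T * δ := by positivity
    have e5 : (∫ z in Efd ∩ {z | -(T * (1 + δ)) ≤ y z ∧ y z ≤ -T}, |F z|) ≤
        K * (2 * T) * (B * (-T - -(T * (1 + δ)))) := by
      refine (setIntegral_abs_le_mul_volume fun z hz => ?_).trans
        (mul_le_mul_of_nonneg_left (HB _ _ ?_ ?_ ?_) (by positivity))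
      · have hy0 : y z ≤ -T := hz.2.2
        have hy1 : -(T * (1 + δ)) ≤ y z := hz.2.1
        have habs : |y z| = -y z := abs_of_nonpos (by linarith)
        rw [houter z (by rw [habs]; linarith)]
        refine (HK z).trans ?_
        gcongr
        rw [habs]
        linarith
      all_goals linarith
    have : K * (2 * T) * (B * (-T - -(T * (1 + δ)))) = K * 2 * B * (T ^ 2 * δ) := by ring
    have : 0 ≤ K * 2 * B * T ^ 3 := by positivity
    have : 0 ≤ D * (T ^ 2 * δ) := by positivity
    linarith

lemma exists_cube_root_mul {s : ℝ} (hs : 0 < s) (hs1 : s ≤ 1) :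
    ∃ r : ℝ, 1 ≤ r ∧ r ≤ 2 ∧ r ^ 3 = 1 + 3 * s ∧ r ^ 2 ≤ 1 + 3 * s := by
  have hr3 : ((1 + 3 * s) ^ (1 / 3 : ℝ)) ^ 3 = 1 + 3 * s := by
    rw [← Real.rpow_natCast, ← Real.rpow_mul (by positivity)]; norm_num
  have hr1 : 1 ≤ (1 + 3 * s) ^ (1 / 3 : ℝ) := Real.one_le_rpow (by linarith) (by norm_num)
  refine ⟨_, hr1, le_of_pow_le_pow_left₀ (n := 3) (by norm_num) (by norm_num)
    (by rw [hr3]; linarith), hr3, ?_⟩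
  calc _ ≤ ((1 + 3 * s) ^ (1 / 3 : ℝ)) ^ 3 := pow_le_pow_right₀ hr1 (by norm_num)
    _ = _ := hr3

/-- The Weyl law in terms of the cube root `s` of the decay rate. -/
lemma exists_cube_root_weyl_bound {φ : ℂ → ℝ} {L : ℝ} {g ν : ℝ → ℂ}
    (hφ : ContDiff ℝ (⊤ : ℕ∞) φ) (hφp : PeriodicC φ) (hcurve : IsZeroCurve (lapC φ) L g ν) :
    ∃ C > 0, ∃ s₀ > 0, ∀ s : ℝ, 0 < s → s ≤ s₀ → ∀ ε > 0, ∃ h₀ > 0,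
      ∀ h : ℝ, 0 < h → h ≤ h₀ →
        |2 * π * h * countN φ (Real.exp (-s ^ 3 / h)) h -
          ((∫ z in {z | 0 < lapC φ z} ∩ Efd, lapC φ z) -
            (((3 / 2 : ℝ) ^ (1 / 3 : ℝ)) * s) ^ 2 / 2 *
              ∫ t in (0 : ℝ)..L, fderiv ℝ (lapC φ) (g t) (ν t) ^ (1 / 3 : ℝ))| ≤ C * s ^ 3 + ε := by
  obtain ⟨C, hC, T₀, hT₀, H⟩ := exists_loweredWeight_mass_bounds hφ hφp hcurve
  have hy := contDiff_normFun hcurve.contDiff hcurve.nondegenerate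
  have hφ2 : ContDiff ℝ 2 φ := hφ.of_le (by norm_cast)
  have hy2 : ContDiff ℝ 2 (normFun (lapC φ)) := hy.of_le (by norm_cast)
  have hyp := hcurve.periodic.normFun
  have hI0 : 0 ≤ ∫ t in (0 : ℝ)..L, fderiv ℝ (lapC φ) (g t) (ν t) ^ (1 / 3 : ℝ) :=
    intervalIntegral.integral_nonneg hcurve.length_pos.le fun t _ =>
      Real.rpow_nonneg (hcurve.pos t).le _
  have hk3 : ((3 / 2 : ℝ) ^ (1 / 3 : ℝ)) ^ 3 = 3 / 2 := by
    rw [← Real.rpow_natCast, ← Real.rpow_mul (by norm_num)]; norm_num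
  have hk0 : 0 < (3 / 2 : ℝ) ^ (1 / 3 : ℝ) := Real.rpow_pos_of_pos (by norm_num) _
  have hk2 : (3 / 2 : ℝ) ^ (1 / 3 : ℝ) ≤ 2 :=
    le_of_pow_le_pow_left₀ (n := 3) (by norm_num) (by norm_num) (by rw [hk3]; norm_num)
  set k := (3 / 2 : ℝ) ^ (1 / 3 : ℝ)
  set J := ∫ t in (0 : ℝ)..L, fderiv ℝ (lapC φ) (g t) (ν t) ^ (1 / 3 : ℝ)
  refine ⟨80 * C + 6 * J, by positivity, min (T₀ / 4) (1 / 4), by positivity,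
    fun s hs hs₀ ε hε => ?_⟩
  have hsT : s ≤ T₀ / 4 := hs₀.trans (min_le_left _ _)
  have hs4 : s ≤ 1 / 4 := hs₀.trans (min_le_right _ _)
  obtain ⟨r, hr1, hr2, hr3, hr4⟩ := exists_cube_root_mul hs (by linarith)
  have hs1 : s < 1 := by linarith
  have hT4 : k * s ≤ 4 * s := by nlinarith
  have hTr4 : k * s * r ≤ 4 * s := by
    calc k * s * r ≤ 2 * s * 2 := by gcongr
      _ = _ := by ring
  have herr : ∀ T, 0 < T → T ≤ 4 * s → C * (T ^ 2 * (T + s)) ≤ 80 * C * s ^ 3 := fun T h0 hT => by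
    calc C * (T ^ 2 * (T + s)) ≤ C * ((4 * s) ^ 2 * (4 * s + s)) := by gcongr
      _ = _ := by ring
  have hpm : 2 / 3 * (k * s) ^ 3 * profileMax s < s ^ 3 := by
    have : 2 / 3 * (k * s) ^ 3 * profileMax s = s ^ 3 * profileMax s := by rw [mul_pow, hk3]; ring
    rw [this]
    refine mul_lt_of_lt_one_right (by positivity) ?_
    rw [profileMax]; nlinarith
  have hpm' : s ^ 3 < 2 / 3 * (k * s * r) ^ 3 * profileMax s := by
    have : 2 / 3 * (k * s * r) ^ 3 * profileMax s = s ^ 3 * ((1 + 3 * s) * profileMax s) := by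
      rw [mul_pow, mul_pow, hk3, hr3]; ring
    rw [this]
    refine lt_mul_of_one_lt_right (by positivity) ?_
    have : (1 + 3 * s) * profileMax s = 1 + s * (3 / 2 - 4 * s) + 3 / 2 * s ^ 3 := by
      rw [profileMax]; ring
    have : 0 < s * (3 / 2 - 4 * s) := mul_pos hs (by linarith)
    have : 0 < 3 / 2 * s ^ 3 := by positivity
    linarith
  have hT0 : 0 < k * s := by positivity
  have hTr0 : 0 < k * s * r := by positivity
  obtain ⟨h₁, hh₁, H₁⟩ := two_pi_mul_countN_le hφ.continuous
    (contDiff_loweredWeight hφ2 hy2 (k * s) s) (hφp.loweredWeight hyp (k * s) s) hpm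
    (le_loweredWeight hT0 hs hs1) (loweredWeight_le hT0 hs hs1) hε
  obtain ⟨h₂, hh₂, H₂⟩ := le_two_pi_mul_countN hφ2 hφp
    (contDiff_loweredWeight hφ2 hy2 (k * s * r) s) (hφp.loweredWeight hyp (k * s * r) s) hy hyp
    (τ := s ^ 3) (η := 2 / 3 * (k * s * r) ^ 3 * profileMax s - s ^ 3)
    (c₀ := -(k * s * r * (1 + s))) (c₁ := -(k * s * r * (1 + s / 2))) (c₂ := -(k * s * r))
    (c₃ := k * s * r) (by positivity) (by linarith) (by nlinarith) (by nlinarith) (by linarith)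
    (fun z _ hz => by rw [loweredWeight_of_le_neg hTr0 hs hs1 hz]; linarith)
    (fun z hz => (loweredWeight_of_le hTr0 hs hs1 hz).ge) hε
  refine ⟨min h₁ h₂, lt_min hh₁ hh₂, fun h hh hle => ?_⟩
  have U₁ := H₁ h hh (hle.trans (min_le_left _ _))
  have U₂ := H₂ h hh (hle.trans (min_le_right _ _))
  have V₁ := (H (k * s) s hT0 (by linarith) hs hs1).1
  have V₂ := (H (k * s * r) s hTr0 (by linarith) hs hs1).2
  have E₁ := herr _ hT0 hT4
  have E₂ := herr _ hTr0 hTr4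
  have hJ : (k * s * r) ^ 2 / 2 * J ≤ (k * s) ^ 2 / 2 * J + 6 * J * s ^ 3 := by
    calc (k * s * r) ^ 2 / 2 * J = (k * s) ^ 2 * r ^ 2 / 2 * J := by ring
      _ ≤ (k * s) ^ 2 * (1 + 3 * s) / 2 * J := by gcongr
      _ = (k * s) ^ 2 / 2 * J + k ^ 2 * (3 / 2 * J * s ^ 3) := by ring
      _ ≤ (k * s) ^ 2 / 2 * J + 2 ^ 2 * (3 / 2 * J * s ^ 3) := by gcongr
      _ = _ := by ring
  have : 0 ≤ 6 * J * s ^ 3 := by positivity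
  rw [abs_le]
  constructor <;> linarith

/-- **Theorem (Weyl asymptotics for small exponential decay rates: thin bands of
separation).** -/
theorem weyl_law_small_tau
    (φ : ℂ → ℝ)
    (hφ : ContDiff ℝ (⊤ : ℕ∞) φ) (hφp : PeriodicC φ) (hφnc : ∃ z w : ℂ, φ z ≠ φ w)
    (hnd : ∀ z : ℂ, lapC φ z = 0 → fderiv ℝ (lapC φ) z ≠ 0)
    -- `g` is a smooth unit-speed parametrization of the simple closed curve
    -- `γ = (Δφ)⁻¹(0) ⊆ M`, of length `L`:
    (L : ℝ) (hL : 0 < L) (g : ℝ → ℂ) (hg : ContDiff ℝ (⊤ : ℕ∞) g)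
    (hgper : Function.Periodic g L)
    (hginj : Set.InjOn g (Set.Ico 0 L))
    (hgspeed : ∀ t : ℝ, ‖deriv g t‖ = 1)
    (hgzero : ∀ t : ℝ, lapC φ (g t) = 0)
    (hgall : ∀ z : ℂ, lapC φ z = 0 →
      ∃ (t : ℝ) (m k : ℤ), z = g t + ((2 * Real.pi * (m : ℝ) : ℝ) : ℂ) +
        ((2 * Real.pi * (k : ℝ) : ℝ) : ℂ) * Complex.I)
    -- `ν` is the unit normal `± i g'` along `γ`, oriented so that `∂ₙ Δφ > 0`:
    (ν : ℝ → ℂ)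
    (hν : (∀ t, ν t = Complex.I * deriv g t) ∨ (∀ t, ν t = -(Complex.I * deriv g t)))
    (hpos : ∀ t : ℝ, 0 < fderiv ℝ (lapC φ) (g t) (ν t)) :
    ∀ N : ℕ, 4 ≤ N → ∃ C > 0, ∃ τ₀ > 0, ∀ τ : ℝ, 0 < τ → τ ≤ τ₀ →
      ∀ ε > 0, ∃ h₀ > 0, ∀ h : ℝ, 0 < h → h ≤ h₀ →
        |2 * Real.pi * h * (countN φ (Real.exp (-τ / h)) h : ℝ) -
            ((∫ z in {z | 0 < lapC φ z} ∩ Efd, lapC φ z) -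
              τ ^ ((2 : ℝ) / 3) *
                ((1 / 2) * ((3 : ℝ) / 2) ^ ((2 : ℝ) / 3) *
                  ∫ t in (0 : ℝ)..L, (fderiv ℝ (lapC φ) (g t) (ν t)) ^ ((1 : ℝ) / 3)))| ≤
          C * (τ ^ (((N : ℝ) + 1) / 6) + τ) + ε := by
  intro N _
  have hcurve : IsZeroCurve (lapC φ) L g ν :=
    { contDiff := hφ.lapC (le_of_eq rfl), periodic := hφp.lapC, nondegenerate := hnd
      length_pos := hL, contDiff_curve := hg, periodic_curve := hgper, injOn_curve := hginj
      speed := hgspeed, zero := hgzero, normal := hν, pos := hpos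
      exhaust := fun z hz => by
        obtain ⟨t, m, k, e⟩ := hgall z hz
        exact ⟨t, m, k, by rw [e, lat]; ring⟩ }
  obtain ⟨C, hC, s₀, hs₀, H⟩ := exists_cube_root_weyl_bound hφ hφp hcurve
  refine ⟨C, hC, s₀ ^ 3, by positivity, fun τ hτ hτ₀ ε hε => ?_⟩
  have hs : 0 < τ ^ (1 / 3 : ℝ) := Real.rpow_pos_of_pos hτ _
  have hs3 : (τ ^ (1 / 3 : ℝ)) ^ 3 = τ := by
    rw [← Real.rpow_natCast, ← Real.rpow_mul hτ.le]; norm_num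
  have hle : τ ^ (1 / 3 : ℝ) ≤ s₀ :=
    le_of_pow_le_pow_left₀ (n := 3) (by norm_num) hs₀.le (by rwa [hs3])
  obtain ⟨h₀, hh₀, H⟩ := H _ hs hle ε hε
  refine ⟨h₀, hh₀, fun h hh hhle => ?_⟩
  have H := H h hh hhle
  have two_thirds : ∀ x : ℝ, 0 ≤ x → x ^ (2 / 3 : ℝ) = (x ^ (1 / 3 : ℝ)) ^ 2 := fun x hx => by
    rw [← Real.rpow_natCast, ← Real.rpow_mul hx]; norm_num
  rw [hs3] at H
  rw [two_thirds τ hτ.le, two_thirds (3 / 2) (by norm_num)]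
  have hpow : 0 ≤ C * τ ^ (((N : ℝ) + 1) / 6) := by positivity
  refine le_trans (le_of_eq ?_) (H.trans (by linarith))
  congr 1
  ring
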